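/- arXiv:2003.13139 — 3 statements merged into one kernel-verified Lean document; each statement's English description precedes it below -/
import Mathlib

section
/- There exists a constant C such that every finite simple graph G with maximum degree Δ ≥ 2 and minimum degree δ ≥ C·ln Δ admits a vertex-colouring 3-weighting, i.e. a map ω : E → {1,2,3} such that for every edge uv of G, the weighted degrees Σ_{e ∋ u} ω(e) and Σ_{e ∋ v} ω(e) are distinct. -/
open Finset in
/-- Counting form of independence: a property not depending on the coordinates in `T` and a
property depending only on them hold together on at most the product proportion of functions. -/
theorem card_filter_and_mul_le {V Λ : Type*} [Fintype V] [DecidableEq V] [Fintype Λ]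
    (T : Finset V) (P Q : (V → Λ) → Prop) [DecidablePred P] [DecidablePred Q]
    (hP : ∀ f g, (∀ u, u ∉ T → f u = g u) → P f → P g)
    (hQ : ∀ f g, (∀ u ∈ T, f u = g u) → Q f → Q g) :
    #{f | P f ∧ Q f} * Fintype.card (V → Λ) ≤ #{f | P f} * #{f | Q f} := by
  rw [← Finset.card_univ, ← Finset.card_product, ← Finset.card_product]
  refine Finset.card_le_card_of_injOn
    (fun x => (T.piecewise x.2 x.1, T.piecewise x.1 x.2)) ?_ ?_
  · rintro ⟨f, g⟩ h
    simp only [coe_product, coe_filter, mem_univ, true_and, coe_univ, Set.mem_prod,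
      Set.mem_ofPred_eq, Set.mem_univ, and_true] at h ⊢
    exact ⟨hP f _ (fun u hu => by simp [hu]) h.1, hQ f _ (fun u hu => by simp [hu]) h.2⟩
  · rintro ⟨f, g⟩ - ⟨f', g'⟩ - h
    simp only [Prod.mk.injEq] at h ⊢
    constructor <;> funext u <;>
      (have h1 := congrFun h.1 u; have h2 := congrFun h.2 u
       by_cases hu : u ∈ T <;> simp_all)

open Finset in
/-- A local lemma, in the counting form of Rosenfeld: if the bad events are rare, then some
function avoids all of them. -/
theorem exists_forall_not_bad {V Λ ι : Type*} [Fintype V] [DecidableEq V] [Fintype Λ] [Nonempty Λ]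
    [Fintype ι] (T : ι → Finset V) (bad : ι → (V → Λ) → Prop) [∀ i, DecidablePred (bad i)]
    (hT : ∀ i, (T i).Nonempty)
    (hbad : ∀ i f g, (∀ u ∈ T i, f u = g u) → bad i f → bad i g)
    (p : ι → ℝ) (q : ℝ) (hq : 0 < q) (hq1 : q ≤ 1)
    (hp : ∀ i, (#{f | bad i f} : ℝ) ≤ p i * Fintype.card (V → Λ))
    (hsum : ∀ v, ∑ i with v ∈ T i, p i / q ^ #(T i) ≤ 1 - q) :
    ∃ f, ∀ i, ¬ bad i f := by
  classical
  have hp0 : ∀ i, 0 ≤ p i := fun i => by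
    have h1 : (0 : ℝ) < Fintype.card (V → Λ) := by exact_mod_cast Fintype.card_pos
    have h2 : (0 : ℝ) ≤ p i * Fintype.card (V → Λ) := le_trans (by positivity) (hp i)
    exact nonneg_of_mul_nonneg_left h2 h1
  set M : Finset V → ℕ := fun S => #{f : V → Λ | ∀ i, T i ⊆ S → ¬ bad i f} with hM
  have step : ∀ n : ℕ, ∀ S : Finset V, #S = n → ∀ v, v ∉ S →
      q * (M S : ℝ) ≤ M (insert v S) := by
    intro n
    induction n using Nat.strong_induction_on with
    | _ n ih =>
    intro S hS v hv
    have chain : ∀ D : Finset V, D ⊆ S → q ^ #D * (M (S \ D) : ℝ) ≤ M S := by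
      intro D
      induction D using Finset.induction_on with
      | empty => intro _; simp
      | insert u D hu ihD =>
        intro hD
        have huS : u ∈ S := hD (mem_insert_self _ _)
        have hDS : D ⊆ S := (subset_insert _ _).trans hD
        have hnot : u ∉ S \ insert u D := by simp
        have hins : insert u (S \ insert u D) = S \ D := by
          ext x; by_cases hx : x = u
          · subst hx; simp [huS, hu]
          · simp [hx]
        have hlt : #(S \ insert u D) < n := by
          rw [← hS]
          exact card_lt_card ⟨sdiff_subset, fun h => hnot (h huS)⟩
        have h1 := ih _ hlt _ rfl u hnot
        rw [hins] at h1
        rw [card_insert_of_notMem hu, pow_succ, mul_assoc]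
        exact le_trans (by gcongr) (ihD hDS)
    have hcover : M S ≤ M (insert v S) +
        ∑ i with v ∈ T i, #{f : V → Λ | (∀ j, T j ⊆ S \ T i → ¬ bad j f) ∧ bad i f} := by
      refine le_trans ?_ (Nat.add_le_add_left card_biUnion_le _)
      refine le_trans (card_le_card ?_) (card_union_le _ _)
      intro f hf
      simp only [mem_filter, mem_univ, true_and, mem_union, mem_biUnion] at hf ⊢
      by_contra! hcon
      obtain ⟨⟨i, hi, hbi⟩, hc⟩ := hcon
      refine hc i ?_ (fun j hj => hf j (hj.trans sdiff_subset)) hbi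
      by_contra hvi
      exact hf i (fun x hx => (mem_insert.1 (hi hx)).resolve_left (fun h => hvi (h ▸ hx))) hbi
    have hterm : ∀ i, (#{f : V → Λ | (∀ j, T j ⊆ S \ T i → ¬ bad j f) ∧ bad i f} : ℝ) ≤
        p i / q ^ #(T i) * M S := by
      intro i
      have h1 := card_filter_and_mul_le (T i) (fun f : V → Λ => ∀ j, T j ⊆ S \ T i → ¬ bad j f)
        (bad i) (fun f g hfg hf j hj hb => hf j hj (hbad j g f
          (fun u hu => (hfg u (mem_sdiff.1 (hj hu)).2).symm) hb)) (hbad i)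
      have h2 : (0 : ℝ) < Fintype.card (V → Λ) := by exact_mod_cast Fintype.card_pos
      have h3 : (#{f : V → Λ | (∀ j, T j ⊆ S \ T i → ¬ bad j f) ∧ bad i f} : ℝ) *
          Fintype.card (V → Λ) ≤ (M (S \ T i) : ℝ) * (p i * Fintype.card (V → Λ)) :=
        le_trans (by exact_mod_cast h1) (mul_le_mul_of_nonneg_left (hp i) (by positivity))
      have h4 : (#{f : V → Λ | (∀ j, T j ⊆ S \ T i → ¬ bad j f) ∧ bad i f} : ℝ) ≤
          M (S \ T i) * p i := by
        rw [← mul_assoc] at h3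
        exact le_of_mul_le_mul_right h3 h2
      have h5 := chain (S ∩ T i) inter_subset_left
      rw [sdiff_inter_self_left] at h5
      have h6 : q ^ #(T i) * (M (S \ T i) : ℝ) ≤ M S := le_trans
        (mul_le_mul_of_nonneg_right (pow_le_pow_of_le_one hq.le hq1 (card_le_card inter_subset_right))
          (by positivity)) h5
      have h7 : (M (S \ T i) : ℝ) ≤ M S / q ^ #(T i) := by
        rw [le_div_iff₀ (by positivity)]; linarith
      calc _ ≤ (M (S \ T i) : ℝ) * p i := h4
        _ ≤ M S / q ^ #(T i) * p i := by gcongr; exact hp0 i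
        _ = _ := by ring
    have h8 : (M S : ℝ) ≤ M (insert v S) + (1 - q) * M S := by
      calc (M S : ℝ) ≤ M (insert v S) + ∑ i with v ∈ T i,
            (#{f : V → Λ | (∀ j, T j ⊆ S \ T i → ¬ bad j f) ∧ bad i f} : ℝ) := by
            exact_mod_cast hcover
        _ ≤ M (insert v S) + ∑ i with v ∈ T i, p i / q ^ #(T i) * M S := by
            gcongr with i _; exact hterm i
        _ = M (insert v S) + (∑ i with v ∈ T i, p i / q ^ #(T i)) * M S := by rw [sum_mul]
        _ ≤ _ := by gcongr; exact hsum v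
    linarith
  have hpos : ∀ S : Finset V, 0 < (M S : ℝ) := by
    intro S
    induction S using Finset.induction_on with
    | empty =>
      have : M ∅ = Fintype.card (V → Λ) := by
        simp only [hM]
        rw [← Finset.card_univ]
        refine congrArg card ?_
        ext f
        simp only [mem_filter, mem_univ, true_and, iff_true, subset_empty]
        exact fun i hi => absurd hi (hT i).ne_empty
      rw [this]
      exact_mod_cast Fintype.card_pos
    | insert v S hv ihS => exact lt_of_lt_of_le (mul_pos hq ihS) (step _ S rfl v hv)
  obtain ⟨f, hf⟩ := card_pos.1 (by exact_mod_cast hpos univ : 0 < M univ)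
  exact ⟨f, fun i => (mem_filter.1 hf).2 i (subset_univ _)⟩

open Finset in
theorem sum_exp_indicator_le {Λ : Type*} [Fintype Λ] [Nonempty Λ] [DecidableEq Λ] (L : Finset Λ)
    {l : ℝ} (hl : 0 ≤ l) (hl1 : l ≤ 1) :
    ∑ a, Real.exp (l * ((if a ∈ L then 1 else 0) - #L / Fintype.card Λ)) ≤
      Fintype.card Λ * Real.exp (l ^ 2) := by
  have hN : (0 : ℝ) < Fintype.card Λ := by exact_mod_cast Fintype.card_pos
  set p : ℝ := #L / Fintype.card Λ with hp
  have hp0 : 0 ≤ p := by positivity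
  have hp1 : p ≤ 1 := by
    rw [hp, div_le_one hN]; exact_mod_cast Finset.card_le_univ L
  have hx : ∀ a, |(if a ∈ L then (1 : ℝ) else 0) - p| ≤ 1 := by
    intro a; rw [abs_le]; split_ifs <;> constructor <;> linarith
  have key : ∀ a, Real.exp (l * ((if a ∈ L then (1 : ℝ) else 0) - p)) ≤
      1 + l * ((if a ∈ L then (1 : ℝ) else 0) - p) + l ^ 2 := by
    intro a
    set y := (if a ∈ L then (1 : ℝ) else 0) - p
    have hy : |y| ≤ 1 := hx a
    have hly : |l * y| ≤ 1 := by
      rw [abs_mul, abs_of_nonneg hl]; exact mul_le_one₀ hl1 (abs_nonneg _) hy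
    have h1 := (abs_le.1 (Real.abs_exp_sub_one_sub_id_le hly)).2
    have h2 : (l * y) ^ 2 ≤ l ^ 2 := by
      rw [mul_pow]
      exact mul_le_of_le_one_right (by positivity) ((sq_le_one_iff_abs_le_one _).2 hy)
    linarith
  calc _ ≤ ∑ a, (1 + l * ((if a ∈ L then (1 : ℝ) else 0) - p) + l ^ 2) :=
        sum_le_sum fun a _ => key a
    _ = Fintype.card Λ * (1 + l ^ 2) := by
        simp only [sum_add_distrib, ← mul_sum, sum_sub_distrib, sum_const, card_univ, sum_boole,
          nsmul_eq_mul, filter_mem_eq_inter, univ_inter, hp]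
        field_simp
        ring
    _ ≤ _ := by
        gcongr
        linarith [Real.add_one_le_exp (l ^ 2)]

open Finset in
/-- Chernoff bound for the number of vertices of `T` whose label falls into a prescribed set. -/
theorem card_filter_deviation_le {V Λ : Type*} [Fintype V] [DecidableEq V] [Fintype Λ] [Nonempty Λ]
    [DecidableEq Λ] (T : Finset V) (L : V → Finset Λ) {θ : ℝ} (hθ : 0 ≤ θ) (hθ1 : θ ≤ 1) :
    (#{f : V → Λ | (∑ u ∈ T, (#(L u) : ℝ) / Fintype.card Λ) + θ * #T < #{u ∈ T | f u ∈ L u}} : ℝ) ≤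
      Real.exp (-(θ ^ 2 / 4) * #T) * Fintype.card (V → Λ) := by
  set l := θ / 2 with hl
  set φ : V → Λ → ℝ := fun u a => if u ∈ T then
    Real.exp (l * ((if a ∈ L u then 1 else 0) - #(L u) / Fintype.card Λ)) else 1 with hφ
  have hφprod : ∀ f : V → Λ, ∏ u, φ u (f u) =
      Real.exp (l * (#{u ∈ T | f u ∈ L u} - ∑ u ∈ T, (#(L u) : ℝ) / Fintype.card Λ)) := by
    intro f
    simp only [hφ]
    rw [Finset.prod_ite_mem, univ_inter, ← Real.exp_sum, ← mul_sum, sum_sub_distrib, sum_boole]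
  have htotal : ∑ f : V → Λ, ∏ u, φ u (f u) ≤
      Fintype.card (V → Λ) * Real.exp (l ^ 2 * #T) := by
    have h1 := Finset.prod_univ_sum (fun _ : V => (univ : Finset Λ)) φ
    rw [Fintype.piFinset_univ] at h1
    rw [← h1]
    calc _ ≤ ∏ u : V, ((Fintype.card Λ : ℝ) * if u ∈ T then Real.exp (l ^ 2) else 1) := by
          refine prod_le_prod (fun u _ => sum_nonneg fun a _ => ?_) fun u _ => ?_
          · simp only [hφ]; split_ifs <;> positivity
          · by_cases hu : u ∈ T
            · simp only [hφ, hu, if_true]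
              exact sum_exp_indicator_le (L u) (by linarith) (by linarith)
            · simp [hφ, hu]
      _ = _ := by
          rw [prod_mul_distrib, Finset.prod_ite_mem, univ_inter, prod_const, prod_const,
            Fintype.card_fun, ← Real.exp_nat_mul, card_univ, mul_comm (#T : ℝ)]
          push_cast; rfl
  set B := ({f : V → Λ | (∑ u ∈ T, (#(L u) : ℝ) / Fintype.card Λ) + θ * #T <
    #{u ∈ T | f u ∈ L u}} : Finset (V → Λ)) with hB
  have hlow : (#B : ℝ) * Real.exp (l * (θ * #T)) ≤ ∑ f : V → Λ, ∏ u, φ u (f u) := by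
    calc (#B : ℝ) * Real.exp (l * (θ * #T)) = ∑ f ∈ B, Real.exp (l * (θ * #T)) := by
          rw [sum_const, nsmul_eq_mul]
      _ ≤ ∑ f ∈ B, ∏ u, φ u (f u) := by
          refine sum_le_sum fun f hf => ?_
          rw [hφprod]
          have := (mem_filter.1 hf).2
          gcongr
          linarith
      _ ≤ _ := by
          refine sum_le_sum_of_subset_of_nonneg (subset_univ _) fun f _ _ => ?_
          rw [hφprod]; positivity
  have h2 : (#B : ℝ) * Real.exp (l * (θ * #T)) ≤
      Fintype.card (V → Λ) * Real.exp (l ^ 2 * #T) := hlow.trans htotal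
  have h3 : Real.exp (l ^ 2 * #T) =
      Real.exp (-(θ ^ 2 / 4) * #T) * Real.exp (l * (θ * #T)) := by
    rw [← Real.exp_add]; congr 1; rw [hl]; ring
  rw [h3, ← mul_assoc (Fintype.card (V → Λ) : ℝ)] at h2
  have := le_of_mul_le_mul_right h2 (Real.exp_pos _)
  linarith

open Finset in
/-- In graphs whose minimum degree exceeds a large multiple of the logarithm of the maximum
degree, vertices can be labelled so that each of polynomially many label patterns occurs in every
neighbourhood at most about as often as in a uniformly random labelling. -/
theorem exists_labelling {Λ : Type} [Fintype Λ] [Nonempty Λ] [DecidableEq Λ] {θ : ℝ}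
    (hθ : 0 < θ) (hθ1 : θ ≤ 1) :
    ∃ C : ℝ, ∀ (V : Type) [Fintype V] [DecidableEq V] (G : SimpleGraph V) [DecidableRel G.Adj],
      2 ≤ G.maxDegree → C * Real.log G.maxDegree ≤ (G.minDegree : ℝ) →
      ∀ (J : Type) [Fintype J], Fintype.card J ≤ G.maxDegree ^ 3 → ∀ L : J → V → Finset Λ,
      ∃ lab : V → Λ, ∀ v j, (#{u ∈ G.neighborFinset v | lab u ∈ L j u} : ℝ) ≤
        (∑ u ∈ G.neighborFinset v, (#(L j u) : ℝ) / Fintype.card Λ) + θ * G.degree v := by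
  set c : ℝ := θ ^ 2 / 8 with hc
  have hc0 : 0 < c := by positivity
  have hgap : 0 < 1 - Real.exp (-c) := by
    have := Real.exp_lt_one_iff.2 (neg_lt_zero.2 hc0); linarith
  obtain ⟨m, hm⟩ := exists_pow_lt_of_lt_one hgap (by norm_num : (1 / 2 : ℝ) < 1)
  refine ⟨(m + 4) / c, ?_⟩
  intro V _ _ G _ hΔ hδ J _ hJ L
  have hΔ' : (2 : ℝ) ≤ G.maxDegree := by exact_mod_cast hΔ
  have hlog : 0 < Real.log G.maxDegree := Real.log_pos (by linarith)
  have hδ0 : 0 < (G.minDegree : ℝ) := lt_of_lt_of_le (by positivity) hδ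
  have hdeg : ∀ v, 0 < G.degree v := fun v =>
    lt_of_lt_of_le (by exact_mod_cast hδ0) (G.minDegree_le_degree v)
  have hexp : ∀ v, Real.exp (-c * G.degree v) ≤ ((G.maxDegree : ℝ) ^ (m + 4))⁻¹ := by
    intro v
    have h1 : ((m + 4 : ℕ) : ℝ) * Real.log G.maxDegree ≤ c * G.degree v := by
      have h2 : (G.minDegree : ℝ) ≤ G.degree v := by exact_mod_cast G.minDegree_le_degree v
      have h3 := mul_le_mul_of_nonneg_left (hδ.trans h2) hc0.le
      push_cast
      calc _ = c * ((m + 4) / c * Real.log G.maxDegree) := by field_simp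
        _ ≤ _ := h3
    rw [← Real.log_pow] at h1
    calc _ ≤ Real.exp (-Real.log ((G.maxDegree : ℝ) ^ (m + 4))) := by
          gcongr; linarith
      _ = _ := by rw [Real.exp_neg, Real.exp_log (by positivity)]
  obtain ⟨lab, hlab⟩ := exists_forall_not_bad (ι := V × J) (Λ := Λ)
    (fun i => G.neighborFinset i.1)
    (fun i f => (∑ u ∈ G.neighborFinset i.1, (#(L i.2 u) : ℝ) / Fintype.card Λ) +
      θ * #(G.neighborFinset i.1) < #{u ∈ G.neighborFinset i.1 | f u ∈ L i.2 u})
    (fun i => card_pos.1 (by rw [G.card_neighborFinset_eq_degree]; exact hdeg _))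
    (by
      intro i f g hfg h
      rwa [show ({u ∈ G.neighborFinset i.1 | g u ∈ L i.2 u} : Finset V) =
        {u ∈ G.neighborFinset i.1 | f u ∈ L i.2 u} from
          filter_congr fun u hu => by rw [hfg u hu]])
    (fun i => Real.exp (-(θ ^ 2 / 4) * #(G.neighborFinset i.1))) (Real.exp (-c))
    (Real.exp_pos _) (Real.exp_le_one_iff.2 (by linarith))
    (fun i => card_filter_deviation_le _ _ hθ.le hθ1)
    (by
      intro v
      have hbound : ∀ i : V × J, Real.exp (-(θ ^ 2 / 4) * #(G.neighborFinset i.1)) /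
          Real.exp (-c) ^ #(G.neighborFinset i.1) ≤ ((G.maxDegree : ℝ) ^ (m + 4))⁻¹ := by
        intro i
        rw [← Real.exp_nat_mul, ← Real.exp_sub]
        refine le_trans (le_of_eq ?_) (hexp i.1)
        rw [G.card_neighborFinset_eq_degree, hc]; congr 1; ring
      have hcard : #{i : V × J | v ∈ G.neighborFinset i.1} ≤ G.maxDegree ^ 4 := by
        have : ({i : V × J | v ∈ G.neighborFinset i.1} : Finset (V × J)) ⊆
            G.neighborFinset v ×ˢ univ := by
          intro i hi
          simp only [mem_filter, mem_univ, true_and, SimpleGraph.mem_neighborFinset, mem_product,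
            and_true] at hi ⊢
          exact hi.symm
        refine (card_le_card this).trans ?_
        rw [card_product, G.card_neighborFinset_eq_degree, card_univ, pow_succ' _ 3]
        exact Nat.mul_le_mul (G.degree_le_maxDegree v) hJ
      calc _ ≤ ∑ i : V × J with v ∈ G.neighborFinset i.1, ((G.maxDegree : ℝ) ^ (m + 4))⁻¹ :=
            sum_le_sum fun i _ => hbound i
        _ = #{i : V × J | v ∈ G.neighborFinset i.1} * ((G.maxDegree : ℝ) ^ (m + 4))⁻¹ := by
            rw [sum_const, nsmul_eq_mul]
        _ ≤ (G.maxDegree : ℝ) ^ 4 * ((G.maxDegree : ℝ) ^ (m + 4))⁻¹ := by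
            gcongr; exact_mod_cast hcard
        _ = ((G.maxDegree : ℝ)⁻¹) ^ m := by
            rw [pow_add, inv_pow]; field_simp
        _ ≤ (1 / 2) ^ m := by
            gcongr
            rw [one_div]; gcongr
        _ ≤ _ := hm.le)
  refine ⟨lab, fun v j => ?_⟩
  have := hlab (v, j)
  rw [G.card_neighborFinset_eq_degree] at this
  exact not_lt.1 this

open Finset in
/-- Greedy choice in increasing order of `b`: every `v ∈ S` gets a value in its window
`[b v, b v + n v]` satisfying `P`, distinct from the values of its neighbours in `S`. -/
theorem exists_greedy_values {V : Type*} [Fintype V] [DecidableEq V] (G : SimpleGraph V)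
    [DecidableRel G.Adj] (S : Finset V) (b n : V → ℕ) (P : ℕ → Prop) [DecidablePred P]
    (h : ∀ v ∈ S, #{u ∈ G.neighborFinset v | u ∈ S ∧ b u ≤ b v ∧ b v ≤ b u + n u} <
      #{t ∈ Icc (b v) (b v + n v) | P t}) :
    ∃ a : V → ℕ, ∀ v ∈ S, (b v ≤ a v ∧ a v ≤ b v + n v ∧ P (a v)) ∧
      ∀ u ∈ S, G.Adj v u → a v ≠ a u := by
  suffices H : ∀ R : Finset V, R ⊆ S →
      ∃ a : V → ℕ, ∀ v ∈ R, (b v ≤ a v ∧ a v ≤ b v + n v ∧ P (a v)) ∧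
        ∀ u ∈ R, G.Adj v u → a v ≠ a u from H S subset_rfl
  intro R
  induction R using Finset.induction_on_max_value b with
  | empty => intro _; exact ⟨fun _ => 0, by simp⟩
  | insert v R hv hmax ih =>
    intro hR
    obtain ⟨a, ha⟩ := ih ((subset_insert _ _).trans hR)
    have hcard : #(({u ∈ G.neighborFinset v | u ∈ R ∧ b v ≤ a u} : Finset V).image a) <
        #{t ∈ Icc (b v) (b v + n v) | P t} := by
      refine lt_of_le_of_lt (card_image_le.trans (card_le_card ?_)) (h v (hR (mem_insert_self _ _)))
      intro u hu
      simp only [mem_filter] at hu ⊢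
      exact ⟨hu.1, hR (mem_insert_of_mem hu.2.1), hmax u hu.2.1,
        hu.2.2.trans (ha u hu.2.1).1.2.1⟩
    obtain ⟨t, ht, hta⟩ := exists_mem_notMem_of_card_lt_card hcard
    simp only [mem_filter, mem_Icc] at ht
    have hne : ∀ u ∈ R, G.Adj v u → t ≠ a u := by
      intro u hu huv htu
      refine hta (mem_image.2 ⟨u, ?_, htu.symm⟩)
      simp only [mem_filter, SimpleGraph.mem_neighborFinset]
      exact ⟨huv, hu, htu ▸ ht.1.1⟩
    have hself : ∀ u ∈ R, u ≠ v := fun u hu h => hv (h ▸ hu)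
    refine ⟨Function.update a v t, fun x hx => ?_⟩
    rcases mem_insert.1 hx with rfl | hxR
    · refine ⟨by simpa [Function.update_self, and_assoc] using ht, fun u hu hxu => ?_⟩
      rcases mem_insert.1 hu with rfl | hu
      · exact absurd hxu (G.irrefl)
      · rw [Function.update_self, Function.update_of_ne (hself u hu)]
        exact hne u hu hxu
    · rw [Function.update_of_ne (hself x hxR)]
      refine ⟨(ha x hxR).1, fun u hu hxu => ?_⟩
      rcases mem_insert.1 hu with rfl | hu
      · rw [Function.update_self]
        exact (hne x hxR hxu.symm).symm
      · rw [Function.update_of_ne (hself u hu)]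
        exact (ha x hxR).2 u hu hxu

open Finset in
theorem exists_sum_eq_add {V : Type*} [DecidableEq V] (F : Finset V) (lo : V → ℕ) (k o : ℕ)
    (ho : o ≤ k * #F) :
    ∃ w : V → ℕ, (∀ u, lo u ≤ w u ∧ w u ≤ lo u + k) ∧ ∑ u ∈ F, w u = ∑ u ∈ F, lo u + o := by
  induction F using Finset.induction_on generalizing o with
  | empty => exact ⟨lo, fun u => ⟨le_rfl, by omega⟩, by
    rw [card_empty, mul_zero, Nat.le_zero] at ho; simp [ho]⟩
  | insert v F hv ih =>
    rw [card_insert_of_notMem hv, mul_add, mul_one] at ho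
    obtain ⟨w, hw, hs⟩ := ih (o - min o k) (by omega)
    refine ⟨Function.update w v (lo v + min o k), fun u => ?_, ?_⟩
    · by_cases hu : u = v
      · subst hu; rw [Function.update_self]; omega
      · rw [Function.update_of_ne hu]; exact hw u
    · rw [sum_insert hv, sum_insert hv, Function.update_self,
        sum_congr rfl fun u (hu : u ∈ F) => Function.update_of_ne (ne_of_mem_of_not_mem hu hv) _ _, hs]
      omega

open Finset in
theorem le_card_filter_mod_eq (m n r : ℕ) (hr : r < 10) :
    (n + 1) / 10 ≤ #{t ∈ Icc m (m + n) | t % 10 = r} := by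
  obtain ⟨s, hs⟩ : ∃ s, s < 10 ∧ (m + s) % 10 = r := ⟨(r + 10 - m % 10) % 10, by omega⟩
  calc (n + 1) / 10 = #((range ((n + 1) / 10)).image fun i => m + s + 10 * i) := by
        rw [card_image_of_injective _ fun i j h => by simpa using h, card_range]
    _ ≤ _ := by
        refine card_le_card fun t ht => ?_
        simp only [mem_image, mem_range, mem_filter, mem_Icc] at ht ⊢
        obtain ⟨i, hi, rfl⟩ := ht
        omega

open Finset in
theorem le_card_filter_mod_lt (m n k : ℕ) (hk : k ≤ 10) :
    k * ((n + 1) / 10) ≤ #{t ∈ Icc m (m + n) | t % 10 < k} := by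
  rw [card_eq_sum_card_fiberwise (f := fun t => t % 10) (t := range k)
    (fun t ht => by simpa using (mem_filter.1 ht).2)]
  calc k * ((n + 1) / 10) = ∑ r ∈ range k, (n + 1) / 10 := by simp
    _ ≤ _ := by
      refine sum_le_sum fun r hr => ?_
      have hr' := mem_range.1 hr
      refine (le_card_filter_mod_eq m n r (by omega)).trans (card_le_card fun t ht => ?_)
      simp only [mem_filter] at ht ⊢
      exact ⟨⟨ht.1, by omega⟩, ht.2⟩

open Finset in
/-- Weights on the edges between disjoint sets `X` and `Y`, chosen vertex by vertex in `Y`: the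
vertices of `Y` get totals satisfying `P` that distinguish neighbours inside `Y`, while the total
at every vertex of `X` stays within one of that of the constant weight `2`. -/
theorem exists_bipartite_weights {V : Type*} [Fintype V] [DecidableEq V] (G : SimpleGraph V)
    [DecidableRel G.Adj] (X Y : Finset V) (b : V → ℕ) (P : ℕ → Prop) [DecidablePred P]
    (h : ∀ y ∈ Y, ∀ m, #{u ∈ G.neighborFinset y | u ∈ Y} <
      #{t ∈ Icc m (m + #{x ∈ G.neighborFinset y | x ∈ X}) | P t}) :
    ∃ g : V → V → ℕ, (∀ y x, 1 ≤ g y x ∧ g y x ≤ 3) ∧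
      (∀ x ∈ X, ∑ y ∈ G.neighborFinset x with y ∈ Y, g y x = 2 * #{y ∈ G.neighborFinset x | y ∈ Y} ∨
        ∑ y ∈ G.neighborFinset x with y ∈ Y, g y x = 2 * #{y ∈ G.neighborFinset x | y ∈ Y} + 1) ∧
      ∀ y ∈ Y, P (b y + ∑ x ∈ G.neighborFinset y with x ∈ X, g y x) ∧
        ∀ u ∈ Y, G.Adj y u → b y + ∑ x ∈ G.neighborFinset y with x ∈ X, g y x ≠
          b u + ∑ x ∈ G.neighborFinset u with x ∈ X, g u x := by
  suffices H : ∀ R : Finset V, R ⊆ Y → ∃ g : V → V → ℕ, (∀ y x, 1 ≤ g y x ∧ g y x ≤ 3) ∧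
      (∀ x ∈ X, ∑ y ∈ G.neighborFinset x with y ∈ R, g y x = 2 * #{y ∈ G.neighborFinset x | y ∈ R} ∨
        ∑ y ∈ G.neighborFinset x with y ∈ R, g y x = 2 * #{y ∈ G.neighborFinset x | y ∈ R} + 1) ∧
      ∀ y ∈ R, P (b y + ∑ x ∈ G.neighborFinset y with x ∈ X, g y x) ∧
        ∀ u ∈ R, G.Adj y u → b y + ∑ x ∈ G.neighborFinset y with x ∈ X, g y x ≠
          b u + ∑ x ∈ G.neighborFinset u with x ∈ X, g u x from H Y subset_rfl
  intro R
  induction R using Finset.induction_on with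
  | empty => intro _; exact ⟨fun _ _ => 2, by simp, by simp, by simp⟩
  | insert v R hv ih =>
    intro hR
    obtain ⟨g, hg, hX, hY⟩ := ih ((subset_insert _ _).trans hR)
    set F : Finset V := {x ∈ G.neighborFinset v | x ∈ X} with hF
    set lo : V → ℕ := fun x =>
      if ∑ y ∈ G.neighborFinset x with y ∈ R, g y x = 2 * #{y ∈ G.neighborFinset x | y ∈ R}
      then 2 else 1 with hlo
    set val : V → ℕ := fun u => b u + ∑ x ∈ G.neighborFinset u with x ∈ X, g u x with hval
    have hcard : #(({u ∈ G.neighborFinset v | u ∈ R} : Finset V).image val) <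
        #{t ∈ Icc (b v + ∑ x ∈ F, lo x) (b v + ∑ x ∈ F, lo x + #F) | P t} := by
      refine lt_of_le_of_lt (card_image_le.trans (card_le_card ?_)) (h v (hR (mem_insert_self _ _)) _)
      intro u hu
      simp only [mem_filter] at hu ⊢
      exact ⟨hu.1, hR (mem_insert_of_mem hu.2)⟩
    obtain ⟨t, ht, hta⟩ := exists_mem_notMem_of_card_lt_card hcard
    simp only [mem_filter, mem_Icc] at ht
    obtain ⟨w, hw, hws⟩ := exists_sum_eq_add F lo 1 (t - (b v + ∑ x ∈ F, lo x)) (by omega)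
    have hself : ∀ u ∈ R, u ≠ v := fun u hu h => hv (h ▸ hu)
    have hlo' : ∀ x, lo x = 2 ∨ lo x = 1 := fun x => by simp only [hlo]; split_ifs <;> simp
    have hvalv : b v + ∑ x ∈ F, w x = t := by omega
    have hne : ∀ u ∈ R, G.Adj v u → t ≠ val u := by
      intro u hu huv htu
      refine hta (mem_image.2 ⟨u, ?_, htu.symm⟩)
      simp only [mem_filter, SimpleGraph.mem_neighborFinset]
      exact ⟨huv, hu⟩
    refine ⟨Function.update g v w, fun y x => ?_, fun x hx => ?_, fun y hy => ?_⟩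
    · by_cases hy : y = v
      · subst hy
        rw [Function.update_self]
        have := hw x
        rcases hlo' x with h | h <;> omega
      · rw [Function.update_of_ne hy]; exact hg y x
    · have hold : ∑ y ∈ G.neighborFinset x with y ∈ R, Function.update g v w y x =
          ∑ y ∈ G.neighborFinset x with y ∈ R, g y x :=
        sum_congr rfl fun y hy => by rw [Function.update_of_ne (hself y (mem_filter.1 hy).2)]
      by_cases hvx : v ∈ G.neighborFinset x
      · have hins : ({y ∈ G.neighborFinset x | y ∈ insert v R} : Finset V) =
            insert v {y ∈ G.neighborFinset x | y ∈ R} := by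
          ext y; simp only [mem_filter, mem_insert]
          constructor
          · tauto
          · rintro (rfl | h)
            · exact ⟨hvx, Or.inl rfl⟩
            · exact ⟨h.1, Or.inr h.2⟩
        have hnot : v ∉ ({y ∈ G.neighborFinset x | y ∈ R} : Finset V) := by simp [hv]
        rw [hins, sum_insert hnot, card_insert_of_notMem hnot, hold, Function.update_self]
        have h1 := hw x
        have h2 := hX x hx
        simp only [hlo] at h1
        split_ifs at h1 <;> omega
      · have hins : ({y ∈ G.neighborFinset x | y ∈ insert v R} : Finset V) =
            {y ∈ G.neighborFinset x | y ∈ R} := by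
          ext y; simp only [mem_filter, mem_insert]
          constructor
          · rintro ⟨h1, rfl | h2⟩
            · exact absurd h1 hvx
            · exact ⟨h1, h2⟩
          · tauto
        rw [hins, hold]
        exact hX x hx
    · rcases mem_insert.1 hy with rfl | hyR
      · rw [Function.update_self, hvalv]
        refine ⟨ht.2, fun u hu hyu => ?_⟩
        rcases mem_insert.1 hu with rfl | hu
        · exact absurd hyu (G.irrefl)
        · rw [Function.update_of_ne (hself u hu)]
          exact hne u hu hyu
      · rw [Function.update_of_ne (hself y hyR)]
        refine ⟨(hY y hyR).1, fun u hu hyu => ?_⟩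
        rcases mem_insert.1 hu with rfl | hu
        · rw [Function.update_self, hvalv]
          exact (hne y hyR hyu.symm).symm
        · rw [Function.update_of_ne (hself u hu)]
          exact (hY y hyR).2 u hu hyu

open Finset in
/-- Deterministic construction from a partition into classes `0, 1, 2, 3` and preliminary weights
`h` on the edges inside the classes `0` and `1`. In this order, the edges from class `1` to `3`,
from `0` to `2`, from `3` to `2` and from `2` to `1` are weighted so that the weighted degrees in
the four classes occupy different residues modulo `10`. -/
theorem exists_weights_of_classes {V : Type*} [Fintype V] [DecidableEq V] (G : SimpleGraph V)
    [DecidableRel G.Adj] (cl : V → Fin 4) (h : V → V → ℕ) (hsymm : ∀ u v, h u v = h v u)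
    (hrange : ∀ u v, 1 ≤ h u v ∧ h u v ≤ 3)
    (n : Fin 4 → V → ℕ) (hn : ∀ c v, n c v = #{u ∈ G.neighborFinset v | cl u = c})
    (T : V → ℕ) (hT : ∀ v, T v = (∑ u ∈ G.neighborFinset v with cl u = 0, h v u) +
      ∑ u ∈ G.neighborFinset v with cl u = 1, h v u)
    (h0 : ∀ v, cl v = 0 → #{u ∈ G.neighborFinset v | cl u = 0 ∧
        n 2 u + 2 * n 3 u + T u ≤ n 2 v + 2 * n 3 v + T v ∧
        n 2 v + 2 * n 3 v + T v ≤ n 2 u + 2 * n 3 u + T u + 2 * n 2 u} <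
      6 * ((2 * n 2 v + 1) / 10))
    (h1 : ∀ v, cl v = 1 → #{u ∈ G.neighborFinset v | cl u = 1 ∧
        n 3 u + 2 * n 2 u + T u ≤ n 3 v + 2 * n 2 v + T v ∧
        n 3 v + 2 * n 2 v + T v ≤ n 3 u + 2 * n 2 u + T u + 2 * n 3 u} <
      (2 * n 3 v + 1) / 10)
    (h2 : ∀ v, cl v = 2 → n 2 v < (n 1 v + 1) / 10)
    (h3 : ∀ v, cl v = 3 → n 3 v < (2 * n 2 v + 1) / 10) :
    ∃ w : V → V → ℕ, (∀ u v, w u v = w v u) ∧ (∀ u v, 1 ≤ w u v ∧ w u v ≤ 3) ∧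
      ∀ u v, G.Adj u v → ∑ x ∈ G.neighborFinset u, w u x ≠ ∑ x ∈ G.neighborFinset v, w v x := by
  obtain ⟨a1, ha1⟩ := exists_greedy_values G {v | cl v = 1} (fun v => n 3 v + 2 * n 2 v + T v)
    (fun v => 2 * n 3 v) (fun t => t % 10 = 6) (fun v hv => by
      simp only [mem_filter, mem_univ, true_and] at hv ⊢
      exact (h1 v hv).trans_le (le_card_filter_mod_eq _ _ _ (by norm_num)))
  obtain ⟨a0, ha0⟩ := exists_greedy_values G {v | cl v = 0} (fun v => n 2 v + 2 * n 3 v + T v)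
    (fun v => 2 * n 2 v) (fun t => t % 10 < 6) (fun v hv => by
      simp only [mem_filter, mem_univ, true_and] at hv ⊢
      exact (h0 v hv).trans_le (le_card_filter_mod_lt _ _ _ (by norm_num)))
  simp only [mem_filter, mem_univ, true_and] at ha0 ha1
  have dist : ∀ (c : Fin 4) (b a : V → ℕ) (d : Fin 4),
      (∀ v, cl v = d → n c v + b v ≤ a v ∧ a v ≤ n c v + b v + 2 * n c v) →
      ∃ f : V → V → ℕ, (∀ v u, 1 ≤ f v u ∧ f v u ≤ 3) ∧ ∀ v, cl v = d →
        (∑ u ∈ G.neighborFinset v with cl u = c, f v u) + b v = a v := by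
    intro c b a d hab
    have : ∀ v, ∃ w : V → ℕ, (∀ u, 1 ≤ w u ∧ w u ≤ 3) ∧ (cl v = d →
        (∑ u ∈ G.neighborFinset v with cl u = c, w u) + b v = a v) := by
      intro v
      by_cases hv : cl v = d
      · have hab' := hab v hv
        obtain ⟨w, hw, hs⟩ := exists_sum_eq_add {u ∈ G.neighborFinset v | cl u = c} (fun _ => 1) 2
          (a v - (n c v + b v)) (by rw [← hn]; omega)
        refine ⟨w, hw, fun _ => ?_⟩
        rw [hs, sum_const, ← hn, smul_eq_mul]
        omega
      · exact ⟨fun _ => 1, by simp, fun h => absurd h hv⟩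
    choose f hf hs using this
    exact ⟨f, hf, hs⟩
  obtain ⟨f1, hf1, hs1⟩ := dist 3 (fun v => 2 * n 2 v + T v) a1 1 fun v hv => by
    have := (ha1 v hv).1; omega
  obtain ⟨f0, hf0, hs0⟩ := dist 2 (fun v => 2 * n 3 v + T v) a0 0 fun v hv => by
    have := (ha0 v hv).1; omega
  obtain ⟨a3, ha3⟩ := exists_greedy_values G {v | cl v = 3}
    (fun v => n 2 v + ((∑ u ∈ G.neighborFinset v with cl u = 1, f1 u v) + 2 * n 0 v + 2 * n 3 v))
    (fun v => 2 * n 2 v) (fun t => t % 10 = 9) (fun v hv => by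
      simp only [mem_filter, mem_univ, true_and] at hv ⊢
      refine lt_of_le_of_lt (le_trans (card_le_card fun u hu => ?_) (hn 3 v).ge)
        ((h3 v hv).trans_le (le_card_filter_mod_eq _ _ _ (by norm_num)))
      simp only [mem_filter] at hu ⊢
      exact ⟨hu.1, hu.2.1⟩)
  simp only [mem_filter, mem_univ, true_and] at ha3
  obtain ⟨f3, hf3, hs3⟩ := dist 2
    (fun v => (∑ u ∈ G.neighborFinset v with cl u = 1, f1 u v) + 2 * n 0 v + 2 * n 3 v) a3 3
    fun v hv => (ha3 v hv).1.imp id And.left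
  obtain ⟨f2, hf2, hs21, hs2⟩ := exists_bipartite_weights G {v | cl v = 1} {v | cl v = 2}
    (fun v => (∑ u ∈ G.neighborFinset v with cl u = 0, f0 u v) +
      (∑ u ∈ G.neighborFinset v with cl u = 3, f3 u v) + 2 * n 2 v)
    (fun t => t % 10 = 8) (fun v hv m => by
      simp only [mem_filter, mem_univ, true_and] at hv ⊢
      rw [← hn, ← hn]
      exact (h2 v hv).trans_le (le_card_filter_mod_eq _ _ _ (by norm_num)))
  simp only [mem_filter, mem_univ, true_and, ← hn] at hs21 hs2
  set tgt : Fin 4 → Fin 4 := ![2, 3, 1, 2] with htgt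
  set f : Fin 4 → V → V → ℕ := ![f0, f1, f2, f3] with hf
  set w : V → V → ℕ := fun u v => if cl v = tgt (cl u) then f (cl u) u v else
    if cl u = tgt (cl v) then f (cl v) v u else
    if (cl u = 0 ∨ cl u = 1) ∧ (cl v = 0 ∨ cl v = 1) then h u v else 2 with hw
  have hcyc : ∀ c : Fin 4, tgt (tgt c) ≠ c := by decide
  have hfr : ∀ c u v, 1 ≤ f c u v ∧ f c u v ≤ 3 := by
    intro c u v
    fin_cases c
    exacts [hf0 u v, hf1 u v, hf2 u v, hf3 u v]
  have hsplit : ∀ v, ∑ x ∈ G.neighborFinset v, w v x =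
      (∑ x ∈ G.neighborFinset v with cl x = 0, w v x) +
      (∑ x ∈ G.neighborFinset v with cl x = 1, w v x) +
      (∑ x ∈ G.neighborFinset v with cl x = 2, w v x) +
      (∑ x ∈ G.neighborFinset v with cl x = 3, w v x) := by
    intro v
    rw [← sum_fiberwise _ cl, Fin.sum_univ_four]
  have hpart : ∀ v c d (φ : V → ℕ), cl v = d → (∀ x, cl x = c → w v x = φ x) →
      ∑ x ∈ G.neighborFinset v with cl x = c, w v x =
        ∑ x ∈ G.neighborFinset v with cl x = c, φ x :=
    fun v c d φ _ hφ => sum_congr rfl fun x hx => hφ x (mem_filter.1 hx).2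
  have hconst : ∀ v c, ∑ x ∈ G.neighborFinset v with cl x = c, 2 = 2 * n c v := by
    intro v c; rw [sum_const, hn, smul_eq_mul, mul_comm]
  have S0 : ∀ v, cl v = 0 → ∑ x ∈ G.neighborFinset v, w v x = a0 v := by
    intro v hv
    rw [hsplit, hpart v 0 0 (h v) hv fun x hx => by simp [hw, htgt, hv, hx],
      hpart v 1 0 (h v) hv fun x hx => by simp [hw, htgt, hv, hx],
      hpart v 2 0 (f0 v) hv fun x hx => by simp [hw, htgt, hf, hv, hx],
      hpart v 3 0 (fun _ => 2) hv fun x hx => by simp [hw, htgt, hv, hx], hconst, ← hs0 v hv, hT]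
    ring
  have S1 : ∀ v, cl v = 1 → ∑ x ∈ G.neighborFinset v, w v x = a1 v ∨
      ∑ x ∈ G.neighborFinset v, w v x = a1 v + 1 := by
    intro v hv
    rw [hsplit, hpart v 0 1 (h v) hv fun x hx => by simp [hw, htgt, hv, hx],
      hpart v 1 1 (h v) hv fun x hx => by simp [hw, htgt, hv, hx],
      hpart v 2 1 (fun x => f2 x v) hv fun x hx => by simp [hw, htgt, hf, hv, hx],
      hpart v 3 1 (f1 v) hv fun x hx => by simp [hw, htgt, hf, hv, hx], ← hs1 v hv, hT]
    have := hs21 v hv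
    omega
  have S2 : ∀ v, cl v = 2 → ∑ x ∈ G.neighborFinset v, w v x =
      (∑ u ∈ G.neighborFinset v with cl u = 0, f0 u v) +
      (∑ u ∈ G.neighborFinset v with cl u = 3, f3 u v) + 2 * n 2 v +
      ∑ x ∈ G.neighborFinset v with cl x = 1, f2 v x := by
    intro v hv
    rw [hsplit, hpart v 0 2 (fun x => f0 x v) hv fun x hx => by simp [hw, htgt, hf, hv, hx],
      hpart v 1 2 (f2 v) hv fun x hx => by simp [hw, htgt, hf, hv, hx],
      hpart v 2 2 (fun _ => 2) hv fun x hx => by simp [hw, htgt, hv, hx],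
      hpart v 3 2 (fun x => f3 x v) hv fun x hx => by simp [hw, htgt, hf, hv, hx], hconst]
    ring
  have S3 : ∀ v, cl v = 3 → ∑ x ∈ G.neighborFinset v, w v x = a3 v := by
    intro v hv
    rw [hsplit, hpart v 0 3 (fun _ => 2) hv fun x hx => by simp [hw, htgt, hv, hx],
      hpart v 1 3 (fun x => f1 x v) hv fun x hx => by simp [hw, htgt, hf, hv, hx],
      hpart v 2 3 (f3 v) hv fun x hx => by simp [hw, htgt, hf, hv, hx],
      hpart v 3 3 (fun _ => 2) hv fun x hx => by simp [hw, htgt, hv, hx], hconst, hconst,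
      ← hs3 v hv]
    ring
  have hcases : ∀ v, cl v = 0 ∨ cl v = 1 ∨ cl v = 2 ∨ cl v = 3 := by
    intro v; generalize cl v = c; revert c; decide
  refine ⟨w, fun u v => ?_, fun u v => ?_, fun u v huv => ?_⟩
  · simp only [hw]
    by_cases h1 : cl v = tgt (cl u)
    · simp only [h1, if_true]
      rw [if_neg]
      intro h3; exact absurd h3.symm (hcyc _)
    · simp only [h1, if_false, and_comm (a := cl u = 0 ∨ cl u = 1), hsymm u v]
  · simp only [hw]
    split_ifs
    exacts [hfr _ _ _, hfr _ _ _, hrange _ _, by norm_num]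
  · rcases hcases u with hu | hu | hu | hu
    · have ku := (ha0 u hu).1.2.2
      have du := (ha0 u hu).2 v
      rw [S0 u hu]
      rcases hcases v with hv | hv | hv | hv
      · rw [S0 v hv]; exact du hv huv
      · have := S1 v hv; have := (ha1 v hv).1.2.2; omega
      · have := (hs2 v hv).1; rw [S2 v hv]; omega
      · have := (ha3 v hv).1.2.2; rw [S3 v hv]; omega
    · have ku := (ha1 u hu).1.2.2
      have du := (ha1 u hu).2 v
      have eu := S1 u hu
      rcases hcases v with hv | hv | hv | hv
      · have := (ha0 v hv).1.2.2; rw [S0 v hv]; omega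
      · have := S1 v hv; have := (ha1 v hv).1.2.2; have := du hv huv; omega
      · have := (hs2 v hv).1; rw [S2 v hv]; omega
      · have := (ha3 v hv).1.2.2; rw [S3 v hv]; omega
    · have ku := (hs2 u hu).1
      have du := (hs2 u hu).2 v
      rw [S2 u hu]
      rcases hcases v with hv | hv | hv | hv
      · have := (ha0 v hv).1.2.2; rw [S0 v hv]; omega
      · have := S1 v hv; have := (ha1 v hv).1.2.2; omega
      · rw [S2 v hv]; exact du hv huv
      · have := (ha3 v hv).1.2.2; rw [S3 v hv]; omega
    · have ku := (ha3 u hu).1.2.2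
      have du := (ha3 u hu).2 v
      rw [S3 u hu]
      rcases hcases v with hv | hv | hv | hv
      · have := (ha0 v hv).1.2.2; rw [S0 v hv]; omega
      · have := S1 v hv; have := (ha1 v hv).1.2.2; omega
      · have := (hs2 v hv).1; rw [S2 v hv]; omega
      · rw [S3 v hv]; exact du hv huv

open Finset in
/-- A labelling under which every label set occurs in each neighbourhood with about its expected
frequency, and the prescribed sets `L t s u` with at most that frequency. -/
theorem exists_labelling_two_sided {Λ : Type} [Fintype Λ] [Nonempty Λ] [DecidableEq Λ] {θ : ℝ}
    (hθ : 0 < θ) (hθ1 : θ ≤ 1) (m : ℕ) :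
    ∃ C : ℝ, ∀ (V : Type) [Fintype V] [DecidableEq V] (G : SimpleGraph V) [DecidableRel G.Adj],
      2 ≤ G.maxDegree → C * Real.log G.maxDegree ≤ (G.minDegree : ℝ) →
      m ≤ G.minDegree ∧ ∀ L : ℕ → Bool → V → Finset Λ,
      ∃ lab : V → Λ, (∀ v, ∀ P : Finset Λ,
          |(#{u ∈ G.neighborFinset v | lab u ∈ P} : ℝ) - G.degree v * (#P / Fintype.card Λ)| ≤
            θ * G.degree v) ∧
        ∀ v t s, t ≤ 3 * G.maxDegree → (#{u ∈ G.neighborFinset v | lab u ∈ L t s u} : ℝ) ≤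
          (∑ u ∈ G.neighborFinset v, (#(L t s u) : ℝ) / Fintype.card Λ) + θ * G.degree v := by
  obtain ⟨C, hC⟩ := exists_labelling (Λ := Λ) hθ hθ1
  set Q := Fintype.card (Finset Λ) with hQ
  refine ⟨max C (2 * (Q + m + 8 : ℕ)), ?_⟩
  intro V _ _ G _ hΔ hδ
  have hΔ' : (2 : ℝ) ≤ G.maxDegree := by exact_mod_cast hΔ
  have hlog : 1 / 2 ≤ Real.log G.maxDegree := by
    have h1 := Real.log_le_log (by norm_num) hΔ'
    have h2 := Real.log_two_gt_d9
    linarith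
  have hbig : Q + m + 8 ≤ G.minDegree := by
    have h1 : (2 * (Q + m + 8 : ℕ) : ℝ) * Real.log G.maxDegree ≤ G.minDegree :=
      le_trans (by gcongr; exact le_max_right _ _) hδ
    have h2 : (0 : ℝ) ≤ (Q + m + 8 : ℕ) := Nat.cast_nonneg _
    have h3 : ((Q + m + 8 : ℕ) : ℝ) ≤ G.minDegree := by nlinarith
    exact_mod_cast h3
  have hmin := G.minDegree_le_maxDegree
  refine ⟨by omega, fun L => ?_⟩
  obtain ⟨lab, hlab⟩ := hC V G hΔ (le_trans (by gcongr; exact le_max_left _ _) hδ)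
    (Finset Λ ⊕ (Fin (3 * G.maxDegree + 1) × Bool))
    (by
      rw [Fintype.card_sum, Fintype.card_prod, Fintype.card_fin, Fintype.card_bool, ← hQ]
      have h8 : 8 ≤ G.maxDegree := by omega
      have h64 : 8 * G.maxDegree ≤ G.maxDegree ^ 3 := by
        calc 8 * G.maxDegree ≤ G.maxDegree ^ 2 * G.maxDegree :=
              Nat.mul_le_mul_right _ (by nlinarith)
          _ = _ := by ring
      omega)
    (Sum.elim (fun P _ => P) fun i u => L i.1 i.2 u)
  have hupper : ∀ v, ∀ P : Finset Λ, (#{u ∈ G.neighborFinset v | lab u ∈ P} : ℝ) ≤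
      G.degree v * (#P / Fintype.card Λ) + θ * G.degree v := by
    intro v P
    have := hlab v (Sum.inl P)
    rw [sum_congr rfl fun u _ => by rw [Sum.elim_inl], sum_const, nsmul_eq_mul,
      G.card_neighborFinset_eq_degree] at this
    exact this
  refine ⟨lab, fun v P => ?_, fun v t s ht => hlab v (Sum.inr (⟨t, by omega⟩, s))⟩
  have h1 := hupper v P
  have h2 := hupper v Pᶜ
  have h3 : (#{u ∈ G.neighborFinset v | lab u ∈ P} : ℝ) +
      #{u ∈ G.neighborFinset v | lab u ∈ Pᶜ} = G.degree v := by
    rw [← G.card_neighborFinset_eq_degree]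
    simp only [mem_compl]
    exact_mod_cast card_filter_add_card_filter_not (s := G.neighborFinset v) (fun u => lab u ∈ P)
  have hN : (0 : ℝ) < Fintype.card Λ := by exact_mod_cast Fintype.card_pos
  have h4 : ((#Pᶜ : ℕ) : ℝ) / Fintype.card Λ = 1 - #P / Fintype.card Λ := by
    rw [card_compl, Nat.cast_sub (card_le_univ P), sub_div, div_self hN.ne']
  rw [h4] at h2
  rw [abs_le]
  constructor <;> linarith

open Finset in
theorem card_filter_fin_Ico {N a b : ℕ} (hb : b ≤ N) :
    #{i : Fin N | a ≤ i.1 ∧ i.1 < b} = b - a := by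
  rw [← Nat.card_Ico, ← card_map Fin.valEmbedding]
  congr 1
  ext x
  simp only [mem_map, mem_filter, mem_univ, true_and, Fin.valEmbedding_apply, mem_Ico]
  exact ⟨fun ⟨i, hi, hx⟩ => hx ▸ hi, fun hx => ⟨⟨x, by omega⟩, hx, rfl⟩⟩

open Finset in
theorem card_filter_affine_le {K : ℕ} {D α β γ t : ℝ} (hD : 0 < D) (hβ : 0 < β) (hγ : 0 ≤ γ) :
    (#{l : Fin K | D * (α + β * l) ≤ t ∧ t ≤ D * (α + β * l + γ)} : ℝ) ≤ γ / β + 1 := by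
  set S : Finset (Fin K) := {l : Fin K | D * (α + β * l) ≤ t ∧ t ≤ D * (α + β * l + γ)} with hS
  rcases S.eq_empty_or_nonempty with h | h
  · rw [h, card_empty, Nat.cast_zero]; positivity
  · have hmin := (mem_filter.1 (S.min'_mem h)).2
    have hmax := (mem_filter.1 (S.max'_mem h)).2
    set a := S.min' h
    set b := S.max' h
    have hab : a ≤ b := S.min'_le_max' h
    have hcard : #S ≤ b.1 + 1 - a.1 := by
      rw [← card_filter_fin_Ico (N := K) (a := a.1) (b := b.1 + 1) (by omega)]
      refine card_le_card fun l hl => ?_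
      have h1 : a ≤ l := S.min'_le _ hl
      have h2 : l ≤ b := S.le_max' _ hl
      simp only [mem_filter, mem_univ, true_and]
      exact ⟨h1, Nat.lt_succ_of_le h2⟩
    have hcard' : (#S : ℝ) ≤ b.1 + 1 - a.1 := by
      have : #S + a.1 ≤ b.1 + 1 := by have : a.1 ≤ b.1 := hab; omega
      have : (#S : ℝ) + a.1 ≤ b.1 + 1 := by exact_mod_cast this
      linarith
    have hle : β * b.1 ≤ β * a.1 + γ := by
      have := le_of_mul_le_mul_left (hmax.1.trans hmin.2) hD
      linarith
    have : ((b.1 : ℝ) - a.1) ≤ γ / β := by rw [le_div_iff₀ hβ]; linarith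
    linarith

open Finset in
theorem sum_filter_edgeFinset_lift {V : Type*} [Fintype V] [DecidableEq V] (G : SimpleGraph V)
    [DecidableRel G.Adj] (w : V → V → ℕ) (hw : ∀ u v, w u v = w v u) (u : V) :
    ∑ e ∈ G.edgeFinset.filter (fun e => u ∈ e), Sym2.lift ⟨w, hw⟩ e =
      ∑ x ∈ G.neighborFinset u, w u x := by
  have himage : G.edgeFinset.filter (fun e => u ∈ e) =
      (G.neighborFinset u).image fun x => s(u, x) := by
    ext e
    simp only [mem_filter, SimpleGraph.mem_edgeFinset, mem_image, SimpleGraph.mem_neighborFinset]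
    constructor
    · rintro ⟨he, y, rfl⟩
      exact ⟨y, he, rfl⟩
    · rintro ⟨x, hx, rfl⟩
      exact ⟨hx, Sym2.mem_mk_left _ _⟩
  rw [himage, sum_image fun x _ y _ h => Sym2.congr_right.1 h]
  rfl

open Finset in
/-- The labels which, given to `u`, may put `u` into conflict with a neighbour of preliminary
degree `t`; the flag tells which of the two large classes is concerned. -/
noncomputable def conflictLabels {V : Type} [Fintype V] (G : SimpleGraph V) [DecidableRel G.Adj]
    (t : ℕ) (s : Bool) (u : V) : Finset (Fin 4096 × Fin 2048) :=
  ({l : Fin 4096 |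
    G.degree u * ((bif s then 131578 / 131072 else 131130 / 131072) +
      260992 / (131072 * 4096) * l) ≤ (t : ℝ) ∧
    (t : ℝ) ≤ G.degree u * ((bif s then 131578 / 131072 else 131130 / 131072) +
      260992 / (131072 * 4096) * l + (bif s then 142 / 131072 else 1038 / 131072))} : Finset _) ×ˢ
  ({i : Fin 2048 | (bif s then 9 else 137) ≤ i.1 ∧ i.1 < bif s then 137 else 2048} : Finset _)

open Finset in
theorem mem_conflictLabels {V : Type} [Fintype V] (G : SimpleGraph V) [DecidableRel G.Adj]
    (t : ℕ) (s : Bool) (u : V) (a : Fin 4096 × Fin 2048) :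
    a ∈ conflictLabels G t s u ↔
      ((bif s then 9 else 137) ≤ a.2.1 ∧ a.2.1 < bif s then 137 else 2048) ∧
      G.degree u * ((bif s then 131578 / 131072 else 131130 / 131072) +
        260992 / (131072 * 4096) * (a.1.1 : ℝ)) ≤ (t : ℝ) ∧
      (t : ℝ) ≤ G.degree u * ((bif s then 131578 / 131072 else 131130 / 131072) +
        260992 / (131072 * 4096) * (a.1.1 : ℝ) +
          (bif s then 142 / 131072 else 1038 / 131072)) := by
  rw [conflictLabels, mem_product, mem_filter, mem_filter, and_comm]
  simp only [mem_univ, true_and]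

open Finset in
theorem card_conflictLabels_le {V : Type} [Fintype V] (G : SimpleGraph V) [DecidableRel G.Adj]
    (t : ℕ) (s : Bool) (u : V) (hu : 0 < G.degree u) :
    (#(conflictLabels G t s u) : ℝ) ≤
      ((bif s then 142 / 131072 else 1038 / 131072) / (260992 / (131072 * 4096)) + 1) *
        bif s then 128 else 1911 := by
  have htypes : #{i : Fin 2048 | (bif s then 9 else 137) ≤ i.1 ∧ i.1 < bif s then 137 else 2048} =
      bif s then 128 else 1911 := by
    rw [card_filter_fin_Ico (by cases s <;> norm_num)]
    cases s <;> rfl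
  rw [conflictLabels, card_product, htypes, Nat.cast_mul, Bool.apply_cond Nat.cast]
  refine mul_le_mul (card_filter_affine_le (by exact_mod_cast hu) (by norm_num)
    (by cases s <;> norm_num)) (by cases s <;> norm_num) (by cases s <;> norm_num)
    (by cases s <;> norm_num [add_nonneg])

open Finset in
/-- A sufficiently regular labelling by a level and a type yields a proper weighting: the type
determines the class of a vertex, the level its preliminary degree. -/
theorem exists_weights_of_labelling {V : Type} [Fintype V] [DecidableEq V] (G : SimpleGraph V)
    [DecidableRel G.Adj] (hD : ∀ v, 100000 ≤ G.degree v) (lab : V → Fin 4096 × Fin 2048)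
    (hP : ∀ v, ∀ P : Finset (Fin 4096 × Fin 2048),
      |(#{u ∈ G.neighborFinset v | lab u ∈ P} : ℝ) -
        G.degree v * (#P / Fintype.card (Fin 4096 × Fin 2048))| ≤ 1 / 131072 * G.degree v)
    (hL : ∀ v t s, t ≤ 3 * G.maxDegree →
      (#{u ∈ G.neighborFinset v | lab u ∈ conflictLabels G t s u} : ℝ) ≤
        (∑ u ∈ G.neighborFinset v, (#(conflictLabels G t s u) : ℝ) /
          Fintype.card (Fin 4096 × Fin 2048)) + 1 / 131072 * G.degree v) :
    ∃ w : V → V → ℕ, (∀ u v, w u v = w v u) ∧ (∀ u v, 1 ≤ w u v ∧ w u v ≤ 3) ∧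
      ∀ u v, G.Adj u v → ∑ x ∈ G.neighborFinset u, w u x ≠ ∑ x ∈ G.neighborFinset v, w v x := by
  have hΛ : (Fintype.card (Fin 4096 × Fin 2048) : ℝ) = 4096 * 2048 := by
    rw [Fintype.card_prod, Fintype.card_fin, Fintype.card_fin]; norm_num
  obtain ⟨ℓ, hℓ⟩ : ∃ ℓ : V → ℕ, ∀ v, (lab v).1.1 = ℓ v := ⟨_, fun _ => rfl⟩
  obtain ⟨τ, hτ⟩ : ∃ τ : V → ℕ, ∀ v, (lab v).2.1 = τ v := ⟨_, fun _ => rfl⟩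
  have hℓK : ∀ v, ℓ v < 4096 := fun v => hℓ v ▸ (lab v).1.2
  have hτN : ∀ v, τ v < 2048 := fun v => hτ v ▸ (lab v).2.2
  have hbox : ∀ v a b c d, a ≤ b → b ≤ 4096 → c ≤ d → d ≤ 2048 →
      |(#{u ∈ G.neighborFinset v | (a ≤ ℓ u ∧ ℓ u < b) ∧ c ≤ τ u ∧ τ u < d} : ℝ) -
        G.degree v * ((b - a) * (d - c) / (4096 * 2048))| ≤ 1 / 131072 * G.degree v := by
    intro v a b c d hab hb hcd hd
    have := hP v (({i : Fin 4096 | a ≤ i.1 ∧ i.1 < b} : Finset _) ×ˢ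
      ({i : Fin 2048 | c ≤ i.1 ∧ i.1 < d} : Finset _))
    rw [card_product, card_filter_fin_Ico hb, card_filter_fin_Ico hd, hΛ] at this
    simpa only [mem_product, mem_filter, mem_univ, true_and, hℓ, hτ, Nat.cast_mul,
      Nat.cast_sub hab, Nat.cast_sub hcd] using this
  obtain ⟨cl, hcl⟩ : ∃ cl : V → Fin 4, ∀ v, cl v = if τ v < 1 then 3 else if τ v < 9 then 2 else
      if τ v < 137 then 1 else 0 := ⟨_, fun _ => rfl⟩
  have hcl0 : ∀ v, cl v = 0 ↔ 137 ≤ τ v ∧ τ v < 2048 := by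
    intro v; have := hτN v; rw [hcl]; split_ifs <;> simp <;> omega
  have hcl1 : ∀ v, cl v = 1 ↔ 9 ≤ τ v ∧ τ v < 137 := by
    intro v; have := hτN v; rw [hcl]; split_ifs <;> simp <;> omega
  have hcl2 : ∀ v, cl v = 2 ↔ 1 ≤ τ v ∧ τ v < 9 := by
    intro v; have := hτN v; rw [hcl]; split_ifs <;> simp <;> omega
  have hcl3 : ∀ v, cl v = 3 ↔ 0 ≤ τ v ∧ τ v < 1 := by
    intro v; have := hτN v; rw [hcl]; split_ifs <;> simp <;> omega
  obtain ⟨n, hn⟩ : ∃ n : Fin 4 → V → ℕ, ∀ c v, n c v = #{u ∈ G.neighborFinset v | cl u = c} :=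
    ⟨_, fun _ _ => rfl⟩
  obtain ⟨h, hh⟩ : ∃ h : V → V → ℕ, ∀ u v, h u v = if 4096 ≤ ℓ u + ℓ v then 3 else 1 :=
    ⟨_, fun _ _ => rfl⟩
  obtain ⟨T, hT⟩ : ∃ T : V → ℕ, ∀ v, T v = (∑ u ∈ G.neighborFinset v with cl u = 0, h v u) +
      ∑ u ∈ G.neighborFinset v with cl u = 1, h v u := ⟨_, fun _ => rfl⟩
  have hn_box : ∀ k v c d, c ≤ d → d ≤ 2048 → (∀ u, cl u = k ↔ c ≤ τ u ∧ τ u < d) →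
      |(n k v : ℝ) - G.degree v * ((d - c) / 2048)| ≤ 1 / 131072 * G.degree v := by
    intro k v c d hcd hd hk
    have := hbox v 0 4096 c d (by norm_num) le_rfl hcd hd
    simp only [hℓK, Nat.zero_le, true_and, ← hk, ← hn, Nat.cast_zero, sub_zero,
      Nat.cast_ofNat] at this
    rwa [mul_div_mul_left _ _ (by norm_num)] at this
  have hn1 := fun v => abs_le.1 (hn_box 1 v 9 137 (by norm_num) (by norm_num) hcl1)
  have hn2 := fun v => abs_le.1 (hn_box 2 v 1 9 (by norm_num) (by norm_num) hcl2)
  have hn3 := fun v => abs_le.1 (hn_box 3 v 0 1 (by norm_num) (by norm_num) hcl3)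
  have hT_card : ∀ v, T v =
      #{u ∈ G.neighborFinset v | (0 ≤ ℓ u ∧ ℓ u < 4096) ∧ 9 ≤ τ u ∧ τ u < 2048} +
      2 * #{u ∈ G.neighborFinset v | (4096 - ℓ v ≤ ℓ u ∧ ℓ u < 4096) ∧ 9 ≤ τ u ∧ τ u < 2048} := by
    intro v
    rw [hT, sum_filter, sum_filter, card_filter, card_filter, mul_sum, ← sum_add_distrib,
      ← sum_add_distrib]
    refine sum_congr rfl fun u _ => ?_
    have h1 := hℓK u
    have h2 := hτN u
    have h3 := hℓK v
    simp only [hcl0, hcl1, hh]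
    split_ifs <;> omega
  have hT_bounds : ∀ v,
      G.degree v * (130496 / 131072 + 260992 / (131072 * 4096) * ℓ v - 3 / 131072) ≤
      (T v : ℝ) ∧
      (T v : ℝ) ≤ G.degree v * (130496 / 131072 + 260992 / (131072 * 4096) * ℓ v + 3 / 131072) := by
    intro v
    have h1 := abs_le.1 (hbox v 0 4096 9 2048 (by norm_num) le_rfl (by norm_num) le_rfl)
    have h2 := abs_le.1 (hbox v (4096 - ℓ v) 4096 9 2048 (by omega) le_rfl (by norm_num) le_rfl)
    rw [Nat.cast_sub (hℓK v).le] at h2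
    rw [hT_card]
    push_cast at h1 h2 ⊢
    constructor <;> linarith [h1.1, h1.2, h2.1, h2.2]
  have hDℓ : ∀ v, (G.degree v : ℝ) * ℓ v ≤ G.degree v * 4095 := by
    intro v
    have : (ℓ v : ℝ) ≤ 4095 := by exact_mod_cast Nat.le_of_lt_succ (hℓK v)
    exact mul_le_mul_of_nonneg_left this (Nat.cast_nonneg _)
  have hD' : ∀ v, (100000 : ℝ) ≤ G.degree v := fun v => by exact_mod_cast hD v
  have hconf : ∀ s v t, t ≤ 3 * G.degree v →
      (#{u ∈ G.neighborFinset v | lab u ∈ conflictLabels G t s u} : ℝ) ≤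
        G.degree v * ((bif s then 7.5 else 518) / 131072) := by
    intro s v t ht
    refine (hL v t s (ht.trans (Nat.mul_le_mul_left _ (G.degree_le_maxDegree v)))).trans ?_
    have h1 : ∀ u ∈ G.neighborFinset v, (#(conflictLabels G t s u) : ℝ) /
        Fintype.card (Fin 4096 × Fin 2048) ≤ (bif s then 6.5 else 517) / 131072 := by
      intro u _
      have := card_conflictLabels_le G t s u (by have := hD u; omega)
      rw [hΛ, div_le_iff₀ (by norm_num)]
      refine this.trans ?_
      cases s <;> norm_num
    have h2 := sum_le_sum h1
    rw [sum_const, nsmul_eq_mul, G.card_neighborFinset_eq_degree] at h2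
    refine (add_le_add_left h2 _).trans (le_of_eq ?_)
    cases s <;> simp <;> ring
  refine exists_weights_of_classes G cl h (fun u v => by simp only [hh, add_comm])
    (fun u v => by rw [hh]; split_ifs <;> norm_num) n hn T hT ?_ ?_ ?_ ?_
  · intro v _
    have ht : n 2 v + 2 * n 3 v + T v ≤ 3 * G.degree v := by
      have : (n 2 v + 2 * n 3 v + T v : ℝ) ≤ 3 * G.degree v := by
        linarith [(hn2 v).2, (hn3 v).2, (hT_bounds v).2, hDℓ v, hD' v]
      exact_mod_cast this
    have h1 := hconf false v _ ht
    have h2 : #{u ∈ G.neighborFinset v | cl u = 0 ∧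
        n 2 u + 2 * n 3 u + T u ≤ n 2 v + 2 * n 3 v + T v ∧
        n 2 v + 2 * n 3 v + T v ≤ n 2 u + 2 * n 3 u + T u + 2 * n 2 u} ≤
        #{u ∈ G.neighborFinset v | lab u ∈ conflictLabels G (n 2 v + 2 * n 3 v + T v) false u} := by
      refine card_le_card fun u hu => ?_
      rw [mem_filter, hcl0] at hu
      obtain ⟨hu, hc, hu1, hu2⟩ := hu
      rw [mem_filter, mem_conflictLabels, hτ, hℓ]
      have hu1' : (n 2 u + 2 * n 3 u + T u : ℝ) ≤ (n 2 v + 2 * n 3 v + T v : ℕ) := by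
        exact_mod_cast hu1
      have hu2' : ((n 2 v + 2 * n 3 v + T v : ℕ) : ℝ) ≤
          n 2 u + 2 * n 3 u + T u + 2 * n 2 u := by exact_mod_cast hu2
      have e2 := hn2 u
      have e3 := hn3 u
      have eT := hT_bounds u
      refine ⟨hu, ⟨hc.1, hc.2⟩, ?_, ?_⟩ <;> dsimp only [cond] <;> push_cast at * <;>
        linarith [e2.1, e2.2, e3.1, e3.2, eT.1, eT.2]
    have h3 : (2 * n 2 v + 1 : ℝ) ≤ 10 * ((2 * n 2 v + 1) / 10 : ℕ) + 9 := by
      exact_mod_cast (by omega : 2 * n 2 v + 1 ≤ 10 * ((2 * n 2 v + 1) / 10) + 9)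
    have h4 : (G.degree v * (518 / 131072) : ℝ) < (6 * ((2 * n 2 v + 1) / 10) : ℕ) := by
      have := (hn2 v).1
      have := hD' v
      push_cast at *
      linarith
    dsimp only [cond] at h1
    exact h2.trans_lt (by exact_mod_cast h1.trans_lt h4)
  · intro v _
    have ht : n 3 v + 2 * n 2 v + T v ≤ 3 * G.degree v := by
      have : (n 3 v + 2 * n 2 v + T v : ℝ) ≤ 3 * G.degree v := by
        linarith [(hn2 v).2, (hn3 v).2, (hT_bounds v).2, hDℓ v, hD' v]
      exact_mod_cast this
    have h1 := hconf true v _ ht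
    have h2 : #{u ∈ G.neighborFinset v | cl u = 1 ∧
        n 3 u + 2 * n 2 u + T u ≤ n 3 v + 2 * n 2 v + T v ∧
        n 3 v + 2 * n 2 v + T v ≤ n 3 u + 2 * n 2 u + T u + 2 * n 3 u} ≤
        #{u ∈ G.neighborFinset v | lab u ∈ conflictLabels G (n 3 v + 2 * n 2 v + T v) true u} := by
      refine card_le_card fun u hu => ?_
      rw [mem_filter, hcl1] at hu
      obtain ⟨hu, hc, hu1, hu2⟩ := hu
      rw [mem_filter, mem_conflictLabels, hτ, hℓ]
      have hu1' : (n 3 u + 2 * n 2 u + T u : ℝ) ≤ (n 3 v + 2 * n 2 v + T v : ℕ) := by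
        exact_mod_cast hu1
      have hu2' : ((n 3 v + 2 * n 2 v + T v : ℕ) : ℝ) ≤
          n 3 u + 2 * n 2 u + T u + 2 * n 3 u := by exact_mod_cast hu2
      have e2 := hn2 u
      have e3 := hn3 u
      have eT := hT_bounds u
      refine ⟨hu, ⟨hc.1, hc.2⟩, ?_, ?_⟩ <;> dsimp only [cond] <;> push_cast at * <;>
        linarith [e2.1, e2.2, e3.1, e3.2, eT.1, eT.2]
    have h3 : (2 * n 3 v + 1 : ℝ) ≤ 10 * ((2 * n 3 v + 1) / 10 : ℕ) + 9 := by
      exact_mod_cast (by omega : 2 * n 3 v + 1 ≤ 10 * ((2 * n 3 v + 1) / 10) + 9)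
    have h4 : (G.degree v * (7.5 / 131072) : ℝ) < ((2 * n 3 v + 1) / 10 : ℕ) := by
      have := (hn3 v).1
      have := hD' v
      push_cast at *
      linarith
    dsimp only [cond] at h1
    exact h2.trans_lt (by exact_mod_cast h1.trans_lt h4)
  · intro v _
    have : (10 * n 2 v + 9 : ℝ) < n 1 v + 1 := by
      have h1 := (hn1 v).1
      have h2 := (hn2 v).2
      have := hD' v
      push_cast at h1 h2
      linarith
    have : 10 * n 2 v + 9 < n 1 v + 1 := by exact_mod_cast this
    omega
  · intro v _
    have : (10 * n 3 v + 9 : ℝ) < 2 * n 2 v + 1 := by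
      have h1 := (hn2 v).1
      have h2 := (hn3 v).2
      have := hD' v
      push_cast at h1 h2
      linarith
    have : 10 * n 3 v + 9 < 2 * n 2 v + 1 := by exact_mod_cast this
    omega

/-- **The 1–2–3 Conjecture for graphs of large minimum degree.**
There exists a constant `C` such that every finite simple graph `G` with maximum
degree `Δ ≥ 2` and minimum degree `δ ≥ C * ln Δ` admits a vertex-colouring
`3`-weighting, i.e. a map `ω` assigning to each edge a weight in `{1,2,3}` such
that the weighted degrees of any two adjacent vertices differ. -/
theorem statement0 :
    ∃ C : ℝ, ∀ (V : Type) [Fintype V] [DecidableEq V]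
      (G : SimpleGraph V) [DecidableRel G.Adj],
      2 ≤ G.maxDegree →
      C * Real.log G.maxDegree ≤ (G.minDegree : ℝ) →
      ∃ ω : Sym2 V → ℕ,
        (∀ e ∈ G.edgeFinset, ω e = 1 ∨ ω e = 2 ∨ ω e = 3) ∧
        ∀ u v : V, G.Adj u v →
          (∑ e ∈ G.edgeFinset.filter (fun e => u ∈ e), ω e) ≠
          (∑ e ∈ G.edgeFinset.filter (fun e => v ∈ e), ω e) := by
  obtain ⟨C, hC⟩ := exists_labelling_two_sided (Λ := Fin 4096 × Fin 2048) (θ := 1 / 131072)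
    (by norm_num) (by norm_num) 100000
  refine ⟨C, ?_⟩
  intro V _ _ G _ hΔ hδ
  obtain ⟨hmin, hlab⟩ := hC V G hΔ hδ
  obtain ⟨lab, hP, hL⟩ := hlab (conflictLabels G)
  obtain ⟨w, hsymm, hrange, hne⟩ := exists_weights_of_labelling G
    (fun v => hmin.trans (G.minDegree_le_degree v)) lab hP hL
  refine ⟨Sym2.lift ⟨w, hsymm⟩, fun e _ => ?_, fun u v huv => ?_⟩
  · induction e using Sym2.ind with
    | _ u v =>
      have := hrange u v
      rw [Sym2.lift_mk]
      dsimp only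
      omega
  · rw [sum_filter_edgeFinset_lift, sum_filter_edgeFinset_lift]
    exact hne u v huv
end

section
/- There exists Δ₀ such that the following holds. Let G = (V,E) be a finite simple graph with maximum degree Δ ≥ Δ₀ and minimum degree δ ≥ 10^{20}·ln Δ, let U ⊆ V satisfy |d_U(v) − 10^{-4}·d(v)| ≤ 10^{-6}·d(v) for all v ∈ V, set W = V ∖ U and F = E(U,W), let F_W ⊆ F satisfy |d_{F_W}(w) − 10^{-4}·d_U(w)| ≤ 10^{-6}·d_U(w) for all w ∈ W and |d_{F_W}(u) − 10^{-4}·d_W(u)| ≤ 10^{-6}·d_W(u) for all u ∈ U, and set F' = F ∖ F_W. Then there exist integers i_u ∈ {0,1,…,10³−1} for u ∈ U and a set F_U ⊆ F' such that: (i) for every u ∈ U, |d_{F_U}(u) − 10^{-3}·i_u·d_{F'}(u)| ≤ 10^{-5}·d(u); (ii) for every w ∈ W, |d_{F_U}(w) − ((1−10^{-3})/2)·d_{F'}(w)| ≤ 10^{-5}·d_{F'}(w); and (iii) for every u ∈ U, defining J(u) = [d(u) + 10^{-3}·i_u·d_{F'}(u) − 10^{-5}·d(u), d(u) + 10^{-3}·i_u·d_{F'}(u)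 + 10^{-5}·d(u) + d_{F_W}(u) + 2·d_U(u)] and N^U_≤(u) = {u' ∈ N(u) ∩ U : 0.5·d(u) ≤ d(u') ≤ d(u) and J(u') ∩ J(u) ≠ ∅}, one has |N^U_≤(u)| ≤ 2·10^{-3}·d_U(u). -/
/-- Number of neighbours of `v` that lie in the vertex set `A`. -/
def dIn {V : Type} [Fintype V] [DecidableEq V] (G : SimpleGraph V) [DecidableRel G.Adj]
    (A : Finset V) (v : V) : ℕ :=
  (G.neighborFinset v ∩ A).card

/-- Number of edges of the edge set `F` incident with `v`. -/
def dE {V : Type} [DecidableEq V] (F : Finset (Sym2 V)) (v : V) : ℕ :=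
  (F.filter (fun e => v ∈ e)).card

/-- The set `E(A,B)` of edges of `G` with one end in `A` and the other in `B`. -/
def between {V : Type} [Fintype V] [DecidableEq V] (G : SimpleGraph V) [DecidableRel G.Adj]
    (A B : Finset V) : Finset (Sym2 V) :=
  G.edgeFinset.filter (fun e => ∃ a ∈ A, ∃ b ∈ B, e = s(a, b))

/-- The interval `J(u)`. -/
noncomputable def Jset {V : Type} [Fintype V] [DecidableEq V] (G : SimpleGraph V)
    [DecidableRel G.Adj] (U : Finset V) (F' F_W : Finset (Sym2 V)) (i : V → ℕ) (u : V) :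
    Set ℝ :=
  Set.Icc ((G.degree u : ℝ) + 1e-3 * i u * dE F' u - 1e-5 * G.degree u)
    ((G.degree u : ℝ) + 1e-3 * i u * dE F' u + 1e-5 * G.degree u + dE F_W u +
      2 * dIn G U u)

section ProductSpace

open scoped BigOperators

variable {ι β : Type*} [Fintype ι] [DecidableEq ι] [Fintype β]

/-- Functions of disjoint sets of coordinates are independent under the uniform measure. -/
lemma expect_mul_of_dependsOn [Nonempty β] {f g : (ι → β) → ℝ} {s t : Set ι}
    (hf : DependsOn f s) (hg : DependsOn g t) (hst : Disjoint s t) :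
    𝔼 x, f x * g x = (𝔼 x, f x) * 𝔼 x, g x := by
  classical
  let σ : (ι → β) × (ι → β) → (ι → β) × (ι → β) :=
    fun p => (s.piecewise p.1 p.2, s.piecewise p.2 p.1)
  have hσ : Function.Involutive σ := by
    rintro ⟨x, y⟩
    ext i <;> by_cases hi : i ∈ s <;> simp [σ, hi]
  have key : ∀ p : (ι → β) × (ι → β), f p.1 * g p.2 = f (σ p).1 * g (σ p).1 := by
    rintro ⟨x, y⟩
    congr 1
    · exact hf fun i hi => by simp [σ, hi]
    · exact hg fun i hi => by simp [σ, hst.notMem_of_mem_right hi]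
  have h1 : ∑ p : (ι → β) × (ι → β), f p.1 * g p.2 =
      ∑ p : (ι → β) × (ι → β), f p.1 * g p.1 :=
    Fintype.sum_equiv hσ.toPerm _ _ key
  rw [Fintype.sum_prod_type, Fintype.sum_prod_type, ← Finset.sum_mul_sum] at h1
  simp only [Finset.sum_const, nsmul_eq_mul, Finset.card_univ, ← Finset.mul_sum] at h1
  simp only [Fintype.expect_eq_sum_div_card]
  have : (Fintype.card (ι → β) : ℝ) ≠ 0 := by simp
  field_simp
  linarith

/-- Resampling one coordinate does not change a uniform average. -/
lemma expect_expect_update [Nonempty β] (f : (ι → β) → ℝ) (a : ι) :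
    𝔼 x, f x = 𝔼 b, 𝔼 x, f (Function.update x a b) := by
  let σ : β × (ι → β) → β × (ι → β) := fun p => (p.2 a, Function.update p.2 a p.1)
  have hσ : Function.Involutive σ := by
    rintro ⟨x, y⟩
    simp [σ]
  have h1 : ∑ p : β × (ι → β), f (Function.update p.2 a p.1) = ∑ p : β × (ι → β), f p.2 :=
    Fintype.sum_equiv hσ.toPerm _ _ fun p => rfl
  rw [Fintype.sum_prod_type, Fintype.sum_prod_type] at h1
  simp only [Finset.sum_const, nsmul_eq_mul, Finset.card_univ] at h1
  simp only [Fintype.expect_eq_sum_div_card]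
  have : (Fintype.card (ι → β) : ℝ) ≠ 0 := by simp
  have : (Fintype.card β : ℝ) ≠ 0 := by simp
  rw [← Finset.sum_div, h1]
  field_simp

lemma expect_apply [Nonempty β] (g : β → ℝ) (a : ι) :
    𝔼 x : ι → β, g (x a) = 𝔼 b, g b := by
  rw [expect_expect_update _ a]
  simp

lemma expect_apply_apply [Nonempty β] (g : β → β → ℝ) {a b : ι} (hab : a ≠ b) :
    𝔼 x : ι → β, g (x a) (x b) = 𝔼 c, 𝔼 d, g d c := by
  rw [expect_expect_update _ b]
  refine Finset.expect_congr rfl fun c _ => ?_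
  rw [expect_expect_update _ a]
  simp [hab]

/-- The moment generating function of a sum of independent bounded variables with nonpositive
means. -/
lemma expect_exp_sum_le [Nonempty β] {κ : Type*} (K : Finset κ) (X : κ → (ι → β) → ℝ)
    (T : κ → Set ι) (hX : ∀ k ∈ K, DependsOn (X k) (T k))
    (hT : (K : Set κ).PairwiseDisjoint T) (hmean : ∀ k ∈ K, 𝔼 x, X k x ≤ 0)
    (hbd : ∀ k ∈ K, ∀ x, |X k x| ≤ 1) {r : ℝ} (hr0 : 0 ≤ r) (hr1 : r ≤ 1) :
    𝔼 x, Real.exp (r * ∑ k ∈ K, X k x) ≤ Real.exp (r ^ 2 * K.card) := by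
  classical
  induction K using Finset.induction_on with
  | empty => simp
  | insert a K ha ih =>
    have hdep : DependsOn (fun x => Real.exp (r * ∑ k ∈ K, X k x)) (⋃ k ∈ K, T k) := by
      intro x y hxy
      simp only
      congr 2
      refine Finset.sum_congr rfl fun k hk => hX k (Finset.mem_insert_of_mem hk) fun i hi => ?_
      exact hxy i (Set.mem_biUnion (by exact_mod_cast hk) hi)
    have hdepa : DependsOn (fun x => Real.exp (r * X a x)) (T a) := by
      intro x y hxy
      simp only
      rw [hX a (Finset.mem_insert_self a K) hxy]
    have hdisj : Disjoint (T a) (⋃ k ∈ K, T k) := by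
      rw [Set.disjoint_iUnion₂_right]
      intro k hk
      exact hT (by simp) (by simp [hk]) (by rintro rfl; exact ha hk)
    have ih' := ih (fun k hk => hX k (Finset.mem_insert_of_mem hk))
      (hT.subset (by simp)) (fun k hk => hmean k (Finset.mem_insert_of_mem hk))
      (fun k hk => hbd k (Finset.mem_insert_of_mem hk))
    have h1 : 𝔼 x, Real.exp (r * X a x) ≤ Real.exp (r ^ 2) := by
      calc 𝔼 x, Real.exp (r * X a x) ≤ 𝔼 x, (1 + r * X a x + r ^ 2) := by
            refine Finset.expect_le_expect fun x _ => ?_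
            have hb := hbd a (Finset.mem_insert_self a K) x
            have hb2 : |r * X a x| ≤ 1 := by
              rw [abs_mul, abs_of_nonneg hr0]
              exact mul_le_one₀ hr1 (abs_nonneg _) hb
            have := (abs_le.1 (Real.abs_exp_sub_one_sub_id_le hb2)).2
            have h2 : X a x ^ 2 ≤ 1 := by rw [← sq_abs]; exact pow_le_one₀ (abs_nonneg _) hb
            nlinarith [sq_nonneg r]
        _ = 1 + r * (𝔼 x, X a x) + r ^ 2 := by
            rw [Finset.expect_add_distrib, Finset.expect_add_distrib, ← Finset.mul_expect,
              Fintype.expect_const, Fintype.expect_const]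
        _ ≤ r ^ 2 + 1 := by
            nlinarith [hmean a (Finset.mem_insert_self a K)]
        _ ≤ _ := Real.add_one_le_exp _
    calc 𝔼 x, Real.exp (r * ∑ k ∈ insert a K, X k x)
        = 𝔼 x, Real.exp (r * X a x) * Real.exp (r * ∑ k ∈ K, X k x) := by
          refine Finset.expect_congr rfl fun x _ => ?_
          rw [Finset.sum_insert ha, mul_add, Real.exp_add]
      _ = _ := expect_mul_of_dependsOn hdepa hdep hdisj
      _ ≤ Real.exp (r ^ 2) * Real.exp (r ^ 2 * K.card) := by
          refine mul_le_mul h1 ih' ?_ (Real.exp_nonneg _)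
          exact Finset.expect_nonneg fun x _ => Real.exp_nonneg _
      _ = _ := by
          rw [← Real.exp_add, Finset.card_insert_of_notMem ha]
          push_cast
          ring_nf

end ProductSpace

section Probability

open scoped BigOperators

open scoped Classical in
/-- The probability of an event under the uniform measure on a finite type. -/
noncomputable def unifProb {Ω : Type*} [Fintype Ω] (p : Ω → Prop) : ℝ :=
  𝔼 x, if p x then 1 else 0

variable {Ω : Type*} [Fintype Ω]

lemma unifProb_eq_expect (p : Ω → Prop) [DecidablePred p] :
    unifProb p = 𝔼 x, if p x then 1 else 0 := by
  unfold unifProb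
  congr!

lemma unifProb_nonneg (p : Ω → Prop) : 0 ≤ unifProb p :=
  Finset.expect_nonneg fun x _ => by split_ifs <;> norm_num

lemma unifProb_mono {p q : Ω → Prop} (h : ∀ x, p x → q x) : unifProb p ≤ unifProb q := by
  refine Finset.expect_le_expect fun x _ => ?_
  by_cases hp : p x
  · simp [hp, h x hp]
  · simp only [hp, if_false]
    split_ifs <;> norm_num

lemma unifProb_or_le (p q : Ω → Prop) :
    unifProb (fun x => p x ∨ q x) ≤ unifProb p + unifProb q := by
  unfold unifProb
  rw [← Finset.expect_add_distrib]
  refine Finset.expect_le_expect fun x _ => ?_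
  by_cases hp : p x <;> by_cases hq : q x <;> simp [hp, hq]

lemma unifProb_exists_mem_le {κ : Type*} (K : Finset κ) (p : κ → Ω → Prop) :
    unifProb (fun x => ∃ k ∈ K, p k x) ≤ ∑ k ∈ K, unifProb (p k) := by
  classical
  induction K using Finset.induction_on with
  | empty => simp [unifProb]
  | insert a K ha ih =>
    rw [Finset.sum_insert ha]
    refine le_trans (unifProb_mono fun x hx => ?_)
      ((unifProb_or_le (p a) (fun x => ∃ k ∈ K, p k x)).trans (by linarith))
    simpa using hx

lemma unifProb_exists_le {κ : Type*} [Fintype κ] (p : κ → Ω → Prop) {b : ℝ}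
    (h : ∀ k, unifProb (p k) ≤ b) :
    unifProb (fun x => ∃ k, p k x) ≤ Fintype.card κ * b := by
  have h1 := unifProb_exists_mem_le Finset.univ p
  simp only [Finset.mem_univ, true_and] at h1
  refine h1.trans ((Finset.sum_le_sum fun k _ => h k).trans ?_)
  simp

lemma unifProb_and_add_and_not (p q : Ω → Prop) :
    unifProb (fun x => p x ∧ q x) + unifProb (fun x => ¬ p x ∧ q x) = unifProb q := by
  unfold unifProb
  rw [← Finset.expect_add_distrib]
  refine Finset.expect_congr rfl fun x _ => ?_
  by_cases hp : p x <;> by_cases hq : q x <;> simp [hp, hq]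

lemma exists_of_unifProb_pos {p : Ω → Prop} (h : 0 < unifProb p) : ∃ x, p x := by
  by_contra! hne
  simp [unifProb, hne] at h

lemma unifProb_lt_le_expect_exp {Y : Ω → ℝ} (r c : ℝ) (hr : 0 ≤ r) :
    unifProb (fun x => c < Y x) ≤ Real.exp (-(r * c)) * 𝔼 x, Real.exp (r * Y x) := by
  rw [Finset.mul_expect]
  refine Finset.expect_le_expect fun x _ => ?_
  split_ifs with h
  · rw [← Real.exp_add]
    refine Real.one_le_exp ?_
    nlinarith
  · positivity

variable {ι β : Type*} [Fintype ι] [DecidableEq ι] [Fintype β] [Nonempty β]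

lemma unifProb_and_of_dependsOn {p q : (ι → β) → Prop} {s t : Set ι}
    (hp : DependsOn p s) (hq : DependsOn q t) (hst : Disjoint s t) :
    unifProb (fun x => p x ∧ q x) = unifProb p * unifProb q := by
  classical
  unfold unifProb
  rw [← expect_mul_of_dependsOn (s := s) (t := t) _ _ hst]
  · refine Finset.expect_congr rfl fun x _ => ?_
    by_cases hp : p x <;> by_cases hq : q x <;> simp [hp, hq]
  · intro x y h
    simp only [hp h]
  · intro x y h
    simp only [hq h]

/-- A Chernoff bound for independent bounded variables with nonpositive means. -/
lemma unifProb_lt_sum_le {κ : Type*} (K : Finset κ) (X : κ → (ι → β) → ℝ)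
    (T : κ → Set ι) (hX : ∀ k ∈ K, DependsOn (X k) (T k))
    (hT : (K : Set κ).PairwiseDisjoint T) (hmean : ∀ k ∈ K, 𝔼 x, X k x ≤ 0)
    (hbd : ∀ k ∈ K, ∀ x, |X k x| ≤ 1) {t : ℝ} (ht0 : 0 ≤ t) (ht1 : t ≤ 1) :
    unifProb (fun x => t * K.card < ∑ k ∈ K, X k x) ≤ Real.exp (-(t ^ 2 / 4 * K.card)) := by
  refine (unifProb_lt_le_expect_exp (t / 2) _ (by positivity)).trans ?_
  refine (mul_le_mul_of_nonneg_left (expect_exp_sum_le K X T hX hT hmean hbd (by positivity)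
    (by linarith)) (Real.exp_nonneg _)).trans (le_of_eq ?_)
  rw [← Real.exp_add]
  ring_nf

/-- Upper tail of the number of occurring events among independent ones. -/
lemma unifProb_lt_card_filter_le {κ : Type*} (K : Finset κ) (p : κ → (ι → β) → Prop)
    [∀ k, DecidablePred (p k)] (T : κ → Set ι) (hp : ∀ k ∈ K, DependsOn (p k) (T k))
    (hT : (K : Set κ).PairwiseDisjoint T) {q : ℝ} (hq0 : 0 ≤ q) (hq1 : q ≤ 1)
    (hmean : ∀ k ∈ K, unifProb (p k) ≤ q) {t : ℝ} (ht0 : 0 ≤ t) (ht1 : t ≤ 1) :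
    unifProb (fun x => (q + t) * K.card < ((K.filter fun k => p k x).card : ℝ)) ≤
      Real.exp (-(t ^ 2 / 4 * K.card)) := by
  refine le_trans (unifProb_mono fun x hx => ?_) (unifProb_lt_sum_le K
    (fun k x => (if p k x then 1 else 0) - q) T ?_ hT ?_ ?_ ht0 ht1)
  · rw [Finset.sum_sub_distrib, Finset.sum_boole, Finset.sum_const, nsmul_eq_mul]
    linarith
  · intro k hk x y hxy
    simp only [hp k hk hxy]
  · intro k hk
    rw [Finset.expect_sub_distrib, Fintype.expect_const]
    have := hmean k hk
    rw [unifProb_eq_expect] at this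
    linarith
  · intro k _ x
    rw [abs_le]
    split_ifs <;> constructor <;> linarith

/-- Lower tail of the number of occurring events among independent ones. -/
lemma unifProb_card_filter_lt_le {κ : Type*} (K : Finset κ) (p : κ → (ι → β) → Prop)
    [∀ k, DecidablePred (p k)] (T : κ → Set ι) (hp : ∀ k ∈ K, DependsOn (p k) (T k))
    (hT : (K : Set κ).PairwiseDisjoint T) {q : ℝ} (hq0 : 0 ≤ q) (hq1 : q ≤ 1)
    (hmean : ∀ k ∈ K, q ≤ unifProb (p k)) {t : ℝ} (ht0 : 0 ≤ t) (ht1 : t ≤ 1) :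
    unifProb (fun x => ((K.filter fun k => p k x).card : ℝ) < (q - t) * K.card) ≤
      Real.exp (-(t ^ 2 / 4 * K.card)) := by
  refine le_trans (unifProb_mono fun x hx => ?_) (unifProb_lt_sum_le K
    (fun k x => q - if p k x then 1 else 0) T ?_ hT ?_ ?_ ht0 ht1)
  · rw [Finset.sum_sub_distrib, Finset.sum_boole, Finset.sum_const, nsmul_eq_mul]
    linarith
  · intro k hk x y hxy
    simp only [hp k hk hxy]
  · intro k hk
    rw [Finset.expect_sub_distrib, Fintype.expect_const]
    have := hmean k hk
    rw [unifProb_eq_expect] at this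
    linarith
  · intro k _ x
    rw [abs_le]
    split_ifs <;> constructor <;> linarith

/-- Two-sided concentration of the number of occurring events among independent events of
equal probability. -/
lemma unifProb_lt_abs_card_filter_sub_le {κ : Type*} (K : Finset κ) (p : κ → (ι → β) → Prop)
    [∀ k, DecidablePred (p k)] (T : κ → Set ι) (hp : ∀ k ∈ K, DependsOn (p k) (T k))
    (hT : (K : Set κ).PairwiseDisjoint T) {q : ℝ} (hq0 : 0 ≤ q) (hq1 : q ≤ 1)
    (hmean : ∀ k ∈ K, unifProb (p k) = q) {t : ℝ} (ht0 : 0 ≤ t) (ht1 : t ≤ 1) :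
    unifProb (fun x => t * K.card < |((K.filter fun k => p k x).card : ℝ) - q * K.card|) ≤
      2 * Real.exp (-(t ^ 2 / 4 * K.card)) := by
  have h1 := unifProb_lt_card_filter_le K p T hp hT hq0 hq1 (fun k hk => (hmean k hk).le) ht0 ht1
  have h2 := unifProb_card_filter_lt_le K p T hp hT hq0 hq1 (fun k hk => (hmean k hk).ge) ht0 ht1
  refine le_trans (unifProb_mono fun x hx => ?_) ((unifProb_or_le _ _).trans
    ((add_le_add h1 h2).trans_eq (by ring)))
  rcases lt_abs.1 hx with h | h
  · left; linarith
  · right; linarith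

/-- The symmetric Lovász local lemma for events determined by independent uniform variables. -/
lemma exists_forall_not_of_local {κ : Type*} [Fintype κ] (A : κ → (ι → β) → Prop)
    (T : κ → Set ι) (hA : ∀ k, DependsOn (A k) (T k)) {D : ℝ} (hD : 1 ≤ D)
    (N : κ → Finset κ) (hN : ∀ k, ((N k).card : ℝ) ≤ D)
    (hdisj : ∀ k, ∀ l ∉ N k, Disjoint (T k) (T l))
    (hprob : ∀ k, unifProb (A k) * (4 * D) ≤ 1) :
    ∃ x, ∀ k, ¬ A k x := by
  classical
  let B : Finset κ → (ι → β) → Prop := fun S x => ∀ k ∈ S, ¬ A k x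
  have hB : ∀ S, DependsOn (B S) (⋃ k ∈ S, T k) := by
    intro S x y hxy
    refine propext (forall₂_congr fun k hk => ?_)
    rw [hA k fun i hi => hxy i (Set.mem_biUnion (by exact_mod_cast hk) hi)]
  have main : ∀ S : Finset κ, ∀ j,
      unifProb (fun x => A j x ∧ B S x) * (2 * D) ≤ unifProb (B S) := by
    intro S
    induction S using Finset.strongInduction with
    | H S ih =>
      intro j
      set S₁ := S.filter (· ∈ N j) with hS₁
      set S₂ := S.filter (· ∉ N j) with hS₂
      have hind : unifProb (fun x => A j x ∧ B S₂ x) = unifProb (A j) * unifProb (B S₂) := by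
        refine unifProb_and_of_dependsOn (hA j) (hB S₂) ?_
        rw [Set.disjoint_iUnion₂_right]
        intro k hk
        exact hdisj j k (Finset.mem_filter.1 hk).2
      have hle : unifProb (fun x => A j x ∧ B S x) ≤ unifProb (fun x => A j x ∧ B S₂ x) :=
        unifProb_mono fun x hx => ⟨hx.1, fun k hk => hx.2 k (Finset.mem_filter.1 hk).1⟩
      have hhalf : unifProb (B S₂) ≤ 2 * unifProb (B S) := by
        rcases S₁.eq_empty_or_nonempty with he | ⟨a, ha⟩
        · have : S₂ = S := by
            rw [hS₂, Finset.filter_eq_self]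
            intro k hk hkN
            have : k ∈ S₁ := Finset.mem_filter.2 ⟨hk, hkN⟩
            simp [he] at this
          rw [this]
          linarith [unifProb_nonneg (B S)]
        · have hss : S₂ ⊂ S := by
            refine Finset.filter_ssubset.2 ⟨a, (Finset.mem_filter.1 ha).1, ?_⟩
            simpa using (Finset.mem_filter.1 ha).2
          have h1 : unifProb (B S₂) ≤
              unifProb (B S) + unifProb (fun x => ∃ k ∈ S₁, A k x ∧ B S₂ x) := by
            refine le_trans (unifProb_mono fun x hx => ?_) (unifProb_or_le _ _)
            by_cases h : B S x
            · exact Or.inl h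
            · right
              simp only [B, not_forall, not_not] at h
              obtain ⟨k, hk, hAk⟩ := h
              refine ⟨k, Finset.mem_filter.2 ⟨hk, ?_⟩, hAk, hx⟩
              by_contra hkN
              exact hx k (Finset.mem_filter.2 ⟨hk, hkN⟩) hAk
          have h2 := unifProb_exists_mem_le S₁ (fun k x => A k x ∧ B S₂ x)
          have h3 : (∑ k ∈ S₁, unifProb fun x => A k x ∧ B S₂ x) * (2 * D) ≤
              D * unifProb (B S₂) := by
            rw [Finset.sum_mul]
            refine (Finset.sum_le_sum fun k _ => ih S₂ hss k).trans ?_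
            rw [Finset.sum_const, nsmul_eq_mul]
            refine mul_le_mul_of_nonneg_right (le_trans ?_ (hN j)) (unifProb_nonneg _)
            exact_mod_cast Finset.card_le_card fun k hk => (Finset.mem_filter.1 hk).2
          have h4 : (∑ k ∈ S₁, unifProb fun x => A k x ∧ B S₂ x) ≤ unifProb (B S₂) / 2 := by
            rw [le_div_iff₀ two_pos]
            refine le_of_mul_le_mul_left ?_ (zero_lt_one.trans_le hD)
            linarith
          linarith
      have h5 : unifProb (A j) * unifProb (B S₂) * (4 * D) ≤ unifProb (B S₂) := by
        nlinarith [mul_le_mul_of_nonneg_right (hprob j) (unifProb_nonneg (B S₂))]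
      rw [hind] at hle
      nlinarith
  have hpos : ∀ S : Finset κ, 0 < unifProb (B S) := by
    intro S
    induction S using Finset.induction_on with
    | empty => simp [B, unifProb]
    | insert a S ha ih =>
      have h1 := main S a
      have h2 := unifProb_and_add_and_not (A a) (B S)
      have h3 : unifProb (B (insert a S)) = unifProb (fun x => ¬ A a x ∧ B S x) := by
        simp only [B, Finset.forall_mem_insert]
      have h4 := unifProb_nonneg fun x => A a x ∧ B S x
      rw [h3]
      nlinarith
  obtain ⟨x, hx⟩ := exists_of_unifProb_pos (hpos Finset.univ)
  exact ⟨x, fun k => hx k (Finset.mem_univ k)⟩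

open scoped Classical in
lemma unifProb_apply (a : ι) (p : β → Prop) :
    unifProb (fun x : ι → β => p (x a)) = unifProb p :=
  expect_apply (fun b => if p b then 1 else 0) a

open scoped Classical in
lemma unifProb_apply_apply {a b : ι} (hab : a ≠ b) (p : β → β → Prop) :
    unifProb (fun x : ι → β => p (x a) (x b)) = 𝔼 c, unifProb fun d => p d c :=
  expect_apply_apply (fun d c => if p d c then 1 else 0) hab

end Probability

section Fin

open scoped BigOperators

lemma unifProb_val_lt {n : ℕ} (k : ℕ) (hk : k ≤ n) :
    unifProb (fun b : Fin n => b.val < k) = k / n := by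
  classical
  unfold unifProb
  rw [Fintype.expect_eq_sum_div_card, Fintype.card_fin]
  congr 1
  have h : (Finset.univ.filter fun b : Fin n => b.val < k).card = k := by
    rw [Fin.card_filter_val_lt, min_eq_right hk]
  refine Eq.trans ?_ (congrArg Nat.cast h)
  rw [Finset.natCast_card_filter]
  refine Finset.sum_congr rfl fun b _ => ?_
  congr

lemma unifProb_apply_val_lt_apply_val {ι : Type*} [Fintype ι] [DecidableEq ι] {n : ℕ} [NeZero n]
    {a b : ι} (hab : a ≠ b) :
    unifProb (fun x : ι → Fin n => (x a).val < (x b).val) = (1 - 1 / n) / 2 := by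
  rw [unifProb_apply_apply hab fun c d : Fin n => c.val < d.val]
  have hn : (n : ℝ) ≠ 0 := Nat.cast_ne_zero.2 (NeZero.ne n)
  have h : ∑ c : Fin n, (c.val : ℝ) = n * (n - 1) / 2 := by
    rw [Fin.sum_univ_eq_sum_range fun c => (c : ℝ)]
    have h2 := Finset.sum_range_id_mul_two n
    have h3 : ((∑ c ∈ Finset.range n, c : ℕ) : ℝ) * 2 = n * (n - 1) := by
      rw [← Nat.cast_pred (NeZero.pos n)]
      exact_mod_cast h2
    push_cast at h3
    linarith
  rw [Finset.expect_congr rfl fun c _ => unifProb_val_lt c.val c.isLt.le,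
    Fintype.expect_eq_sum_div_card, ← Finset.sum_div, h, Fintype.card_fin]
  field_simp

lemma unifProb_fin_le_of_subsingleton {n : ℕ} {p : Fin n → Prop}
    (hp : ∀ a b, p a → p b → a = b) : unifProb p ≤ 1 / n := by
  classical
  unfold unifProb
  rw [Fintype.expect_eq_sum_div_card, Finset.sum_boole, Fintype.card_fin]
  gcongr
  exact_mod_cast Finset.card_le_one.2 fun a ha b hb =>
    hp a b (Finset.mem_filter.1 ha).2 (Finset.mem_filter.1 hb).2

end Fin

section Degrees

lemma dE_sdiff_add {V : Type} [DecidableEq V] {F H : Finset (Sym2 V)} (h : H ⊆ F) (v : V) :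
    dE (F \ H) v + dE H v = dE F v := by
  unfold dE
  rw [← Finset.card_union_of_disjoint]
  · rw [← Finset.filter_union, Finset.sdiff_union_of_subset h]
  · exact Finset.disjoint_filter_filter Finset.sdiff_disjoint

variable {V : Type} [Fintype V] [DecidableEq V] (G : SimpleGraph V) [DecidableRel G.Adj]

lemma dE_eq_card_filter {F : Finset (Sym2 V)} (hF : F ⊆ G.edgeFinset) (v : V) :
    dE F v = ((G.neighborFinset v).filter fun x => s(v, x) ∈ F).card := by
  unfold dE
  have h : (F.filter fun e => v ∈ e) =
      ((G.neighborFinset v).filter fun x => s(v, x) ∈ F).image fun x => s(v, x) := by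
    ext e
    simp only [Finset.mem_filter, Finset.mem_image, SimpleGraph.mem_neighborFinset]
    constructor
    · rintro ⟨he, hv⟩
      obtain ⟨x, rfl⟩ := Sym2.mem_iff_exists.1 hv
      refine ⟨x, ⟨?_, he⟩, rfl⟩
      simpa using hF he
    · rintro ⟨x, ⟨_, hx⟩, rfl⟩
      exact ⟨hx, Sym2.mem_mk_left v x⟩
  rw [h, Finset.card_image_of_injective]
  intro x y hxy
  exact Sym2.congr_right.1 hxy

lemma between_subset_edgeFinset (A B : Finset V) : between G A B ⊆ G.edgeFinset :=
  Finset.filter_subset _ _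

lemma between_comm (A B : Finset V) : between G A B = between G B A := by
  unfold between
  refine Finset.filter_congr fun e _ => ?_
  constructor <;> rintro ⟨a, ha, b, hb, rfl⟩ <;> exact ⟨b, hb, a, ha, Sym2.eq_swap⟩

variable {G}

lemma mk_mem_between_iff {A B : Finset V} (hAB : Disjoint A B) {v : V} (hv : v ∈ A) (x : V) :
    s(v, x) ∈ between G A B ↔ G.Adj v x ∧ x ∈ B := by
  simp only [between, Finset.mem_filter, SimpleGraph.mem_edgeFinset, SimpleGraph.mem_edgeSet]
  refine and_congr_right fun _ => ⟨?_, fun hx => ⟨v, hv, x, hx, rfl⟩⟩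
  rintro ⟨a, ha, b, hb, h⟩
  rcases Sym2.eq_iff.1 h with ⟨rfl, rfl⟩ | ⟨rfl, rfl⟩
  · exact hb
  · exact absurd hb (Finset.disjoint_left.1 hAB hv)

lemma dE_between {A B : Finset V} (hAB : Disjoint A B) {v : V} (hv : v ∈ A) :
    dE (between G A B) v = dIn G B v := by
  rw [dE_eq_card_filter G (between_subset_edgeFinset G A B), dIn]
  congr 1
  ext x
  simp [mk_mem_between_iff hAB hv]

lemma dIn_add_dIn_compl (U : Finset V) (v : V) :
    dIn G U v + dIn G (Finset.univ \ U) v = G.degree v := by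
  unfold dIn
  rw [← Finset.card_union_of_disjoint, ← Finset.inter_union_distrib_left]
  · rw [Finset.union_sdiff_of_subset (Finset.subset_univ U), Finset.inter_univ,
      SimpleGraph.card_neighborFinset_eq_degree]
  · exact Finset.disjoint_sdiff.mono Finset.inter_subset_right Finset.inter_subset_right

/-- For fixed `i_u`, at most one value of `i_{u'}` makes `J(u')` meet `J(u)`. -/
lemma eq_of_Jset_inter_nonempty {U : Finset V} {F' F_W : Finset (Sym2 V)} {u u' : V}
    (hpos : (0 : ℝ) < G.degree u') (hhalf : (0.5 : ℝ) * G.degree u ≤ G.degree u')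
    (hu : (dE F_W u : ℝ) + 2 * dIn G U u ≤ 3.03e-4 * G.degree u)
    (hu' : (dE F_W u' : ℝ) + 2 * dIn G U u' ≤ 3.03e-4 * G.degree u')
    (hF' : (0.9997 : ℝ) * G.degree u' ≤ dE F' u') {i k l : ℕ}
    (hk : (Jset G U F' F_W (fun _ => k) u' ∩ Jset G U F' F_W (fun _ => i) u).Nonempty)
    (hl : (Jset G U F' F_W (fun _ => l) u' ∩ Jset G U F' F_W (fun _ => i) u).Nonempty) :
    k = l := by
  wlog hkl : k < l generalizing k l
  · rcases (not_lt.1 hkl).eq_or_lt with h | h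
    · exact h.symm
    · exact (this hl hk h).symm
  exfalso
  obtain ⟨y, ⟨hy1, hy2⟩, hy3, hy4⟩ := hk
  obtain ⟨z, ⟨hz1, hz2⟩, hz3, hz4⟩ := hl
  have h1 : (k : ℝ) + 1 ≤ l := by exact_mod_cast hkl
  have h2 : ((k : ℝ) + 1) * dE F' u' ≤ l * dE F' u' :=
    mul_le_mul_of_nonneg_right h1 (Nat.cast_nonneg _)
  norm_num at hhalf hu hu' hF' hy1 hy2 hy3 hy4 hz1 hz2 hz3 hz4
  linarith

end Degrees

section Events

variable {V : Type} [Fintype V] [DecidableEq V]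

/-- Concentration of the number of edges `vx` with `x ∈ K` whose value is below a constant. -/
lemma unifProb_edge_lt_const (K : Finset V) (v : V) {k : ℕ} (hk : k ≤ 1000) :
    unifProb (fun ω : V ⊕ Sym2 V → Fin 1000 => (1e-5 : ℝ) * K.card <
      |((K.filter fun x => (ω (.inr s(v, x))).val < k).card : ℝ) - k / 1000 * K.card|) ≤
    2 * Real.exp (-((1e-5) ^ 2 / 4 * K.card)) := by
  have hk' : (k : ℝ) ≤ 1000 := by exact_mod_cast hk
  refine unifProb_lt_abs_card_filter_sub_le K
    (fun x (ω : V ⊕ Sym2 V → Fin 1000) => (ω (.inr s(v, x))).val < k)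
    (fun x => {.inr s(v, x)}) ?_ ?_ (by positivity) (by linarith) ?_ (by norm_num) (by norm_num)
  · intro x _ ω ω' h
    simp only
    rw [h _ rfl]
  · intro x _ y _ hxy
    simpa [Function.onFun] using fun h => hxy (Sym2.congr_right.1 h)
  · intro x _
    rw [unifProb_apply _ fun b : Fin 1000 => b.val < k, unifProb_val_lt k hk]
    norm_num

/-- Concentration of the number of edges `vx` with `x ∈ K` whose value is below that of `x`. -/
lemma unifProb_edge_lt_vertex (K : Finset V) (v : V) :
    unifProb (fun ω : V ⊕ Sym2 V → Fin 1000 => (1e-5 : ℝ) * K.card <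
      |((K.filter fun x => (ω (.inr s(v, x))).val < (ω (.inl x)).val).card : ℝ) -
        (1 - 1e-3) / 2 * K.card|) ≤
    2 * Real.exp (-((1e-5) ^ 2 / 4 * K.card)) := by
  refine unifProb_lt_abs_card_filter_sub_le K
    (fun x (ω : V ⊕ Sym2 V → Fin 1000) => (ω (.inr s(v, x))).val < (ω (.inl x)).val)
    (fun x => {.inr s(v, x), .inl x}) ?_ ?_ (by norm_num) (by norm_num) ?_ (by norm_num)
    (by norm_num)
  · intro x _ ω ω' h
    simp only
    rw [h (.inr s(v, x)) (by simp), h (.inl x) (by simp)]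
  · intro x _ y _ hxy
    have h : s(v, x) ≠ s(v, y) := fun h => hxy (Sym2.congr_right.1 h)
    rw [Function.onFun, Set.disjoint_iff_forall_ne]
    rintro a (rfl | rfl) b (rfl | rfl) <;> simp [h, hxy, -Sym2.eq]
  · intro x _
    rw [unifProb_apply_val_lt_apply_val (by simp)]
    norm_num

/-- Upper tail of the number of vertices `x ∈ K` whose value satisfies `p x`, when each `p x` holds
for at most one value. -/
lemma unifProb_lt_card_vertex (K : Finset V) (p : V → ℕ → Prop) [∀ x, DecidablePred (p x)]
    (hp : ∀ x ∈ K, ∀ k l, p x k → p x l → k = l) :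
    unifProb (fun ω : V ⊕ Sym2 V → Fin 1000 => (2e-3 : ℝ) * K.card <
      ((K.filter fun x => p x (ω (.inl x)).val).card : ℝ)) ≤
    Real.exp (-((1e-3) ^ 2 / 4 * K.card)) := by
  have := unifProb_lt_card_filter_le K
    (fun x (ω : V ⊕ Sym2 V → Fin 1000) => p x (ω (.inl x)).val)
    (fun x => {.inl x}) (q := 1e-3) ?_ ?_ (by norm_num) (by norm_num) ?_ (t := 1e-3)
    (by norm_num) (by norm_num)
  · norm_num at this ⊢
    exact this
  · intro x _ ω ω' h
    simp only
    rw [h _ rfl]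
  · intro x _ y _ hxy
    simpa using hxy
  · intro x hx
    rw [unifProb_apply _ fun b : Fin 1000 => p x b.val]
    refine (unifProb_fin_le_of_subsingleton fun a b ha hb =>
      Fin.ext (hp x hx _ _ ha hb)).trans ?_
    norm_num

end Events

/-- Given `U` and `F_W` as in Statements 1 and 2, with `F' = F ∖ F_W`, one can choose
integers `i_u ∈ {0,…,999}` for `u ∈ U` and `F_U ⊆ F'` satisfying conditions
(i), (ii) and (iii) (the latter bounding the size of `N^U_≤(u)`). -/
theorem statement3 :
    ∃ Δ₀ : ℕ, ∀ (V : Type) [Fintype V] [DecidableEq V]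
      (G : SimpleGraph V) [DecidableRel G.Adj],
      Δ₀ ≤ G.maxDegree →
      (1e20 : ℝ) * Real.log G.maxDegree ≤ (G.minDegree : ℝ) →
      ∀ U : Finset V,
        (∀ v : V, |(dIn G U v : ℝ) - 1e-4 * G.degree v| ≤ 1e-6 * G.degree v) →
        ∀ W : Finset V, W = Finset.univ \ U →
        ∀ F_W ⊆ between G U W,
          (∀ w ∈ W, |(dE F_W w : ℝ) - 1e-4 * dIn G U w| ≤ 1e-6 * dIn G U w) →
          (∀ u ∈ U, |(dE F_W u : ℝ) - 1e-4 * dIn G W u| ≤ 1e-6 * dIn G W u) →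
          ∀ F' : Finset (Sym2 V), F' = between G U W \ F_W →
          ∃ (i : V → ℕ), (∀ u ∈ U, i u ≤ 10 ^ 3 - 1) ∧
            ∃ F_U ⊆ F',
              (∀ u ∈ U,
                |(dE F_U u : ℝ) - 1e-3 * i u * dE F' u| ≤ 1e-5 * G.degree u) ∧
              (∀ w ∈ W,
                |(dE F_U w : ℝ) - (1 - 1e-3) / 2 * dE F' w| ≤ 1e-5 * dE F' w) ∧
              (∀ u ∈ U,
                (({u' : V | u' ∈ G.neighborFinset u ∧ u' ∈ U ∧
                    0.5 * G.degree u ≤ (G.degree u' : ℝ) ∧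
                    (G.degree u' : ℝ) ≤ G.degree u ∧
                    (Jset G U F' F_W i u' ∩ Jset G U F' F_W i u).Nonempty}).ncard : ℝ)
                  ≤ 2e-3 * dIn G U u) := by
  refine ⟨10, ?_⟩
  intro V _ _ G _ hΔ hδ U hU W hW F_W hFW hFWw hFWu F' hF'
  classical
  have hΔ' : (10 : ℝ) ≤ G.maxDegree := by exact_mod_cast hΔ
  set L := Real.log G.maxDegree with hL
  have hLpos : 0 < L := Real.log_pos (by linarith)
  have hdeg : ∀ v, 1e20 * L ≤ (G.degree v : ℝ) := fun v =>
    hδ.trans (by exact_mod_cast G.minDegree_le_degree v)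
  have hdpos : ∀ v, (0 : ℝ) < G.degree v := fun v => lt_of_lt_of_le (by positivity) (hdeg v)
  have hUW : Disjoint U W := hW ▸ Finset.disjoint_sdiff
  have hmemW : ∀ v, v ∈ W ↔ v ∉ U := fun v => by simp [hW]
  have hF'G : F' ⊆ G.edgeFinset :=
    hF' ▸ Finset.sdiff_subset.trans (between_subset_edgeFinset G U W)
  have hUWedge : ∀ u ∈ U, ∀ x, s(u, x) ∈ F' → x ∈ W := fun u hu x hx =>
    ((mk_mem_between_iff hUW hu x).1 (Finset.mem_sdiff.1 (hF' ▸ hx)).1).2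
  have hWUedge : ∀ w ∈ W, ∀ x, s(w, x) ∈ F' → x ∈ U := fun w hw x hx =>
    ((mk_mem_between_iff hUW.symm hw x).1
      (between_comm G U W ▸ (Finset.mem_sdiff.1 (hF' ▸ hx)).1)).2
  have hF'U : ∀ u ∈ U, (dE F' u : ℝ) + dE F_W u = dIn G W u := fun u hu => by
    rw [← dE_between hUW hu, hF', ← dE_sdiff_add hFW]
    push_cast
    rfl
  have hF'W : ∀ w ∈ W, (dE F' w : ℝ) + dE F_W w = dIn G U w := fun w hw => by
    rw [← dE_between hUW.symm hw, between_comm, hF', ← dE_sdiff_add hFW]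
    push_cast
    rfl
  have hsum : ∀ v, (dIn G U v : ℝ) + dIn G W v = G.degree v := fun v => by
    rw [hW]
    exact_mod_cast dIn_add_dIn_compl U v
  have hUle : ∀ v, (dIn G U v : ℝ) ≤ 1.01e-4 * G.degree v := fun v => by
    have := (abs_le.1 (hU v)).2
    norm_num at this ⊢
    linarith
  have hUge : ∀ v, 0.99e-4 * G.degree v ≤ (dIn G U v : ℝ) := fun v => by
    have := (abs_le.1 (hU v)).1
    norm_num at this ⊢
    linarith
  have hsmall : ∀ u ∈ U, (dE F_W u : ℝ) + 2 * dIn G U u ≤ 3.03e-4 * G.degree u := by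
    intro u hu
    have h1 := (abs_le.1 (hFWu u hu)).2
    have h2 := hUle u
    have h3 := hsum u
    have h4 : (0 : ℝ) ≤ dIn G U u := Nat.cast_nonneg _
    norm_num at h1 h2 ⊢
    linarith
  have hlarge : ∀ u ∈ U, 0.9997 * (G.degree u : ℝ) ≤ dE F' u := by
    intro u hu
    have h1 := (abs_le.1 (hFWu u hu)).2
    have h2 := hUle u
    have h3 := hsum u
    have h4 := hF'U u hu
    have h5 := hdpos u
    norm_num at h1 h2 h5 ⊢
    linarith
  have hle : ∀ u ∈ U, (dE F' u : ℝ) ≤ G.degree u := by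
    intro u hu
    have h3 := hsum u
    have h4 := hF'U u hu
    have h5 : (0 : ℝ) ≤ dE F_W u := Nat.cast_nonneg _
    have h6 : (0 : ℝ) ≤ dIn G U u := Nat.cast_nonneg _
    linarith
  have hF'big : ∀ v, 9e15 * L ≤ (dE F' v : ℝ) := by
    intro v
    have h0 := hdeg v
    by_cases hv : v ∈ U
    · have := hlarge v hv
      norm_num at this h0 ⊢
      linarith
    · have h1 := (abs_le.1 (hFWw v ((hmemW v).2 hv))).2
      have h2 := hUge v
      have h4 := hF'W v ((hmemW v).2 hv)
      norm_num at h0 h1 h2 ⊢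
      linarith
  have hUbig : ∀ v, 9e15 * L ≤ (dIn G U v : ℝ) := by
    intro v
    have h0 := hdeg v
    have h2 := hUge v
    norm_num at h0 h2 ⊢
    linarith
  let K : V → Finset V := fun v => (G.neighborFinset v).filter fun x => s(v, x) ∈ F'
  have hK : ∀ v, dE F' v = (K v).card := fun v => dE_eq_card_filter G hF'G v
  let conflict : V → ℕ → V → ℕ → Prop := fun u i x k =>
    0.5 * G.degree u ≤ (G.degree x : ℝ) ∧ (G.degree x : ℝ) ≤ G.degree u ∧
      (Jset G U F' F_W (fun _ => k) x ∩ Jset G U F' F_W (fun _ => i) u).Nonempty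
  let bad₁ : V → Fin 1000 → (V ⊕ Sym2 V → Fin 1000) → Prop := fun u i ω =>
    (1e-5 : ℝ) * (K u).card <
      |(((K u).filter fun x => (ω (.inr s(u, x))).val < i.val).card : ℝ) -
        i.val / 1000 * (K u).card|
  let bad₂ : V → (V ⊕ Sym2 V → Fin 1000) → Prop := fun w ω =>
    (1e-5 : ℝ) * (K w).card <
      |(((K w).filter fun x => (ω (.inr s(w, x))).val < (ω (.inl x)).val).card : ℝ) -
        (1 - 1e-3) / 2 * (K w).card|
  let bad₃ : V → Fin 1000 → (V ⊕ Sym2 V → Fin 1000) → Prop := fun u i ω =>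
    (2e-3 : ℝ) * (G.neighborFinset u ∩ U).card <
      (((G.neighborFinset u ∩ U).filter fun x => conflict u i.val x (ω (.inl x)).val).card : ℝ)
  let bad : V → (V ⊕ Sym2 V → Fin 1000) → Prop := fun v ω =>
    (∃ i, bad₁ v i ω) ∨ bad₂ v ω ∨ ∃ i, v ∈ U ∧ bad₃ v i ω
  let T : V → Set (V ⊕ Sym2 V) := fun v => {a | ∃ x, G.Adj v x ∧ (a = .inl x ∨ a = .inr s(v, x))}
  have hdep : ∀ v, DependsOn (bad v) (T v) := by
    intro v ω ω' h
    have hl : ∀ x, G.Adj v x → ω (.inl x) = ω' (.inl x) := fun x hx => h _ ⟨x, hx, Or.inl rfl⟩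
    have hr : ∀ x, G.Adj v x → ω (.inr s(v, x)) = ω' (.inr s(v, x)) := fun x hx =>
      h _ ⟨x, hx, Or.inr rfl⟩
    have hKadj : ∀ x ∈ K v, G.Adj v x := fun x hx => by
      simpa using (Finset.mem_filter.1 hx).1
    have e₁ : ∀ i : Fin 1000, ((K v).filter fun x => (ω (.inr s(v, x))).val < i.val) =
        (K v).filter fun x => (ω' (.inr s(v, x))).val < i.val := fun i =>
      Finset.filter_congr fun x hx => by rw [hr x (hKadj x hx)]
    have e₂ : ((K v).filter fun x => (ω (.inr s(v, x))).val < (ω (.inl x)).val) =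
        (K v).filter fun x => (ω' (.inr s(v, x))).val < (ω' (.inl x)).val :=
      Finset.filter_congr fun x hx => by rw [hr x (hKadj x hx), hl x (hKadj x hx)]
    have e₃ : ∀ i : Fin 1000, ((G.neighborFinset v ∩ U).filter fun x =>
        conflict v i.val x (ω (.inl x)).val) =
        (G.neighborFinset v ∩ U).filter fun x => conflict v i.val x (ω' (.inl x)).val :=
      fun i => Finset.filter_congr fun x hx => by
        rw [hl x (by simpa using (Finset.mem_inter.1 hx).1)]
    simp only [bad, bad₁, bad₂, bad₃, e₁, e₂, e₃]
  let N : V → Finset V := fun v =>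
    (insert v (G.neighborFinset v)).biUnion fun x => insert x (G.neighborFinset x)
  have hcard : ∀ x, (insert x (G.neighborFinset x)).card ≤ G.maxDegree + 1 := fun x =>
    (Finset.card_insert_le _ _).trans (by simpa using G.degree_le_maxDegree x)
  have hN : ∀ v, ((N v).card : ℝ) ≤ ((G.maxDegree : ℝ) + 1) ^ 2 := by
    intro v
    have h1 : (N v).card ≤ (G.maxDegree + 1) * (G.maxDegree + 1) :=
      (Finset.card_biUnion_le_card_mul _ _ _ fun x _ => hcard x).trans
        (Nat.mul_le_mul_right _ (hcard v))
    rw [sq]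
    exact_mod_cast h1
  have hdisj : ∀ v, ∀ k ∉ N v, Disjoint (T v) (T k) := by
    intro v k hk
    rw [Set.disjoint_left]
    rintro a ⟨x, hx, ha⟩ ⟨y, hy, ha'⟩
    refine hk (Finset.mem_biUnion.2 ?_)
    rcases ha with rfl | rfl
    · rcases ha' with h | h
      · obtain rfl := Sum.inl_injective h
        exact ⟨x, by simp [hx], by simp [hy.symm]⟩
      · cases h
    · rcases ha' with h | h
      · cases h
      · rcases Sym2.eq_iff.1 (Sum.inr_injective h) with ⟨rfl, -⟩ | ⟨-, rfl⟩
        · exact ⟨v, by simp, by simp⟩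
        · exact ⟨x, by simp [hx], by simp⟩
  have hexp : ∀ c n : ℝ, 1e-10 ≤ c → 9e15 * L ≤ n →
      Real.exp (-(c / 4 * n)) ≤ ((G.maxDegree : ℝ) ^ 10)⁻¹ := by
    intro c n hc hn
    rw [← Real.exp_log (show (0 : ℝ) < G.maxDegree by linarith), ← Real.exp_nat_mul,
      ← Real.exp_neg, Real.exp_le_exp, ← hL]
    have h0 : 0 ≤ n := le_trans (by positivity) hn
    have h1 : 1e-10 * n ≤ c * n := mul_le_mul_of_nonneg_right hc h0
    norm_num at h1 hn ⊢
    linarith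
  have hprob : ∀ v, unifProb (bad v) * (4 * ((G.maxDegree : ℝ) + 1) ^ 2) ≤ 1 := by
    intro v
    set ε := ((G.maxDegree : ℝ) ^ 10)⁻¹ with hε
    have hKv : 9e15 * L ≤ ((K v).card : ℝ) := hK v ▸ hF'big v
    have p₁ := unifProb_exists_le (bad₁ v) fun i =>
      (unifProb_edge_lt_const (K v) v i.isLt.le).trans
        (mul_le_mul_of_nonneg_left (hexp _ _ (by norm_num) hKv) two_pos.le)
    have p₂ := (unifProb_edge_lt_vertex (K v) v).trans
      (mul_le_mul_of_nonneg_left (hexp _ _ (by norm_num) hKv) two_pos.le)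
    have p₃ : unifProb (fun ω => ∃ i, v ∈ U ∧ bad₃ v i ω) ≤ Fintype.card (Fin 1000) * ε := by
      refine unifProb_exists_le _ fun i => ?_
      by_cases hv : v ∈ U
      · simp only [hv, true_and]
        refine (unifProb_lt_card_vertex (G.neighborFinset v ∩ U) (conflict v i.val) ?_).trans
          (hexp _ _ (by norm_num) (hUbig v))
        intro x hx k l hk hl
        have hxU := (Finset.mem_inter.1 hx).2
        exact eq_of_Jset_inter_nonempty (hdpos x) hk.1 (hsmall v hv) (hsmall x hxU)
          (hlarge x hxU) hk.2.2 hl.2.2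
      · simp only [hv, false_and]
        simp only [unifProb, if_false, Finset.expect_const_zero]
        positivity
    rw [Fintype.card_fin] at p₁ p₃
    have h1 : unifProb (bad v) ≤ 3002 * ε := by
      have h2 := unifProb_or_le (fun ω => ∃ i, bad₁ v i ω)
        (fun ω => bad₂ v ω ∨ ∃ i, v ∈ U ∧ bad₃ v i ω)
      have h3 := unifProb_or_le (bad₂ v) (fun ω => ∃ i, v ∈ U ∧ bad₃ v i ω)
      have p₂' : unifProb (bad₂ v) ≤ 2 * ε := p₂
      push_cast at p₁ p₃
      have h4 : unifProb (bad v) ≤ unifProb (fun ω => ∃ i, bad₁ v i ω) +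
        unifProb (fun ω => bad₂ v ω ∨ ∃ i, v ∈ U ∧ bad₃ v i ω) := h2
      linarith
    have hD : ((G.maxDegree : ℝ) + 1) ^ 2 ≤ 4 * (G.maxDegree : ℝ) ^ 2 := by nlinarith
    have h8 : (10 : ℝ) ^ 8 ≤ (G.maxDegree : ℝ) ^ 8 := by gcongr
    calc unifProb (bad v) * (4 * ((G.maxDegree : ℝ) + 1) ^ 2)
        ≤ 3002 * ε * (4 * (4 * (G.maxDegree : ℝ) ^ 2)) := by gcongr
      _ = 48032 / (G.maxDegree : ℝ) ^ 8 := by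
        rw [hε]
        field_simp
        norm_num
      _ ≤ 1 := by
        rw [div_le_one (by positivity)]
        linarith
  obtain ⟨ω, hω⟩ := exists_forall_not_of_local bad T hdep
    (by nlinarith : (1 : ℝ) ≤ ((G.maxDegree : ℝ) + 1) ^ 2) N hN hdisj hprob
  simp only [bad, not_or, not_exists, not_and] at hω
  refine ⟨fun v => (ω (.inl v)).val, fun u _ => Nat.le_pred_of_lt (ω (.inl u)).isLt,
    F'.filter fun e => ∃ u ∈ U, u ∈ e ∧ (ω (.inr e)).val < (ω (.inl u)).val,
    Finset.filter_subset _ _, ?_, ?_, ?_⟩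
  · intro u hu
    have h1 := not_lt.1 ((hω u).1 (ω (.inl u)))
    have h2 : ((G.neighborFinset u).filter fun x => s(u, x) ∈ F'.filter fun e =>
        ∃ u ∈ U, u ∈ e ∧ (ω (.inr e)).val < (ω (.inl u)).val) =
        (K u).filter fun x => (ω (.inr s(u, x))).val < (ω (.inl u)).val := by
      rw [Finset.filter_filter]
      refine Finset.filter_congr fun x _ => ?_
      rw [Finset.mem_filter]
      refine and_congr_right fun hx => ⟨?_, fun h => ⟨u, hu, by simp, h⟩⟩
      rintro ⟨z, hz, hze, h⟩
      rcases Sym2.mem_iff.1 hze with rfl | rfl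
      · exact h
      · exact absurd hz ((hmemW _).1 (hUWedge u hu _ hx))
    rw [dE_eq_card_filter G ((Finset.filter_subset _ _).trans hF'G), h2]
    have h3 := hle u hu
    rw [hK u] at h3 ⊢
    refine le_trans (le_of_eq ?_) (h1.trans (by gcongr))
    norm_num [div_eq_mul_inv, mul_comm]
  · intro w hw
    have h1 := not_lt.1 (hω w).2.1
    have h2 : ((G.neighborFinset w).filter fun x => s(w, x) ∈ F'.filter fun e =>
        ∃ u ∈ U, u ∈ e ∧ (ω (.inr e)).val < (ω (.inl u)).val) =
        (K w).filter fun x => (ω (.inr s(w, x))).val < (ω (.inl x)).val := by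
      rw [Finset.filter_filter]
      refine Finset.filter_congr fun x _ => ?_
      rw [Finset.mem_filter]
      refine and_congr_right fun hx => ⟨?_, fun h => ⟨x, hWUedge w hw x hx, by simp, h⟩⟩
      rintro ⟨z, hz, hze, h⟩
      rcases Sym2.mem_iff.1 hze with rfl | rfl
      · exact absurd hz ((hmemW _).1 hw)
      · exact h
    rw [dE_eq_card_filter G ((Finset.filter_subset _ _).trans hF'G), h2, hK w]
    exact h1
  · intro u hu
    have h1 := not_lt.1 ((hω u).2.2 (ω (.inl u)) hu)
    refine le_trans (le_of_eq ?_) h1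
    rw [← Set.ncard_coe_finset]
    congr 2
    ext x
    simp only [Finset.coe_filter, Finset.mem_inter, Set.mem_ofPred_eq, and_assoc]
    rfl
end

section
/- There exists Δ₀ such that the following holds. Let G = (V,E) be a finite simple graph with maximum degree Δ ≥ Δ₀ and minimum degree δ ≥ 10^{20}·ln Δ, let W ⊆ V, and let reals c_v ≥ 0 be given for v ∈ W. Suppose that for every v ∈ W one has d_W(v) ≥ (1 − 1.01·10^{-4})·d(v), and that for all adjacent u, v ∈ W with d_W(u) ≤ d_W(v) one has c_v − c_u ≥ −5·10^{-6}·d_W(v). Then there exist reals x_v ∈ [1.1, 2.9] for v ∈ W and a weighting ω : E(G[W]) → {1,3} such that, setting for each v ∈ W: σ(v) = Σ_{e ∈ E(G[W]), v ∈ e} ω(e); l(v) = 2^{⌊log₂(10^{-9}·d_W(v))⌋}; s₀(v) = c_v + x_v·d_W(v) + 3·l(v); and I(v) the unique interval of the form [k·l(v), (k+1)·l(v)) with k ∈ ℤ containing s₀(v), the following hold for every v ∈ W: (i) |σ(v) − x_v·d_W(v)| ≤ 10^{-9}·d_W(v); and (ii) |{u ∈ N(v) ∩ W : d_W(u) ≤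 d_W(v) and s₀(u) ∈ I(v)}| ≤ 0.95·l(v). -/
/-- The edge set of the subgraph of `G` induced by `W`. -/
def indEdges {V : Type} [Fintype V] [DecidableEq V] (G : SimpleGraph V) [DecidableRel G.Adj]
    (W : Finset V) : Finset (Sym2 V) :=
  G.edgeFinset.filter (fun e => ∃ a ∈ W, ∃ b ∈ W, e = s(a, b))

/-- The quantity `l(v) = 2^⌊log₂(10⁻⁹ d_W(v))⌋`. -/
noncomputable def ell {V : Type} [Fintype V] [DecidableEq V] (G : SimpleGraph V)
    [DecidableRel G.Adj] (W : Finset V) (v : V) : ℝ :=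
  (2 : ℝ) ^ (⌊Real.logb 2 (1e-9 * (dIn G W v : ℝ))⌋)

/-- The near location `s₀(v) = c_v + x_v d_W(v) + 3 l(v)` of the final sum of `v`. -/
noncomputable def sZero {V : Type} [Fintype V] [DecidableEq V] (G : SimpleGraph V)
    [DecidableRel G.Adj] (W : Finset V) (c x : V → ℝ) (v : V) : ℝ :=
  c v + x v * (dIn G W v : ℝ) + 3 * ell G W v

/-- The unique interval `I(v) = [k·l(v), (k+1)·l(v))`, `k ∈ ℤ`, containing `s₀(v)`. -/
noncomputable def Iv {V : Type} [Fintype V] [DecidableEq V] (G : SimpleGraph V)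
    [DecidableRel G.Adj] (W : Finset V) (c x : V → ℝ) (v : V) : Set ℝ :=
  Set.Ico ((⌊sZero G W c x v / ell G W v⌋ : ℝ) * ell G W v)
    ((⌊sZero G W c x v / ell G W v⌋ + 1 : ℝ) * ell G W v)

/-- Symmetric block corrections, in thousandths, with zero row sums. -/
def blockTable : List (List ℤ) :=
  [[328, 301, 273, 243, 212, 179, 145, 109, 71, 31, -10, -54, -100, -148, -199, -252, -307, -365, -383, -74],
   [301, 274, 247, 216, 185, 152, 118, 82, 44, 4, -38, -81, -127, -175, -226, -279, -334, -370, -151, 158],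
   [273, 247, 218, 188, 157, 124, 89, 53, 15, -24, -66, -110, -155, -204, -254, -307, -363, -209, 9, 319],
   [243, 216, 188, 157, 127, 93, 60, 24, -14, -54, -96, -139, -185, -233, -284, -337, -236, -32, 186, 316],
   [212, 185, 157, 127, 96, 63, 28, -8, -46, -85, -127, -171, -216, -265, -315, -271, -91, 113, 331, 283],
   [179, 152, 124, 93, 63, 29, -4, -40, -78, -118, -160, -203, -249, -297, -286, -111, 69, 273, 316, 248],
   [145, 118, 89, 60, 28, -4, -39, -75, -113, -152, -194, -238, -284, -304, -135, 41, 221, 344, 280, 212],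
   [109, 82, 53, 24, -8, -40, -75, -111, -149, -188, -230, -274, -320, -158, 11, 186, 366, 306, 242, 174],
   [71, 44, 15, -14, -46, -78, -113, -149, -187, -226, -266, -312, -170, -4, 165, 340, 327, 266, 202, 135],
   [31, 4, -24, -54, -85, -118, -152, -188, -226, -266, -308, -183, -14, 153, 322, 344, 286, 225, 160, 93],
   [-10, -38, -66, -96, -127, -160, -194, -230, -266, -308, -187, -23, 147, 313, 356, 300, 242, 181, 117, 49],
   [-54, -81, -110, -139, -171, -203, -238, -274, -312, -183, -23, 142, 312, 363, 310, 255, 196, 135, 71, 4],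
   [-100, -127, -155, -185, -216, -249, -284, -320, -170, -14, 147, 312, 365, 315, 262, 206, 148, 87, 23, -45],
   [-148, -175, -204, -233, -265, -297, -304, -158, -4, 153, 313, 363, 315, 265, 212, 156, 98, 36, -28, -95],
   [-199, -226, -254, -284, -315, -286, -135, 11, 165, 322, 356, 310, 262, 212, 158, 104, 45, -17, -81, -148],
   [-252, -279, -307, -337, -271, -111, 41, 186, 340, 344, 300, 255, 206, 156, 104, 47, -11, -72, -136, -203],
   [-307, -334, -363, -236, -91, 69, 221, 366, 327, 286, 242, 196, 148, 98, 45, -11, -69, -130, -195, -262],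
   [-365, -370, -209, -32, 113, 273, 344, 306, 266, 225, 181, 135, 87, 36, -17, -72, -130, -192, -256, -323],
   [-383, -151, 9, 186, 331, 316, 280, 242, 202, 160, 117, 71, 23, -28, -81, -136, -195, -256, -320, -387],
   [-74, 158, 319, 316, 283, 248, 212, 174, 135, 93, 49, 4, -45, -95, -148, -203, -262, -323, -387, -454]]

/-- The entry of `blockTable` in row `i` and column `j`. -/
def blockCorr (i j : Fin 20) : ℤ := (blockTable.getD i []).getD j 0

/-- Lower approximations, in ten-thousandths, of `0.55 * exp (0.048 * i) - 0.5`. -/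
def expTable : List ℤ :=
  [500, 770, 1054, 1351, 1664, 1991, 2335, 2696, 3074, 3471, 3888, 4325, 4783, 5265, 5769, 6299,
   6854, 7437, 8049, 8691, 9364]

theorem blockCorr_symm : ∀ i j, blockCorr i j = blockCorr j i := by decide +kernel

theorem sum_blockCorr : ∀ i, ∑ j, blockCorr i j = 0 := by decide +kernel

theorem blockCorr_lower : ∀ i j : Fin 20,
    0 ≤ expTable.getD i 0 + expTable.getD j 0 - 4234 + 10 * blockCorr i j := by decide +kernel

theorem blockCorr_upper : ∀ i j : Fin 20,
    (expTable.getD (i + 1) 0 + 1) + (expTable.getD (j + 1) 0 + 1) - 4233 + 10 * blockCorr i j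
      ≤ 10000 := by decide +kernel

theorem exp_block_bounds :
    (1.04917065 : ℝ) ≤ Real.exp 0.048 ∧ Real.exp 0.048 ≤ 1.04917067 := by
  have h := Real.exp_bound' (x := 0.048) (by norm_num) (by norm_num) (n := 6) (by norm_num)
  have h' := Real.sum_le_exp_of_nonneg (x := 0.048) (by norm_num) 6
  norm_num [Finset.sum_range_succ, Nat.factorial] at h h'
  constructor <;> norm_num <;> linarith

theorem expTable_bounds (i : ℕ) (hi : i ≤ 20) :
    (expTable.getD i 0 : ℝ) / 10000 ≤ 0.55 * Real.exp (0.048 * i) - 0.5 ∧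
    0.55 * Real.exp (0.048 * i) - 0.5 ≤ ((expTable.getD i 0 : ℝ) + 1) / 10000 := by
  have e : Real.exp (0.048 * i) = Real.exp 0.048 ^ i := by rw [← Real.exp_nat_mul]; ring_nf
  obtain ⟨h1, h2⟩ := exp_block_bounds
  have l : (1.04917065 : ℝ) ^ i ≤ Real.exp 0.048 ^ i := by gcongr
  have u : Real.exp 0.048 ^ i ≤ (1.04917067 : ℝ) ^ i := by gcongr
  rw [e]
  generalize Real.exp 0.048 ^ i = y at l u
  interval_cases i <;> norm_num [expTable] at l u ⊢ <;> constructor <;> linarith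

theorem card_zmod_val_lt {M k : ℕ} [NeZero M] (hk : k ≤ M) :
    (Finset.univ.filter (fun b : ZMod M => b.val < k)).card = k := by
  rw [← Finset.card_range k]
  refine Finset.card_nbij' (fun b => b.val) (fun n => (n : ZMod M)) ?_ ?_ ?_ ?_
  · intro b hb; simpa using hb
  · intro n hn
    have hn : n < k := by simpa using hn
    simpa [ZMod.val_natCast_of_lt (hn.trans_le hk)] using hn
  · intro b _; simp
  · intro n hn
    have hn : n < k := by simpa using hn
    simp [ZMod.val_natCast_of_lt (hn.trans_le hk)]

theorem card_zmod_shift_lt {M : ℕ} [NeZero M] (a : ZMod M) {y : ℝ} (hy : y ≤ M) :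
    (Finset.univ.filter (fun b : ZMod M => ((a + b).val : ℝ) < y)).card = ⌈y⌉₊ := by
  rw [← card_zmod_val_lt (M := M) (k := ⌈y⌉₊) (Nat.ceil_le.2 hy)]
  refine Finset.card_nbij' (fun b => a + b) (fun b => b - a) ?_ ?_ ?_ ?_
  · intro b hb; simpa [Nat.lt_ceil] using hb
  · intro b hb; simpa [Nat.lt_ceil] using hb
  · intro b _; simp
  · intro b _; simp

theorem sum_exp_grid {m : ℕ} (hm : 0 < m) :
    (∑ i : Fin 20, ∑ r : Fin m, Real.exp (0.048 * ((i : ℕ) + (r : ℕ) / m))) *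
      (Real.exp (0.048 / m) - 1) = Real.exp 0.048 ^ 20 - 1 := by
  have hm' : (0 : ℝ) < m := by exact_mod_cast hm
  have h1 : ∀ (i : Fin 20) (r : Fin m), Real.exp (0.048 * ((i : ℕ) + (r : ℕ) / m)) =
      Real.exp 0.048 ^ (i : ℕ) * Real.exp (0.048 / m) ^ (r : ℕ) := by
    intro i r
    rw [← Real.exp_nat_mul, ← Real.exp_nat_mul, ← Real.exp_add]
    ring_nf
  simp_rw [h1, ← Finset.mul_sum, ← Finset.sum_mul]
  rw [Fin.sum_univ_eq_sum_range (fun i => Real.exp 0.048 ^ i) 20,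
    Fin.sum_univ_eq_sum_range (fun i => Real.exp (0.048 / m) ^ i) m, mul_assoc,
    geom_sum_mul, ← Real.exp_nat_mul, mul_div_cancel₀ _ hm'.ne', geom_sum_mul]

theorem avg_grid_bounds {m : ℕ} (hm : 10 ^ 6 ≤ m) :
    (0.4233 : ℝ) ≤ 0.55 * ((∑ i : Fin 20, ∑ r : Fin m,
      Real.exp (0.048 * ((i : ℕ) + (r : ℕ) / m))) / (20 * m)) - 0.5 ∧
    0.55 * ((∑ i : Fin 20, ∑ r : Fin m,
      Real.exp (0.048 * ((i : ℕ) + (r : ℕ) / m))) / (20 * m)) - 0.5 ≤ 0.4234 := by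
  have hm0 : 0 < m := by omega
  have hmr : (10 : ℝ) ^ 6 ≤ m := by exact_mod_cast hm
  have hm' : (0 : ℝ) < m := by exact_mod_cast hm0
  have key := sum_exp_grid hm0
  set S := ∑ i : Fin 20, ∑ r : Fin m, Real.exp (0.048 * ((i : ℕ) + (r : ℕ) / m)) with hS
  have hS0 : 0 ≤ S := Finset.sum_nonneg fun i _ => Finset.sum_nonneg fun r _ => (Real.exp_pos _).le
  obtain ⟨e1, e2⟩ := exp_block_bounds
  have l : (1.04917065 : ℝ) ^ 20 ≤ Real.exp 0.048 ^ 20 := by gcongr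
  have u : Real.exp 0.048 ^ 20 ≤ (1.04917067 : ℝ) ^ 20 := by gcongr
  rw [show Real.exp 0.048 ^ 20 = S * (Real.exp (0.048 / m) - 1) + 1 by linarith] at l u
  have a1 : 0.048 / (m : ℝ) + 1 ≤ Real.exp (0.048 / m) := Real.add_one_le_exp _
  have a2 : Real.exp (0.048 / m) ≤ 1 + 0.048 / m * 1.000001 := by
    have hs : 0.048 / (m : ℝ) ≤ 4.8e-8 := by
      rw [div_le_iff₀ hm']; linarith
    have hp : 0 < 0.048 / (m : ℝ) := by positivity
    have := Real.add_one_le_exp (-(0.048 / (m : ℝ)))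
    have e0 : Real.exp (0.048 / (m : ℝ)) * Real.exp (-(0.048 / (m : ℝ))) = 1 := by
      rw [← Real.exp_add]; simp
    have hE := Real.exp_pos (0.048 / (m : ℝ))
    nlinarith
  have hd : (20 : ℝ) * m * (S / (20 * m)) = S := by field_simp
  set q := S / (20 * (m : ℝ)) with hq
  have hq0 : 0 ≤ q := by positivity
  have b1 : S * (0.048 / m) = 0.96 * q := by rw [← hd]; field_simp; ring
  have c1 : S * (0.048 / m) ≤ S * (Real.exp (0.048 / m) - 1) := by
    apply mul_le_mul_of_nonneg_left _ hS0; linarith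
  have c2 : S * (Real.exp (0.048 / m) - 1) ≤ S * (0.048 / m * 1.000001) := by
    apply mul_le_mul_of_nonneg_left _ hS0; linarith
  have l' : (2.611696 : ℝ) ≤ 1.04917065 ^ 20 := by norm_num
  have u' : (1.04917067 : ℝ) ^ 20 ≤ 2.611698 := by norm_num
  constructor <;> linarith

/-- A finite type of vertex states `z`, each with a target value `x z` and a symmetric `0`-`1`
kernel `h`, such that the average over `z'` of `1 + 2 * h z z'` is close to `x z` while the values
`x z` are spread as evenly as a density proportional to `1 / x` allows. -/
theorem exists_state_kernel :
    ∃ (Z : Type) (_ : Fintype Z) (_ : DecidableEq Z) (x : Z → ℝ) (h : Z → Z → ℕ),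
      Nonempty Z ∧ (∀ z, x z ∈ Set.Icc (1.1 : ℝ) 2.9) ∧ (∀ z z', h z z' = h z' z) ∧
      (∀ z z', h z z' = 0 ∨ h z z' = 1) ∧
      (∀ z, |∑ z', (1 + 2 * (h z z' : ℝ) - x z)| ≤ 1e-11 * Fintype.card Z) ∧
      ∀ (S : Finset Z) (A w : ℝ), 0 < A → 0 ≤ w → (∀ z ∈ S, A ≤ x z) →
        (∀ z ∈ S, ∀ z' ∈ S, x z - x z' ≤ w) →
        (S.card : ℝ) ≤ (w / (0.96 * A) + 1e-13) * Fintype.card Z := by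
  obtain ⟨m, hm⟩ : ∃ m : ℕ, 10 ^ 12 ≤ m := ⟨_, le_rfl⟩
  obtain ⟨M, hM⟩ : ∃ M : ℕ, 10 ^ 12 ≤ M := ⟨_, le_rfl⟩
  have : NeZero M := ⟨by omega⟩
  have : NeZero m := ⟨by omega⟩
  have hmr : (10 : ℝ) ^ 12 ≤ m := by exact_mod_cast hm
  have hMr : (10 : ℝ) ^ 12 ≤ M := by exact_mod_cast hM
  have hm0 : (0 : ℝ) < m := by linarith [show (0 : ℝ) < 10 ^ 12 by norm_num]
  have hM0 : (0 : ℝ) < M := by linarith [show (0 : ℝ) < 10 ^ 12 by norm_num]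
  obtain ⟨av1, av2⟩ := avg_grid_bounds (m := m) (by omega)
  set S₀ := ∑ i : Fin 20, ∑ r : Fin m, Real.exp (0.048 * ((i : ℕ) + (r : ℕ) / m)) with hS₀
  set μ := 0.55 * (S₀ / (20 * m)) - 0.5 with hμ
  let t : Fin 20 → Fin m → ℝ := fun i r =>
    0.55 * Real.exp (0.048 * ((i : ℕ) + (r : ℕ) / m)) - 0.5
  let g : Fin 20 → Fin m → Fin 20 → Fin m → ℝ := fun i r j s =>
    t i r + t j s - μ + (blockCorr i j : ℝ) / 1000
  have tl : ∀ i r, (expTable.getD (i : Fin 20) 0 : ℝ) / 10000 ≤ t i r := by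
    intro i r
    refine (expTable_bounds i (by omega)).1.trans ?_
    simp only [t]
    gcongr
    have : (0 : ℝ) ≤ (r : ℕ) / m := by positivity
    linarith
  have tu : ∀ i r, t i r ≤ ((expTable.getD ((i : Fin 20) + 1) 0 : ℝ) + 1) / 10000 := by
    intro i r
    refine le_trans ?_ (expTable_bounds (i + 1) (by omega)).2
    simp only [t]
    gcongr
    push_cast
    have : ((r : ℕ) : ℝ) / m ≤ 1 := by
      rw [div_le_one hm0]; exact_mod_cast r.2.le
    linarith
  have g0 : ∀ i r j s, 0 ≤ g i r j s := by
    intro i r j s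
    have h1 := tl i r
    have h2 := tl j s
    have h3 : (0 : ℝ) ≤ expTable.getD i 0 + expTable.getD j 0 - 4234 + 10 * blockCorr i j := by
      exact_mod_cast blockCorr_lower i j
    simp only [g]
    linarith
  have g1 : ∀ i r j s, g i r j s ≤ 1 := by
    intro i r j s
    have h1 := tu i r
    have h2 := tu j s
    have h3 : ((expTable.getD (i + 1) 0 : ℝ) + 1) + (expTable.getD (j + 1) 0 + 1) - 4233
        + 10 * blockCorr i j ≤ 10000 := by
      exact_mod_cast blockCorr_upper i j
    simp only [g]
    linarith
  have gs : ∀ i r j s, g i r j s = g j s i r := by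
    intro i r j s
    simp only [g, blockCorr_symm i j]
    ring
  have gsum : ∀ i r, ∑ j, ∑ s, g i r j s = 20 * m * t i r := by
    intro i r
    have hk : ∑ j, (blockCorr i j : ℝ) = 0 := by exact_mod_cast sum_blockCorr i
    have ht : ∑ j, ∑ s, t j s = 20 * m * μ := by
      simp only [t, Finset.sum_sub_distrib, ← Finset.mul_sum, ← hS₀]
      simp only [hμ, Finset.sum_const, Finset.card_univ, Fintype.card_fin, nsmul_eq_mul]
      field_simp
      push_cast
      ring
    simp only [g, Finset.sum_add_distrib, Finset.sum_sub_distrib, ht]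
    simp only [Finset.sum_const, Finset.card_univ, Fintype.card_fin, nsmul_eq_mul,
      ← Finset.mul_sum, ← Finset.sum_div, hk]
    push_cast
    ring
  refine ⟨Fin 20 × Fin m × ZMod M, inferInstance, inferInstance,
    fun z => 1 + 2 * t z.1 z.2.1,
    fun z z' => if ((z.2.2 + z'.2.2).val : ℝ) < M * g z.1 z.2.1 z'.1 z'.2.1 then 1 else 0,
    inferInstance, ?_, ?_, ?_, ?_, ?_⟩
  · rintro ⟨i, r, b⟩
    have h1 := tl i r
    have h2 := tu i r
    have h3 : ∀ i : Fin 20, 500 ≤ expTable.getD i 0 ∧ expTable.getD (i + 1) 0 ≤ 9364 := by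
      decide +kernel
    have h4 : (500 : ℝ) ≤ expTable.getD i 0 := by exact_mod_cast (h3 i).1
    have h5 : (expTable.getD (i + 1) 0 : ℝ) ≤ 9364 := by exact_mod_cast (h3 i).2
    constructor <;> norm_num <;> linarith
  · rintro ⟨i, r, b⟩ ⟨j, s, b'⟩
    simp only [gs i r j s, add_comm b b']
  · rintro z z'
    dsimp only
    split_ifs <;> simp
  · rintro ⟨i, r, b⟩
    have hcard : (Fintype.card (Fin 20 × Fin m × ZMod M) : ℝ) = 20 * m * M := by
      simp [ZMod.card, mul_assoc]
    rw [hcard]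
    have hin : ∀ j s, ∑ b' : ZMod M,
        (((if ((b + b').val : ℝ) < M * g i r j s then 1 else 0 : ℕ)) : ℝ) =
        (⌈M * g i r j s⌉₊ : ℝ) := by
      intro j s
      rw [← card_zmod_shift_lt (M := M) b (y := M * g i r j s)
        (mul_le_of_le_one_right hM0.le (g1 _ _ _ _))]
      simp
    have hs : ∑ z' : Fin 20 × Fin m × ZMod M,
        (1 + 2 * (((if ((b + z'.2.2).val : ℝ) < M * g i r z'.1 z'.2.1 then 1 else 0 : ℕ)) : ℝ)
          - (1 + 2 * t i r)) =
        2 * ∑ j, ∑ s, ((⌈M * g i r j s⌉₊ : ℝ) - M * g i r j s) := by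
      have e1 : ∀ y : ℝ, 1 + 2 * y - (1 + 2 * t i r) = 2 * y - 2 * t i r := fun y => by ring
      simp_rw [e1, Fintype.sum_prod_type, Finset.sum_sub_distrib, ← Finset.mul_sum, hin, gsum]
      simp only [Finset.sum_const, Finset.card_univ, Fintype.card_fin, nsmul_eq_mul, ZMod.card]
      push_cast
      ring
    dsimp only
    rw [hs]
    have hb : ∀ j s, 0 ≤ (⌈M * g i r j s⌉₊ : ℝ) - M * g i r j s ∧
        (⌈M * g i r j s⌉₊ : ℝ) - M * g i r j s ≤ 1 := by
      intro j s
      have h0 : 0 ≤ M * g i r j s := mul_nonneg hM0.le (g0 _ _ _ _)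
      have := Nat.le_ceil (M * g i r j s)
      have := Nat.ceil_lt_add_one h0
      constructor <;> linarith
    have hpos : 0 ≤ ∑ j, ∑ s, ((⌈M * g i r j s⌉₊ : ℝ) - M * g i r j s) :=
      Finset.sum_nonneg fun j _ => Finset.sum_nonneg fun s _ => (hb j s).1
    have hle : ∑ j, ∑ s, ((⌈M * g i r j s⌉₊ : ℝ) - M * g i r j s) ≤ ∑ j : Fin 20, ∑ s : Fin m, 1 :=
      Finset.sum_le_sum fun j _ => Finset.sum_le_sum fun s _ => (hb j s).2
    simp only [Finset.sum_const, Finset.card_univ, Fintype.card_fin, nsmul_eq_mul] at hle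
    rw [abs_of_nonneg (by positivity)]
    push_cast at hle
    nlinarith
  · intro S A w hA hw hS hd
    have hcard : (Fintype.card (Fin 20 × Fin m × ZMod M) : ℝ) = 20 * m * M := by
      simp [ZMod.card, mul_assoc]
    rw [hcard]
    rcases S.eq_empty_or_nonempty with rfl | hne
    · simp; positivity
    let n : Fin 20 × Fin m × ZMod M → ℕ := fun z => z.2.1 + m * z.1
    have hx : ∀ z : Fin 20 × Fin m × ZMod M,
        1 + 2 * t z.1 z.2.1 = 1.1 * Real.exp (0.048 / m * n z) := by
      intro z
      simp only [t, n]
      have : 0.048 / (m : ℝ) * ((z.2.1 + m * z.1 : ℕ) : ℝ) =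
          0.048 * ((z.1 : ℕ) + (z.2.1 : ℕ) / (m : ℝ)) := by
        push_cast; field_simp; ring
      rw [this]; ring
    have hinj : ∀ z z' : Fin 20 × Fin m × ZMod M, n z = n z' → z.1 = z'.1 ∧ z.2.1 = z'.2.1 := by
      intro z z' h
      have := (finProdFinEquiv (m := 20) (n := m)).injective
        (a₁ := (z.1, z.2.1)) (a₂ := (z'.1, z'.2.1)) (Fin.ext (by simpa [n] using h))
      simpa using this
    have hgap : ∀ z ∈ S, ∀ z' ∈ S, (n z : ℝ) - n z' ≤ w * m / (0.048 * A) := by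
      intro z hz z' hz'
      have h1 := hd z hz z' hz'
      have h2 := hS z' hz'
      dsimp only at h1 h2
      rw [hx z, hx z'] at h1
      rw [hx z'] at h2
      rw [le_div_iff₀ (by positivity)]
      rcases le_total (n z : ℝ) (n z') with hn | hn
      · have : 0 ≤ w * m := by positivity
        nlinarith [mul_pos (show (0 : ℝ) < 0.048 by norm_num) hA]
      have h3 : Real.exp (0.048 / m * n z) = Real.exp (0.048 / m * n z') *
          Real.exp (0.048 / m * (n z - n z')) := by rw [← Real.exp_add]; ring_nf
      have h4 := Real.add_one_le_exp (0.048 / m * ((n z : ℝ) - n z'))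
      have h5 : 0 ≤ 0.048 / m * ((n z : ℝ) - n z') := mul_nonneg (by positivity) (by linarith)
      have h6 : A * (0.048 / m * ((n z : ℝ) - n z')) ≤ w := by
        have hE := Real.exp_pos (0.048 / m * n z')
        rw [h3] at h1
        calc A * (0.048 / m * ((n z : ℝ) - n z'))
            ≤ 1.1 * Real.exp (0.048 / m * n z') * (0.048 / m * ((n z : ℝ) - n z')) := by gcongr
          _ ≤ 1.1 * Real.exp (0.048 / m * n z') *
              (Real.exp (0.048 / m * ((n z : ℝ) - n z')) - 1) := by gcongr; linarith
          _ ≤ w := by linarith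
      calc ((n z : ℝ) - n z') * (0.048 * A)
          = A * (0.048 / m * ((n z : ℝ) - n z')) * m := by field_simp
        _ ≤ w * m := by gcongr
    obtain ⟨z₀, hz₀, hmin⟩ := Finset.exists_min_image S n hne
    have himg : ((S.image n).card : ℝ) ≤ w * m / (0.048 * A) + 1 := by
      have hsub : S.image n ⊆ Finset.Icc (n z₀) (n z₀ + ⌊w * m / (0.048 * A)⌋₊) := by
        intro k hk
        obtain ⟨z, hz, rfl⟩ := Finset.mem_image.1 hk
        have h1 := hmin z hz
        have h2 := hgap z hz z₀ hz₀
        have h3 : n z - n z₀ ≤ ⌊w * m / (0.048 * A)⌋₊ := by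
          apply Nat.le_floor
          rwa [Nat.cast_sub h1]
        rw [Finset.mem_Icc]
        omega
      have h1 := Finset.card_le_card hsub
      rw [Nat.card_Icc] at h1
      have h2 : (⌊w * m / (0.048 * A)⌋₊ : ℝ) ≤ w * m / (0.048 * A) := Nat.floor_le (by positivity)
      have h3 : (S.image n).card ≤ ⌊w * m / (0.048 * A)⌋₊ + 1 := by omega
      have h4 : ((S.image n).card : ℝ) ≤ ⌊w * m / (0.048 * A)⌋₊ + 1 := by exact_mod_cast h3
      linarith
    have hfib : S.card ≤ M * (S.image n).card := by
      refine Finset.card_le_mul_card_image S M fun k hk => ?_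
      refine le_trans ?_ (ZMod.card M).le
      rw [← Finset.card_univ]
      refine Finset.card_le_card_of_injOn (fun z => z.2.2) (fun _ _ => by simp) ?_
      intro z hz z' hz' h
      rw [Finset.mem_coe, Finset.mem_filter] at hz hz'
      obtain ⟨e1, e2⟩ := hinj z z' (hz.2.trans hz'.2.symm)
      exact Prod.ext e1 (Prod.ext e2 h)
    have hfib' : (S.card : ℝ) ≤ M * (S.image n).card := by exact_mod_cast hfib
    have hfin : M * (w * m / (0.048 * A) + 1) ≤ (w / (0.96 * A) + 1e-13) * (20 * m * M) := by
      have e1 : w / (0.96 * A) * (20 * m * M) = M * (w * m / (0.048 * A)) := by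
        field_simp; ring
      rw [add_mul, e1]
      nlinarith
    exact hfib'.trans ((mul_le_mul_of_nonneg_left himg hM0.le).trans hfin)

/-- Events depending on disjoint sets of coordinates are independent under the uniform measure. -/
theorem card_filter_and_mul_card {V Z : Type*} [Fintype V] [DecidableEq V] [Fintype Z]
    (S : Finset V) (A B : (V → Z) → Prop) [DecidablePred A] [DecidablePred B]
    (hA : ∀ f g : V → Z, (∀ u ∈ S, f u = g u) → (A f ↔ A g))
    (hB : ∀ f g : V → Z, (∀ u, u ∉ S → f u = g u) → (B f ↔ B g)) :
    (Finset.univ.filter (fun f => A f ∧ B f)).card * Fintype.card (V → Z) =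
      (Finset.univ.filter A).card * (Finset.univ.filter B).card := by
  rw [← Finset.card_univ, ← Finset.card_product, ← Finset.card_product]
  let sw : (V → Z) × (V → Z) → (V → Z) × (V → Z) := fun p =>
    (fun u => if u ∈ S then p.1 u else p.2 u, fun u => if u ∈ S then p.2 u else p.1 u)
  have hsw : ∀ p, sw (sw p) = p := by
    rintro ⟨f, g⟩
    ext u <;> by_cases hu : u ∈ S <;> simp [sw, hu]
  have h1 : ∀ p, A (sw p).1 ↔ A p.1 := fun p => hA _ _ fun u hu => by simp [sw, hu]
  have h2 : ∀ p, B (sw p).2 ↔ B p.1 := fun p => hB _ _ fun u hu => by simp [sw, hu]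
  have h3 : ∀ p, B (sw p).1 ↔ B p.2 := fun p => hB _ _ fun u hu => by simp [sw, hu]
  refine Finset.card_nbij' sw sw ?_ ?_ (fun p _ => hsw p) (fun p _ => hsw p)
  · intro p hp
    simp only [Finset.coe_product, Set.mem_prod, Finset.mem_coe, Finset.mem_filter,
      Finset.mem_univ, true_and, and_true] at hp ⊢
    exact ⟨(h1 p).2 hp.1, (h2 p).2 hp.2⟩
  · intro p hp
    simp only [Finset.coe_product, Set.mem_prod, Finset.mem_coe, Finset.mem_filter,
      Finset.mem_univ, true_and, and_true] at hp ⊢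
    exact ⟨(h1 p).2 hp.1, (h3 p).2 hp.2⟩

/-- Symmetric Lovász local lemma on a finite product space with the uniform measure. -/
theorem exists_avoiding_of_local {V Z : Type*} [Fintype V] [DecidableEq V] [Fintype Z]
    [Nonempty Z] (A : V → (V → Z) → Prop) (S : V → Finset V) (p D : ℝ)
    (hdep : ∀ v, ∀ f g : V → Z, (∀ u ∈ S v, f u = g u) → (A v f ↔ A v g))
    (hp0 : 0 ≤ p) (hp1 : 2 * p < 1) (hpD : 4 * p * D ≤ 1)
    (hp : ∀ v, ∀ P : Finset (V → Z), (∀ f ∈ P, A v f) →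
      (P.card : ℝ) ≤ p * Fintype.card (V → Z))
    (hD : ∀ v, ((Finset.univ.filter (fun w => ¬ Disjoint (S v) (S w))).card : ℝ) ≤ D) :
    ∃ f, ∀ v, ¬ A v f := by
  classical
  let N : Finset V → Finset (V → Z) := fun T =>
    Finset.univ.filter (fun f => ∀ w ∈ T, ¬ A w f)
  have hcard : (0 : ℝ) < Fintype.card (V → Z) := by exact_mod_cast Fintype.card_pos
  have main : ∀ n, ∀ T : Finset V, T.card ≤ n → ∀ v,
      (((N T).filter (A v)).card : ℝ) ≤ 2 * p * (N T).card := by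
    intro n
    induction n with
    | zero =>
      intro T hT v
      obtain rfl : T = ∅ := by simpa using hT
      have h := hp v ((N ∅).filter (A v)) (fun f hf => (Finset.mem_filter.1 hf).2)
      have e : (N ∅).card = Fintype.card (V → Z) := by simp [N]
      rw [e]
      nlinarith
    | succ n ih =>
      intro T hT v
      let T₁ := T.filter (fun w => ¬ Disjoint (S v) (S w))
      let T₂ := T.filter (fun w => Disjoint (S v) (S w))
      have hsub : N T ⊆ N T₂ := by
        intro f hf
        simp only [N, Finset.mem_filter, Finset.mem_univ, true_and] at hf ⊢
        exact fun w hw => hf w (Finset.mem_filter.1 hw).1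
      have hind : (((N T₂).filter (A v)).card : ℝ) ≤ p * (N T₂).card := by
        have h := card_filter_and_mul_card (S v) (A v) (fun f => ∀ w ∈ T₂, ¬ A w f) (hdep v)
          (by
            intro f g hfg
            refine forall₂_congr fun w hw => not_congr (hdep w f g fun u hu => hfg u fun hu' => ?_)
            exact Finset.disjoint_left.1 (Finset.mem_filter.1 hw).2 hu' hu)
        have h' : (((N T₂).filter (A v)).card : ℝ) * Fintype.card (V → Z) =
            (Finset.univ.filter (A v)).card * (N T₂).card := by
          rw [Finset.filter_filter]
          simp_rw [and_comm (b := A v _)]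
          exact_mod_cast h
        have h2 := hp v (Finset.univ.filter (A v)) (fun f hf => (Finset.mem_filter.1 hf).2)
        have h3 : (0 : ℝ) ≤ (N T₂).card := by positivity
        refine le_of_mul_le_mul_right ?_ hcard
        rw [h']
        nlinarith
      have hle : (((N T).filter (A v)).card : ℝ) ≤ ((N T₂).filter (A v)).card := by
        exact_mod_cast Finset.card_le_card (Finset.filter_subset_filter _ hsub)
      have hhalf : ((N T₂).card : ℝ) ≤ 2 * (N T).card := by
        by_cases hT1 : T₁ = ∅
        · have : T₂ = T := by
            refine Finset.filter_true_of_mem fun w hw => ?_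
            by_contra hc
            have : w ∈ T₁ := Finset.mem_filter.2 ⟨hw, hc⟩
            simp [hT1] at this
          rw [this]
          have : (0 : ℝ) ≤ (N T).card := by positivity
          linarith
        · have hlt : T₂.card ≤ n := by
            have h1 : T₁.card + T₂.card = T.card := by
              rw [add_comm]
              exact Finset.card_filter_add_card_filter_not _
            have h2 : 0 < T₁.card := Finset.card_pos.2 (Finset.nonempty_iff_ne_empty.2 hT1)
            omega
          have hcov : N T₂ ⊆ N T ∪ T₁.biUnion (fun w => (N T₂).filter (A w)) := by
            intro f hf
            by_cases hfT : f ∈ N T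
            · exact Finset.mem_union_left _ hfT
            · refine Finset.mem_union_right _ ?_
              simp only [N, Finset.mem_filter, Finset.mem_univ, true_and, not_forall,
                not_not] at hfT
              obtain ⟨w, hw, hAw⟩ := hfT
              refine Finset.mem_biUnion.2 ⟨w, Finset.mem_filter.2 ⟨hw, fun hdis => ?_⟩,
                Finset.mem_filter.2 ⟨hf, hAw⟩⟩
              exact (Finset.mem_filter.1 hf).2 w (Finset.mem_filter.2 ⟨hw, hdis⟩) hAw
          have h1 : (N T₂).card ≤ (N T).card + ∑ w ∈ T₁, ((N T₂).filter (A w)).card :=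
            (Finset.card_le_card hcov).trans ((Finset.card_union_le _ _).trans
              (Nat.add_le_add_left Finset.card_biUnion_le _))
          have h2 : ((N T₂).card : ℝ) ≤
              (N T).card + ∑ w ∈ T₁, (((N T₂).filter (A w)).card : ℝ) := by exact_mod_cast h1
          have h3 : ∑ w ∈ T₁, (((N T₂).filter (A w)).card : ℝ) ≤
              ∑ w ∈ T₁, 2 * p * (N T₂).card := Finset.sum_le_sum fun w _ => ih T₂ hlt w
          rw [Finset.sum_const, nsmul_eq_mul] at h3
          have h4 : (T₁.card : ℝ) ≤ D := by
            refine le_trans ?_ (hD v)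
            exact_mod_cast Finset.card_le_card (Finset.filter_subset_filter _ (Finset.subset_univ _))
          have h5 : (T₁.card : ℝ) * (2 * p * (N T₂).card) ≤ D * (2 * p * (N T₂).card) := by
            gcongr
          have h6 : D * (2 * p * (N T₂).card) ≤ 1 / 2 * (N T₂).card := by
            have : (0 : ℝ) ≤ (N T₂).card := by positivity
            nlinarith
          linarith
      nlinarith
  have hpos : ∀ T : Finset V, 0 < ((N T).card : ℝ) := by
    intro T
    induction T using Finset.induction_on with
    | empty => simpa [N] using hcard
    | insert v T hv ih =>
      have h1 : (N (insert v T)) = (N T).filter (fun f => ¬ A v f) := by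
        ext f
        simp only [N, Finset.mem_filter, Finset.mem_univ, true_and, Finset.forall_mem_insert]
        exact and_comm
      have h2 : ((N T).filter (A v)).card + ((N T).filter (fun f => ¬ A v f)).card = (N T).card :=
        Finset.card_filter_add_card_filter_not _
      have h3 : (((N T).filter (A v)).card : ℝ) + ((N T).filter (fun f => ¬ A v f)).card =
          (N T).card := by exact_mod_cast h2
      have h4 := main T.card T le_rfl v
      rw [h1]
      nlinarith
  have h := hpos Finset.univ
  obtain ⟨f, hf⟩ := Finset.card_pos.1 (show 0 < (N Finset.univ).card by exact_mod_cast h)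
  exact ⟨f, fun v => (Finset.mem_filter.1 hf).2 v (Finset.mem_univ v)⟩

/-- Exponential Markov inequality for a sum of functions of independent uniform coordinates,
conditionally on the coordinate `v`. -/
theorem card_le_exp_of_sum_ge {V Z : Type*} [Fintype V] [DecidableEq V] [Fintype Z]
    [DecidableEq Z] (v : V) (U : Finset V) (hv : v ∉ U) (Y : V → Z → Z → ℝ) (κ T : ℝ)
    (hY : ∀ u ∈ U, ∀ ζ, ∑ z, Real.exp (Y u ζ z) ≤ Real.exp κ * Fintype.card Z)
    (P : Finset (V → Z)) (hP : ∀ f ∈ P, T ≤ ∑ u ∈ U, Y u (f v) (f u)) :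
    (P.card : ℝ) ≤ Real.exp (U.card * κ - T) * Fintype.card (V → Z) := by
  have key : ∑ f : V → Z, Real.exp (∑ u ∈ U, Y u (f v) (f u)) ≤
      Real.exp (U.card * κ) * Fintype.card (V → Z) := by
    let H : Z → V → Z → ℝ := fun ζ u z =>
      if u = v then (if z = ζ then 1 else 0) else if u ∈ U then Real.exp (Y u ζ z) else 1
    have e1 : ∀ f : V → Z, Real.exp (∑ u ∈ U, Y u (f v) (f u)) = ∑ ζ, ∏ u, H ζ u (f u) := by
      intro f
      rw [Finset.sum_eq_single (f v)]
      · rw [Real.exp_sum, ← Finset.prod_subset (Finset.subset_univ U)]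
        · refine Finset.prod_congr rfl fun u hu => ?_
          have : u ≠ v := fun h => hv (h ▸ hu)
          simp [H, this, hu]
        · intro u _ hu
          by_cases h : u = v
          · subst h; simp [H]
          · simp [H, h, hu]
      · intro ζ _ hζ
        exact Finset.prod_eq_zero (Finset.mem_univ v) (by simp [H, hζ.symm])
      · intro h; exact absurd (Finset.mem_univ _) h
    have e2 : ∀ ζ, ∏ u, ∑ z, H ζ u z ≤
        Real.exp (U.card * κ) * (Fintype.card Z : ℝ) ^ (Fintype.card V - 1) := by
      intro ζ
      rw [← Finset.mul_prod_erase _ _ (Finset.mem_univ v)]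
      have hv1 : ∑ z, H ζ v z = 1 := by simp [H]
      have hUe : U ⊆ Finset.univ.erase v := fun u hu =>
        Finset.mem_erase.2 ⟨fun h => hv (h ▸ hu), Finset.mem_univ _⟩
      have hb : ∏ u ∈ Finset.univ.erase v, ∑ z, H ζ u z ≤
          ∏ u ∈ Finset.univ.erase v, ((if u ∈ U then Real.exp κ else 1) * (Fintype.card Z : ℝ)) := by
        refine Finset.prod_le_prod (fun u _ => Finset.sum_nonneg fun z _ => ?_) fun u hu => ?_
        · simp only [H]; split_ifs <;> positivity
        · have hne := (Finset.mem_erase.1 hu).1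
          by_cases h : u ∈ U
          · simpa [H, hne, h] using hY u h ζ
          · simp [H, hne, h]
      rw [hv1, one_mul]
      refine hb.trans (le_of_eq ?_)
      rw [Finset.prod_mul_distrib, Finset.prod_const, Finset.card_erase_of_mem (Finset.mem_univ v),
        Finset.card_univ, ← Finset.prod_subset hUe (fun u _ hu => if_neg hu),
        Finset.prod_congr rfl (fun u hu => if_pos hu), Finset.prod_const, ← Real.exp_nat_mul]
    simp_rw [e1]
    rw [Finset.sum_comm]
    have e3 : ∀ ζ, ∑ f : V → Z, ∏ u, H ζ u (f u) = ∏ u, ∑ z, H ζ u z := by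
      intro ζ
      rw [Finset.prod_univ_sum]
      simp
    simp_rw [e3]
    refine (Finset.sum_le_sum fun ζ _ => e2 ζ).trans (le_of_eq ?_)
    have hVpos : 0 < Fintype.card V := Fintype.card_pos_iff.2 ⟨v⟩
    rw [Finset.sum_const, Finset.card_univ, nsmul_eq_mul, Fintype.card_fun]
    push_cast
    rw [mul_left_comm, ← pow_succ', Nat.sub_add_cancel hVpos]
  have h1 : (P.card : ℝ) * Real.exp T ≤ ∑ f : V → Z, Real.exp (∑ u ∈ U, Y u (f v) (f u)) := by
    rw [← nsmul_eq_mul, ← Finset.sum_const]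
    exact (Finset.sum_le_sum fun f hf => Real.exp_le_exp.2 (hP f hf)).trans
      (Finset.sum_le_sum_of_subset_of_nonneg (Finset.subset_univ P)
        fun f _ _ => (Real.exp_pos _).le)
  rw [Real.exp_sub, div_mul_eq_mul_div, le_div_iff₀ (Real.exp_pos T)]
  exact h1.trans key

theorem ell_bounds {V : Type} [Fintype V] [DecidableEq V] (G : SimpleGraph V)
    [DecidableRel G.Adj] (W : Finset V) (v : V) (hd : 0 < dIn G W v) :
    0 < ell G W v ∧ ell G W v ≤ 1e-9 * (dIn G W v : ℝ) ∧
      1e-9 * (dIn G W v : ℝ) ≤ 2 * ell G W v := by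
  have hy : 0 < 1e-9 * (dIn G W v : ℝ) := by positivity
  have hl : ell G W v = (2 : ℝ) ^ ((⌊Real.logb 2 (1e-9 * (dIn G W v : ℝ))⌋ : ℤ) : ℝ) := by
    rw [ell, Real.rpow_intCast]
  refine ⟨by unfold ell; positivity, ?_, ?_⟩
  · rw [hl]
    calc _ ≤ (2 : ℝ) ^ Real.logb 2 (1e-9 * (dIn G W v : ℝ)) :=
          Real.rpow_le_rpow_of_exponent_le (by norm_num) (Int.floor_le _)
      _ = _ := Real.rpow_logb (by norm_num) (by norm_num) hy
  · rw [hl]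
    calc 1e-9 * (dIn G W v : ℝ) = (2 : ℝ) ^ Real.logb 2 (1e-9 * (dIn G W v : ℝ)) :=
          (Real.rpow_logb (by norm_num) (by norm_num) hy).symm
      _ ≤ (2 : ℝ) ^ (((⌊Real.logb 2 (1e-9 * (dIn G W v : ℝ))⌋ : ℤ) : ℝ) + 1) :=
          Real.rpow_le_rpow_of_exponent_le (by norm_num) (Int.lt_floor_add_one _).le
      _ = _ := by rw [Real.rpow_add_one (by norm_num), mul_comm]

theorem sum_indEdges_filter_mem {V : Type} [Fintype V] [DecidableEq V] (G : SimpleGraph V)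
    [DecidableRel G.Adj] (W : Finset V) {v : V} (hv : v ∈ W) (w : Sym2 V → ℕ) :
    ∑ e ∈ (indEdges G W).filter (fun e => v ∈ e), w e =
      ∑ u ∈ G.neighborFinset v ∩ W, w s(v, u) := by
  symm
  refine Finset.sum_bij (fun u _ => s(v, u)) ?_ ?_ ?_ ?_
  · intro u hu
    rw [Finset.mem_inter, SimpleGraph.mem_neighborFinset] at hu
    rw [Finset.mem_filter, indEdges, Finset.mem_filter, SimpleGraph.mem_edgeFinset,
      SimpleGraph.mem_edgeSet]
    exact ⟨⟨hu.1, v, hv, u, hu.2, rfl⟩, Sym2.mem_mk_left v u⟩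
  · intro a _ b _ h
    exact Sym2.congr_right.1 h
  · intro e he
    rw [Finset.mem_filter, indEdges, Finset.mem_filter, SimpleGraph.mem_edgeFinset] at he
    obtain ⟨⟨he, a, ha, b, hb, rfl⟩, hve⟩ := he
    rw [SimpleGraph.mem_edgeSet] at he
    rcases Sym2.mem_iff.1 hve with rfl | rfl
    · exact ⟨b, Finset.mem_inter.2 ⟨(G.mem_neighborFinset _ _).2 he, hb⟩, rfl⟩
    · exact ⟨a, Finset.mem_inter.2 ⟨(G.mem_neighborFinset _ _).2 he.symm, ha⟩, Sym2.eq_swap⟩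
  · intro _ _; rfl

/-- One-sided concentration of a sum of bounded functions of independent uniform coordinates. -/
theorem card_le_of_sum_ge {V Z : Type*} [Fintype V] [DecidableEq V] [Fintype Z]
    [DecidableEq Z] (v : V) (U : Finset V) (hv : v ∉ U) (y : Z → Z → ℝ)
    (hy : ∀ ζ z, |y ζ z| ≤ 2) (hs : ∀ ζ, ∑ z, y ζ z ≤ 1e-11 * Fintype.card Z)
    (P : Finset (V → Z)) (hP : ∀ f ∈ P, 1e-9 * (U.card : ℝ) ≤ ∑ u ∈ U, y (f v) (f u)) :
    (P.card : ℝ) ≤ Real.exp (-6e-20 * U.card) * Fintype.card (V → Z) := by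
  have h := card_le_exp_of_sum_ge v U hv (fun _ ζ z => 1.2e-10 * y ζ z) (5.88e-20)
    (1.2e-10 * (1e-9 * U.card)) ?_ P ?_
  · refine h.trans ?_
    gcongr
    have : (0 : ℝ) ≤ U.card := by positivity
    norm_num
    linarith
  · intro u _ ζ
    have h1 : ∀ z, Real.exp (1.2e-10 * y ζ z) ≤ 1 + 1.2e-10 * y ζ z + 5.76e-20 := by
      intro z
      have hb := abs_le.1 (hy ζ z)
      have h2 : |1.2e-10 * y ζ z| ≤ 1 := by rw [abs_le]; constructor <;> linarith
      have h3 := (abs_le.1 (Real.abs_exp_sub_one_sub_id_le h2)).2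
      have h4 : y ζ z ^ 2 ≤ 4 := by nlinarith
      nlinarith
    calc ∑ z, Real.exp (1.2e-10 * y ζ z) ≤ ∑ z, (1 + 1.2e-10 * y ζ z + 5.76e-20) :=
          Finset.sum_le_sum fun z _ => h1 z
      _ = 1.2e-10 * ∑ z, y ζ z + (1 + 5.76e-20) * Fintype.card Z := by
          simp only [Finset.sum_add_distrib, ← Finset.mul_sum, Finset.sum_const, Finset.card_univ,
            nsmul_eq_mul]
          ring
      _ ≤ (5.88e-20 + 1) * Fintype.card Z := by
          have := hs ζ
          have : (0 : ℝ) ≤ Fintype.card Z := by positivity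
          linarith
      _ ≤ _ := by
          gcongr
          exact Real.add_one_le_exp _
  · intro f hf
    rw [← Finset.mul_sum]
    have := hP f hf
    gcongr

/-- Upper tail for the number of coordinates in `U` satisfying a condition of small
probability. -/
theorem card_le_of_count_gt {V Z : Type*} [Fintype V] [DecidableEq V] [Fintype Z]
    [DecidableEq Z] (v : V) (U : Finset V) (hv : v ∉ U) (Q : V → Z → Z → Prop)
    [∀ u ζ z, Decidable (Q u ζ z)] (l d : ℝ) (hl : 0 ≤ l) (hd : 0 < d) (hU : (U.card : ℝ) ≤ d)
    (hQ : ∀ u ∈ U, ∀ ζ, ((Finset.univ.filter (fun z => Q u ζ z)).card : ℝ) ≤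
      0.9475 * (l / d) * Fintype.card Z)
    (P : Finset (V → Z))
    (hP : ∀ f ∈ P, 0.95 * l ≤ ((U.filter (fun u => Q u (f v) (f u))).card : ℝ)) :
    (P.card : ℝ) ≤ Real.exp (-1.5e-6 * l) * Fintype.card (V → Z) := by
  have h := card_le_exp_of_sum_ge v U hv (fun u ζ z => if Q u ζ z then 0.001 else 0)
    (0.001001 * (0.9475 * (l / d))) (0.001 * (0.95 * l)) ?_ P ?_
  · refine h.trans ?_
    gcongr
    have h1 : U.card * (0.001001 * (0.9475 * (l / d))) ≤ d * (0.001001 * (0.9475 * (l / d))) := by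
      gcongr
    have h2 : d * (0.001001 * (0.9475 * (l / d))) = 0.001001 * 0.9475 * l := by
      field_simp
    linarith
  · intro u hu ζ
    have h1 : ∀ z, Real.exp (if Q u ζ z then (0.001 : ℝ) else 0) ≤
        1 + if Q u ζ z then (0.001001 : ℝ) else 0 := by
      intro z
      split_ifs
      · have h3 := (abs_le.1 (Real.abs_exp_sub_one_sub_id_le (x := 0.001)
          (by norm_num))).2
        norm_num at h3 ⊢
        linarith
      · simp
    have hc : (0 : ℝ) ≤ Fintype.card Z := by positivity
    calc _ ≤ ∑ z, (1 + if Q u ζ z then (0.001001 : ℝ) else 0) :=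
          Finset.sum_le_sum fun z _ => h1 z
      _ = Fintype.card Z + 0.001001 * (Finset.univ.filter (fun z => Q u ζ z)).card := by
          rw [Finset.sum_add_distrib, ← Finset.sum_filter, Finset.sum_const, Finset.sum_const,
            Finset.card_univ]
          simp only [nsmul_eq_mul]
          ring
      _ ≤ (0.001001 * (0.9475 * (l / d)) + 1) * Fintype.card Z := by
          have := hQ u hu ζ
          linarith
      _ ≤ _ := by
          gcongr
          exact Real.add_one_le_exp _
  · intro f hf
    rw [← Finset.sum_filter, Finset.sum_const, nsmul_eq_mul]
    have := hP f hf
    linarith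

/-- The number of closed neighbourhoods meeting a given one. -/
theorem card_filter_not_disjoint_closedNbhd {V : Type*} [Fintype V] [DecidableEq V]
    (G : SimpleGraph V) [DecidableRel G.Adj] (v : V) :
    (Finset.univ.filter (fun w => ¬ Disjoint (insert v (G.neighborFinset v))
      (insert w (G.neighborFinset w)))).card ≤ (G.maxDegree + 1) * (G.maxDegree + 1) := by
  have hc : ∀ u, (insert u (G.neighborFinset u)).card ≤ G.maxDegree + 1 := fun u =>
    (Finset.card_insert_le _ _).trans
      (Nat.add_le_add_right ((G.card_neighborFinset_eq_degree u).trans_le (G.degree_le_maxDegree u)) 1)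
  refine (Finset.card_le_card (t := (insert v (G.neighborFinset v)).biUnion
    fun u => insert u (G.neighborFinset u)) ?_).trans
    ((Finset.card_biUnion_le_card_mul _ _ _ fun u _ => hc u).trans (Nat.mul_le_mul_right _ (hc v)))
  intro w hw
  obtain ⟨u, hu1, hu2⟩ := Finset.not_disjoint_iff.1 (Finset.mem_filter.1 hw).2
  refine Finset.mem_biUnion.2 ⟨u, hu1, ?_⟩
  rcases Finset.mem_insert.1 hu2 with rfl | h
  · exact Finset.mem_insert_self _ _
  · rw [SimpleGraph.mem_neighborFinset] at h
    exact Finset.mem_insert_of_mem ((G.mem_neighborFinset _ _).2 h.symm)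

/-- A state of `u` putting its near location into the interval of `v` has a large value, and all
such states have close values. -/
theorem card_states_in_interval_le {Z : Type} [Fintype Z] (x : Z → ℝ)
    (hS : ∀ (S : Finset Z) (A w : ℝ), 0 < A → 0 ≤ w → (∀ z ∈ S, A ≤ x z) →
        (∀ z ∈ S, ∀ z' ∈ S, x z - x z' ≤ w) →
        (S.card : ℝ) ≤ (w / (0.96 * A) + 1e-13) * Fintype.card Z)
    {cu cv du dv lu lv xv : ℝ} (hdu : 0 < du) (hduv : du ≤ dv) (hlu : lu ≤ 1e-9 * du)
    (hlv : 0 < lv) (hlv' : 1e-9 * dv ≤ 2 * lv)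
    (hc : cv - cu ≥ -5e-6 * dv) (hxv : 1.1 ≤ xv) (S : Finset Z)
    (hI : ∀ z ∈ S, cu + x z * du + 3 * lu ∈
      Set.Ico ((⌊(cv + xv * dv + 3 * lv) / lv⌋ : ℝ) * lv)
        ((⌊(cv + xv * dv + 3 * lv) / lv⌋ + 1 : ℝ) * lv)) :
    (S.card : ℝ) ≤ 0.9475 * (lv / dv) * Fintype.card Z := by
  have hdv : 0 < dv := hdu.trans_le hduv
  have hfl := Int.lt_floor_add_one ((cv + xv * dv + 3 * lv) / lv)
  rw [div_lt_iff₀ hlv] at hfl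
  generalize (⌊(cv + xv * dv + 3 * lv) / lv⌋ : ℝ) = k at hI hfl
  have h := hS S (1.09999 * dv / du) (lv / du) (by positivity) (by positivity) ?_ ?_
  · refine h.trans ?_
    gcongr
    have e : lv / du / (0.96 * (1.09999 * dv / du)) = lv / dv / (0.96 * 1.09999) := by
      field_simp
    rw [e]
    have h1 : 5e-10 ≤ lv / dv := by rw [le_div_iff₀ hdv]; linarith
    have h2 : lv / dv / (0.96 * 1.09999) ≤ 0.947 * (lv / dv) := by
      rw [div_le_iff₀ (by norm_num)]
      linarith
    linarith
  · intro z hz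
    obtain ⟨h1, _⟩ := hI z hz
    rw [div_le_iff₀ hdu]
    have : 1.1 * dv ≤ xv * dv := by gcongr
    linarith
  · intro z hz z' hz'
    obtain ⟨h1, h2⟩ := hI z hz
    obtain ⟨h3, h4⟩ := hI z' hz'
    rw [le_div_iff₀ hdu]
    linarith

/-- Existence of reals `x_v ∈ [1.1, 2.9]` and a `{1,3}`-weighting of `E(G[W])`
such that every `v ∈ W` satisfies (i) `|σ(v) − x_v d_W(v)| ≤ 10⁻⁹ d_W(v)` and
(ii) at most `0.95 l(v)` neighbours `u ∈ W` of `v` with `d_W(u) ≤ d_W(v)` have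
`s₀(u) ∈ I(v)`. -/
theorem statement19 :
    ∃ Δ₀ : ℕ, ∀ (V : Type) [Fintype V] [DecidableEq V]
      (G : SimpleGraph V) [DecidableRel G.Adj],
      Δ₀ ≤ G.maxDegree →
      (1e20 : ℝ) * Real.log G.maxDegree ≤ (G.minDegree : ℝ) →
      ∀ (W : Finset V) (c : V → ℝ),
        (∀ v ∈ W, 0 ≤ c v) →
        (∀ v ∈ W, (1 - 1.01e-4) * (G.degree v : ℝ) ≤ (dIn G W v : ℝ)) →
        (∀ u v : V, u ∈ W → v ∈ W → G.Adj u v → dIn G W u ≤ dIn G W v →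
          c v - c u ≥ -5e-6 * (dIn G W v : ℝ)) →
        ∃ (x : V → ℝ) (ω : Sym2 V → ℕ),
          (∀ v ∈ W, x v ∈ Set.Icc (1.1 : ℝ) 2.9) ∧
          (∀ e ∈ indEdges G W, ω e = 1 ∨ ω e = 3) ∧
          (∀ v ∈ W,
            |((∑ e ∈ (indEdges G W).filter (fun e => v ∈ e), ω e : ℕ) : ℝ) -
                x v * (dIn G W v : ℝ)| ≤ 1e-9 * (dIn G W v : ℝ) ∧
            (({u : V | G.Adj v u ∧ u ∈ W ∧ dIn G W u ≤ dIn G W v ∧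
                sZero G W c x u ∈ Iv G W c x v}).ncard : ℝ) ≤ 0.95 * ell G W v) := by
  refine ⟨10, ?_⟩
  intro V _ _ G _ hΔ hδ W c _ hdeg hc
  classical
  obtain ⟨Z, _, _, X, h, _, hX, hsymm, h01, hsum, hspread⟩ := exists_state_kernel
  have hΔr : (10 : ℝ) ≤ G.maxDegree := by exact_mod_cast hΔ
  have hΔ0 : (0 : ℝ) < G.maxDegree := by linarith
  have hlog1 : 1 ≤ Real.log G.maxDegree := by
    rw [Real.le_log_iff_exp_le hΔ0]
    have := Real.exp_one_lt_d9
    linarith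
  have hdW : ∀ v ∈ W, 0.99e20 * Real.log G.maxDegree ≤ (dIn G W v : ℝ) := by
    intro v hv
    have h1 := hdeg v hv
    have h2 : (G.minDegree : ℝ) ≤ G.degree v := by exact_mod_cast G.minDegree_le_degree v
    linarith
  have hdpos : ∀ v ∈ W, 0 < dIn G W v := by
    intro v hv
    have := hdW v hv
    have h0 : (0 : ℝ) < dIn G W v := by linarith
    exact_mod_cast h0
  have hnot : ∀ v, v ∉ G.neighborFinset v ∩ W := fun v hv => by simp at hv
  let low : V → Finset V := fun v =>
    (G.neighborFinset v ∩ W).filter (fun u => dIn G W u ≤ dIn G W v)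
  let Q : V → V → Z → Z → Prop := fun v u ζ z =>
    c u + X z * (dIn G W u : ℝ) + 3 * ell G W u ∈
      Set.Ico ((⌊(c v + X ζ * (dIn G W v : ℝ) + 3 * ell G W v) / ell G W v⌋ : ℝ) * ell G W v)
        ((⌊(c v + X ζ * (dIn G W v : ℝ) + 3 * ell G W v) / ell G W v⌋ + 1 : ℝ) * ell G W v)
  let y : Z → Z → ℝ := fun ζ z => 1 + 2 * (h ζ z : ℝ) - X ζ
  have hy2 : ∀ ζ z, |y ζ z| ≤ 2 := by
    intro ζ z
    obtain ⟨h1, h2⟩ := hX ζ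
    rw [abs_le]
    rcases h01 ζ z with h3 | h3 <;> simp only [y, h3] <;> constructor <;> norm_num <;> linarith
  let bad : V → (V → Z) → Prop := fun v f => v ∈ W ∧
    (1e-9 * (dIn G W v : ℝ) < |∑ u ∈ G.neighborFinset v ∩ W, y (f v) (f u)| ∨
      0.95 * ell G W v < (((low v).filter (fun u => Q v u (f v) (f u))).card : ℝ))
  have hbad : ∀ v, ∀ P : Finset (V → Z), (∀ f ∈ P, bad v f) →
      (P.card : ℝ) ≤ 3 / (G.maxDegree : ℝ) ^ 4 * Fintype.card (V → Z) := by
    intro v P hP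
    by_cases hv : v ∈ W
    swap
    · have : P = ∅ := Finset.eq_empty_of_forall_notMem fun f hf => hv (hP f hf).1
      subst this
      simp only [Finset.card_empty, Nat.cast_zero]
      positivity
    obtain ⟨l0, l1, l2⟩ := ell_bounds G W v (hdpos v hv)
    have hd := hdW v hv
    have hd0 : (0 : ℝ) < dIn G W v := by exact_mod_cast hdpos v hv
    have small : ∀ r : ℝ, r ≤ -(4 * Real.log G.maxDegree) →
        Real.exp r ≤ 1 / (G.maxDegree : ℝ) ^ 4 := by
      intro r hr
      refine (Real.exp_le_exp.2 hr).trans (le_of_eq ?_)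
      rw [Real.exp_neg, mul_comm, Real.exp_mul, Real.exp_log hΔ0, one_div]
      norm_cast
    let P₁ := P.filter fun f => 1e-9 * (dIn G W v : ℝ) ≤ ∑ u ∈ G.neighborFinset v ∩ W, y (f v) (f u)
    let P₂ := P.filter fun f =>
      1e-9 * (dIn G W v : ℝ) ≤ ∑ u ∈ G.neighborFinset v ∩ W, -y (f v) (f u)
    let P₃ := P.filter fun f =>
      0.95 * ell G W v ≤ (((low v).filter (fun u => Q v u (f v) (f u))).card : ℝ)
    have hcov : P ⊆ P₁ ∪ P₂ ∪ P₃ := by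
      intro f hf
      rcases (hP f hf).2 with h1 | h1
      · rcases lt_abs.1 h1 with h2 | h2
        · exact Finset.mem_union_left _ (Finset.mem_union_left _ (Finset.mem_filter.2 ⟨hf, h2.le⟩))
        · refine Finset.mem_union_left _ (Finset.mem_union_right _ (Finset.mem_filter.2 ⟨hf, ?_⟩))
          rw [Finset.sum_neg_distrib]
          exact h2.le
      · exact Finset.mem_union_right _ (Finset.mem_filter.2 ⟨hf, h1.le⟩)
    have hcardP : (P.card : ℝ) ≤ P₁.card + P₂.card + P₃.card := by
      exact_mod_cast (Finset.card_le_card hcov).trans ((Finset.card_union_le _ _).trans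
        (Nat.add_le_add_right (Finset.card_union_le _ _) _))
    have e₁ : (P₁.card : ℝ) ≤ 1 / (G.maxDegree : ℝ) ^ 4 * Fintype.card (V → Z) := by
      refine (card_le_of_sum_ge v (G.neighborFinset v ∩ W) (hnot v) y hy2
        (fun ζ => (abs_le.1 (hsum ζ)).2) P₁ fun f hf => (Finset.mem_filter.1 hf).2).trans ?_
      gcongr
      refine small _ ?_
      change -6e-20 * (dIn G W v : ℝ) ≤ _
      linarith
    have e₂ : (P₂.card : ℝ) ≤ 1 / (G.maxDegree : ℝ) ^ 4 * Fintype.card (V → Z) := by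
      refine (card_le_of_sum_ge v (G.neighborFinset v ∩ W) (hnot v) (fun ζ z => -y ζ z)
        (fun ζ z => by rw [abs_neg]; exact hy2 ζ z)
        (fun ζ => by
          rw [Finset.sum_neg_distrib]
          have := (abs_le.1 (hsum ζ)).1
          simp only [y]
          linarith) P₂ fun f hf => (Finset.mem_filter.1 hf).2).trans ?_
      gcongr
      refine small _ ?_
      change -6e-20 * (dIn G W v : ℝ) ≤ _
      linarith
    have e₃ : (P₃.card : ℝ) ≤ 1 / (G.maxDegree : ℝ) ^ 4 * Fintype.card (V → Z) := by
      refine (card_le_of_count_gt v (low v) (fun hvl => hnot v (Finset.mem_filter.1 hvl).1) (Q v)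
        (ell G W v) (dIn G W v) l0.le hd0
        (by exact_mod_cast Finset.card_le_card (Finset.filter_subset _ _)) ?_ P₃
        fun f hf => (Finset.mem_filter.1 hf).2).trans ?_
      · intro u hu ζ
        obtain ⟨hu1, hu2⟩ := Finset.mem_filter.1 hu
        obtain ⟨hu3, hu4⟩ := Finset.mem_inter.1 hu1
        obtain ⟨m0, m1, m2⟩ := ell_bounds G W u (hdpos u hu4)
        exact card_states_in_interval_le X hspread (by exact_mod_cast hdpos u hu4)
          (by exact_mod_cast hu2) m1 l0 l2
          (hc u v hu4 hv ((G.mem_neighborFinset _ _).1 hu3).symm hu2) (hX ζ).1 _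
          fun z hz => (Finset.mem_filter.1 hz).2
      · gcongr
        refine small _ ?_
        linarith
    calc (P.card : ℝ) ≤ P₁.card + P₂.card + P₃.card := hcardP
      _ ≤ 1 / (G.maxDegree : ℝ) ^ 4 * Fintype.card (V → Z) +
          1 / (G.maxDegree : ℝ) ^ 4 * Fintype.card (V → Z) +
          1 / (G.maxDegree : ℝ) ^ 4 * Fintype.card (V → Z) := by gcongr
      _ = _ := by ring
  have hΔ4 : (0 : ℝ) < (G.maxDegree : ℝ) ^ 4 := by positivity
  obtain ⟨f, hf⟩ := exists_avoiding_of_local bad (fun v => insert v (G.neighborFinset v))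
    (3 / (G.maxDegree : ℝ) ^ 4) ((G.maxDegree + 1) * (G.maxDegree + 1))
    (by
      intro v f g hfg
      have hv := hfg v (Finset.mem_insert_self _ _)
      have hu : ∀ u ∈ G.neighborFinset v ∩ W, f u = g u := fun u hu =>
        hfg u (Finset.mem_insert_of_mem (Finset.mem_inter.1 hu).1)
      have h1 : ∑ u ∈ G.neighborFinset v ∩ W, y (f v) (f u) =
          ∑ u ∈ G.neighborFinset v ∩ W, y (g v) (g u) :=
        Finset.sum_congr rfl fun u h => by rw [hv, hu u h]
      have h2 : (low v).filter (fun u => Q v u (f v) (f u)) =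
          (low v).filter (fun u => Q v u (g v) (g u)) :=
        Finset.filter_congr fun u h => by rw [hv, hu u (Finset.mem_filter.1 h).1]
      simp only [bad, h1, h2])
    (by positivity)
    (by
      rw [← mul_div_assoc, div_lt_one hΔ4]
      calc (2 : ℝ) * 3 < 10 ^ 4 := by norm_num
        _ ≤ _ := by gcongr)
    (by
      rw [← mul_div_assoc, div_mul_eq_mul_div, div_le_one hΔ4]
      have h1 : (G.maxDegree : ℝ) + 1 ≤ 2 * G.maxDegree := by linarith
      calc (4 : ℝ) * 3 * (((G.maxDegree : ℝ) + 1) * (G.maxDegree + 1))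
          ≤ 4 * 3 * ((2 * G.maxDegree) * (2 * G.maxDegree)) := by gcongr
        _ = 48 * (G.maxDegree : ℝ) ^ 2 := by ring
        _ ≤ 10 ^ 2 * (G.maxDegree : ℝ) ^ 2 := by gcongr; norm_num
        _ ≤ (G.maxDegree : ℝ) ^ 2 * (G.maxDegree : ℝ) ^ 2 := by gcongr
        _ = _ := by ring)
    hbad (fun v => by exact_mod_cast card_filter_not_disjoint_closedNbhd G v)
  refine ⟨fun v => X (f v), Sym2.lift ⟨fun a b => 1 + 2 * h (f a) (f b), fun a b => by
    dsimp only
    rw [hsymm]⟩, fun v _ => hX _, ?_, ?_⟩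
  · intro e _
    induction e using Sym2.ind with
    | _ a b => rcases h01 (f a) (f b) with h1 | h1 <;> simp [h1]
  · intro v hv
    have hv' := hf v
    simp only [bad, hv, true_and, not_or, not_lt] at hv'
    constructor
    · rw [sum_indEdges_filter_mem G W hv]
      refine le_trans (le_of_eq ?_) hv'.1
      simp only [Sym2.lift_mk, y, Finset.sum_sub_distrib, Finset.sum_const, nsmul_eq_mul]
      push_cast
      rw [mul_comm (X (f v))]
      rfl
    · refine le_trans (le_of_eq ?_) hv'.2
      rw [← Set.ncard_coe_finset]
      congr 2
      ext u
      simp only [low, Finset.coe_filter, Finset.mem_filter, Finset.mem_inter,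
        SimpleGraph.mem_neighborFinset, and_assoc]
      rfl
end
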